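/- Fix δ₀ > 0. Then there exist k ∈ ℕ and ε₂ > 0, depending only on δ₀, such that the following holds: for every C₀ > 0 there exists a constant C₁ > 0, depending only on C₀ and δ₀, such that for all N_𝒵 ≥ 0, all finite sets 𝒵₁, …, 𝒵_k with #(𝒵_j) ≤ C₀ N_𝒵, all maps ζ_j : 𝒵_j → [C₀^{-1}, C₀] (j = 1, …, k), and every η ∈ ℝ with |η| > 1, if for every σ ∈ [|η|^{-1}, |η|^{-ε₂}] and every j one has #{(𝐛,𝐜) ∈ 𝒵_j² : |ζ_j(𝐛) − ζ_j(𝐜)| ≤ σ} ≤ C₀ N_𝒵² σ^{δ₀}, then |S_k(η)| ≤ C₁ |η|^{-ε₂}, where S_k(η) := N_𝒵^{-k} Σ_{𝐛₁ ∈ 𝒵₁, …, 𝐛_k ∈ 𝒵_k} exp(2πi η ζ₁(𝐛₁)⋯ζ_k(𝐛_k)). -/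

import Mathlib

section PartNo1

lemma block_sum {ι : Type*} (s : Finset ι) (w d : ι → ℝ) (τ M B : ℝ) (J : ℕ) (hτ : 0 ≤ τ)
    (hB : 1 ≤ B) (hw : ∀ p ∈ s, 0 ≤ w p) (hd : ∀ p ∈ s, 1 ≤ d p)
    (hd2 : ∀ p ∈ s, d p ≤ B ^ J)
    (h : ∀ l : ℝ, 1 ≤ l → ∑ p ∈ s with d p ≤ l, w p ≤ M * l ^ τ) :
    ∑ p ∈ s, w p * (d p) ^ (-τ) ≤ (J + 1) * M * B ^ τ := by
  have hM : 0 ≤ M := by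
    have := h 1 le_rfl
    rw [Real.one_rpow, mul_one] at this
    refine le_trans (Finset.sum_nonneg ?_) this
    intro p hp; exact hw p (Finset.mem_filter.1 hp).1
  have hB0 : 0 < B := by linarith
  have key : ∀ j : ℕ, ∑ p ∈ s with d p ≤ B ^ j, w p * (d p) ^ (-τ) ≤ (j + 1) * M * B ^ τ := by
    intro j
    induction j with
    | zero =>
      have h1 := h 1 le_rfl
      rw [Real.one_rpow, mul_one] at h1
      have h2 : ∑ p ∈ s with d p ≤ B ^ 0, w p * (d p) ^ (-τ) ≤ ∑ p ∈ s with d p ≤ 1, w p := by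
        rw [pow_zero]
        apply Finset.sum_le_sum
        intro p hp
        have hp' := (Finset.mem_filter.1 hp).1
        have : (d p) ^ (-τ) ≤ 1 := Real.rpow_le_one_of_one_le_of_nonpos (hd p hp') (by linarith)
        nlinarith [hw p hp']
      have h3 : M * 1 ≤ M * B ^ τ := mul_le_mul_of_nonneg_left (Real.one_le_rpow hB hτ) hM
      push_cast; linarith
    | succ j ih =>
      have h1 := h (B ^ (j+1)) (one_le_pow₀ hB)
      have hsplit : ∑ p ∈ s with d p ≤ B ^ (j+1), w p * (d p) ^ (-τ)
          ≤ (∑ p ∈ s with d p ≤ B ^ j, w p * (d p) ^ (-τ)) +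
            ∑ p ∈ s with d p ≤ B ^ (j+1), w p * (B ^ j) ^ (-τ) := by
        rw [Finset.sum_filter, Finset.sum_filter, Finset.sum_filter, ← Finset.sum_add_distrib]
        apply Finset.sum_le_sum
        intro p hp
        have hw' := hw p hp
        have hdp := hd p hp
        have e1 : 0 ≤ w p * (d p) ^ (-τ) := by positivity
        have e2 : 0 ≤ w p * (B ^ j) ^ (-τ) := by positivity
        by_cases c1 : d p ≤ B ^ j
        · have c2 : d p ≤ B ^ (j+1) := c1.trans (pow_le_pow_right₀ hB (Nat.le_succ j))
          simp only [c1, c2, if_true]; linarith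
        · by_cases c2 : d p ≤ B ^ (j+1)
          · simp only [c1, c2, if_true, if_false, zero_add]
            apply mul_le_mul_of_nonneg_left _ hw'
            exact Real.rpow_le_rpow_of_nonpos (by positivity) (by push Not at c1; exact c1.le) (by linarith)
          · simp [c1, c2]
      rw [← Finset.sum_mul] at hsplit
      have h4 : (∑ p ∈ s with d p ≤ B ^ (j+1), w p) * (B ^ j) ^ (-τ) ≤ M * B ^ τ := by
        calc _ ≤ (M * (B^(j+1)) ^ τ) * (B ^ j) ^ (-τ) := by gcongr
          _ = M * B ^ τ := by
            rw [pow_succ, Real.mul_rpow (by positivity) (by positivity), Real.rpow_neg (by positivity)]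
            have : (B ^ j) ^ τ ≠ 0 := by positivity
            field_simp
      push_cast; linarith
  have := key J
  rwa [Finset.filter_true_of_mem hd2] at this

lemma card_int_near (A : Finset ℤ) (c R : ℝ) (hR : 0 ≤ R) (h : ∀ x ∈ A, |(x:ℝ) - c| ≤ R) :
    (A.card : ℝ) ≤ 2 * R + 1 := by
  have hsub : A ⊆ Finset.Icc ⌈c - R⌉ ⌊c + R⌋ := by
    intro x hx
    have := abs_le.1 (h x hx)
    rw [Finset.mem_Icc]
    exact ⟨Int.ceil_le.2 (by linarith), Int.le_floor.2 (by linarith)⟩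
  have h1 := Finset.card_le_card hsub
  rw [Int.card_Icc] at h1
  have h2 : (A.card : ℝ) ≤ ((⌊c + R⌋ + 1 - ⌈c - R⌉).toNat : ℝ) := by exact_mod_cast h1
  refine h2.trans ?_
  rcases le_or_gt 0 (⌊c + R⌋ + 1 - ⌈c - R⌉) with h0 | h0
  · have : ((⌊c + R⌋ + 1 - ⌈c - R⌉).toNat : ℝ) = ((⌊c + R⌋ + 1 - ⌈c - R⌉ : ℤ) : ℝ) := by
      exact_mod_cast Int.toNat_of_nonneg h0
    rw [this]; push_cast
    linarith [Int.floor_le (c + R), Int.le_ceil (c - R)]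
  · rw [Int.toNat_of_nonpos h0.le]; simp; linarith

lemma cover_card {β : Type*} (A : Finset ℤ) (Y : Finset β) (φ : β → ℝ) (R : ℝ) (hR : 0 ≤ R)
    (h : ∀ x ∈ A, ∃ y ∈ Y, |(x:ℝ) - φ y| ≤ R) : (A.card : ℝ) ≤ (2 * R + 1) * Y.card := by
  classical
  have hsub : A ⊆ Y.biUnion (fun y => A.filter (fun x : ℤ => |(x:ℝ) - φ y| ≤ R)) := by
    intro x hx
    obtain ⟨y, hy, hxy⟩ := h x hx
    rw [Finset.mem_biUnion]
    exact ⟨y, hy, Finset.mem_filter.2 ⟨hx, hxy⟩⟩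
  have h1 : A.card ≤ ∑ y ∈ Y, (A.filter (fun x : ℤ => |(x:ℝ) - φ y| ≤ R)).card :=
    (Finset.card_le_card hsub).trans Finset.card_biUnion_le
  have h2 : (A.card : ℝ) ≤ ∑ y ∈ Y, ((A.filter (fun x : ℤ => |(x:ℝ) - φ y| ≤ R)).card : ℝ) := by
    exact_mod_cast h1
  refine h2.trans ?_
  calc _ ≤ ∑ y ∈ Y, (2 * R + 1) := by
        apply Finset.sum_le_sum
        intro y hy
        exact card_int_near _ (φ y) R hR (fun x hx => (Finset.mem_filter.1 hx).2)
    _ = _ := by rw [Finset.sum_const, nsmul_eq_mul, mul_comm]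

lemma fiber_card {α β : Type*} [DecidableEq β] (s : Finset α) (f : α → β) (t : Finset β) (L : ℝ)
    (hf : ∀ a ∈ s, f a ∈ t) (h : ∀ b ∈ t, ((s.filter (fun a => f a = b)).card : ℝ) ≤ L) :
    (s.card : ℝ) ≤ L * t.card := by
  rw [Finset.card_eq_sum_card_fiberwise hf]
  push_cast
  calc _ ≤ ∑ b ∈ t, L := Finset.sum_le_sum h
    _ = _ := by rw [Finset.sum_const, nsmul_eq_mul, mul_comm]

lemma card_filter_prod {α β : Type*} (P : Finset α) (Q : Finset β) (r : α → β → Prop)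
    [∀ a b, Decidable (r a b)] :
    ((P ×ˢ Q).filter (fun x => r x.1 x.2)).card = ∑ p ∈ P, (Q.filter (fun q => r p q)).card := by
  rw [Finset.card_filter, Finset.sum_product]
  apply Finset.sum_congr rfl; intro p _; rw [Finset.card_filter]

lemma card_filter_prod' {α β : Type*} (P : Finset α) (Q : Finset β) (r : α → β → Prop)
    [∀ a b, Decidable (r a b)] :
    ((P ×ˢ Q).filter (fun x => r x.1 x.2)).card = ∑ q ∈ Q, (P.filter (fun p => r p q)).card := by
  rw [Finset.card_filter, Finset.sum_product_right]
  apply Finset.sum_congr rfl; intro p _; rw [Finset.card_filter]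

end PartNo1

section PartNo2

open scoped Pointwise

set_option maxHeartbeats 1600000 in
/-- Graph part of Balog–Szemerédi–Gowers. -/
lemma bsg_graph {α β : Type*} (P : Finset α) (Q : Finset β) (r : α → β → Prop)
    [∀ a b, Decidable (r a b)] (L m : ℝ) (hL : 1 ≤ L) (hm : 0 < m)
    (hP : (P.card : ℝ) ≤ m) (hQ : (Q.card : ℝ) ≤ m)
    (hE : m ^ 2 / L ≤ (((P ×ˢ Q).filter (fun x => r x.1 x.2)).card : ℝ)) :
    ∃ P' ⊆ P, ∃ Q' ⊆ Q, m ^ 2 / (24 * L ^ 2) ≤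
        (((P' ×ˢ Q').filter (fun x => r x.1 x.2)).card : ℝ) ∧
      ∀ p ∈ P', ∀ q ∈ Q', m ^ 2 / (6144 * L ^ 5) ≤
        (((P ×ˢ Q).filter (fun x => r p x.2 ∧ r x.1 x.2 ∧ r x.1 q)).card : ℝ) := by
  classical
  have hL0 : 0 < L := by linarith
  set P1 := P.filter (fun p => m / (2 * L) ≤ ((Q.filter (fun q => r p q)).card : ℝ)) with hP1
  set U : β → Finset α := fun q => P1.filter (fun p => r p q) with hU
  set cod : α → α → ℕ := fun p p' => (Q.filter (fun q => r p q ∧ r p' q)).card with hcod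
  set ε := 1 / (256 * L ^ 3) with hε
  set bad : α → α → Prop := fun p p' => (cod p p' : ℝ) < ε * m with hbad
  -- edges in P1
  have e1 : m ^ 2 / (2 * L) ≤ ∑ q ∈ Q, ((U q).card : ℝ) := by
    have a1 : (((P ×ˢ Q).filter (fun x => r x.1 x.2)).card : ℝ)
        = ∑ p ∈ P, ((Q.filter (fun q => r p q)).card : ℝ) := by
      rw [card_filter_prod]; push_cast; rfl
    have a2 : ∑ q ∈ Q, ((U q).card : ℝ) = ∑ p ∈ P1, ((Q.filter (fun q => r p q)).card : ℝ) := by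
      have := card_filter_prod P1 Q r
      rw [card_filter_prod' P1 Q r] at this
      exact_mod_cast this
    have a3 : ∑ p ∈ P, ((Q.filter (fun q => r p q)).card : ℝ) ≤
        ∑ p ∈ P1, ((Q.filter (fun q => r p q)).card : ℝ) + ∑ p ∈ P, m / (2 * L) := by
      rw [hP1, Finset.sum_filter, ← Finset.sum_add_distrib]
      apply Finset.sum_le_sum
      intro p hp
      split_ifs with h
      · have : 0 ≤ m / (2 * L) := by positivity
        linarith
      · linarith
    rw [Finset.sum_const, nsmul_eq_mul] at a3
    have a4 : (P.card : ℝ) * (m / (2 * L)) ≤ m * (m / (2 * L)) := by gcongr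
    have a5 : m * (m / (2 * L)) + m ^ 2 / (2 * L) = m ^ 2 / L := by field_simp; ring
    linarith
  have e2 : m ^ 3 / (4 * L ^ 2) ≤ ∑ q ∈ Q, ((U q).card : ℝ) ^ 2 := by
    have cs := sq_sum_le_card_mul_sum_sq (s := Q) (f := fun q => ((U q).card : ℝ))
    have b1 : (m ^ 2 / (2 * L)) ^ 2 ≤ (∑ q ∈ Q, ((U q).card : ℝ)) ^ 2 := by gcongr
    have b2 : (Q.card : ℝ) * ∑ q ∈ Q, ((U q).card : ℝ) ^ 2 ≤ m * ∑ q ∈ Q, ((U q).card : ℝ) ^ 2 :=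
      mul_le_mul_of_nonneg_right hQ (Finset.sum_nonneg (fun q _ => sq_nonneg _))
    have b3 : (m ^ 2 / (2 * L)) ^ 2 = m * (m ^ 3 / (4 * L ^ 2)) := by field_simp; ring
    have b4 : m * (m ^ 3 / (4 * L ^ 2)) ≤ m * ∑ q ∈ Q, ((U q).card : ℝ) ^ 2 := by linarith
    exact le_of_mul_le_mul_left b4 hm
  set bd : β → ℕ := fun q => (((U q) ×ˢ (U q)).filter (fun x => bad x.1 x.2)).card with hbd
  have e3 : ∑ q ∈ Q, (bd q : ℝ) ≤ ε * m ^ 3 := by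
    have c1 : ∀ q, bd q = ((P1 ×ˢ P1).filter (fun x => bad x.1 x.2 ∧ (r x.1 q ∧ r x.2 q))).card := by
      intro q
      simp only [hbd]
      congr 1
      ext x
      simp only [hU, Finset.mem_filter, Finset.mem_product]
      tauto
    have c2 : ∑ q ∈ Q, bd q = ∑ x ∈ (P1 ×ˢ P1).filter (fun x => bad x.1 x.2), cod x.1 x.2 := by
      simp only [c1, hcod]
      rw [← card_filter_prod ((P1 ×ˢ P1).filter (fun x => bad x.1 x.2)) Q
        (fun x q => r x.1 q ∧ r x.2 q),
        card_filter_prod' ((P1 ×ˢ P1).filter (fun x => bad x.1 x.2)) Q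
        (fun x q => r x.1 q ∧ r x.2 q)]
      apply Finset.sum_congr rfl
      intro q _
      rw [Finset.filter_filter]
    have c3 : (∑ q ∈ Q, (bd q : ℝ)) = ∑ x ∈ (P1 ×ˢ P1).filter (fun x => bad x.1 x.2), (cod x.1 x.2 : ℝ) := by
      exact_mod_cast c2
    rw [c3]
    calc _ ≤ ∑ x ∈ (P1 ×ˢ P1).filter (fun x => bad x.1 x.2), ε * m := by
          apply Finset.sum_le_sum; intro x hx
          exact (Finset.mem_filter.1 hx).2.le
      _ = (((P1 ×ˢ P1).filter (fun x => bad x.1 x.2)).card : ℝ) * (ε * m) := by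
          rw [Finset.sum_const, nsmul_eq_mul]
      _ ≤ (m * m) * (ε * m) := by
          gcongr
          have d1 : ((P1 ×ˢ P1).filter (fun x => bad x.1 x.2)).card ≤ P.card * P.card := by
            refine (Finset.card_filter_le _ _).trans ?_
            rw [Finset.card_product]
            gcongr <;> exact Finset.filter_subset _ _
          calc _ ≤ ((P.card * P.card : ℕ) : ℝ) := by exact_mod_cast d1
            _ ≤ m * m := by push_cast; gcongr
      _ = _ := by ring
  -- choose q
  have e4 : ∃ q ∈ Q, m ^ 2 / (8 * L ^ 2) ≤ ((U q).card : ℝ) ^ 2 - 32 * L * bd q := by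
    by_contra hcon
    push Not at hcon
    have hQne : Q.Nonempty := by
      rw [Finset.nonempty_iff_ne_empty]
      rintro rfl
      simp at hE
      have : 0 < m ^ 2 / L := by positivity
      linarith
    have f1 : ∑ q ∈ Q, (((U q).card : ℝ) ^ 2 - 32 * L * bd q) < ∑ q ∈ Q, m ^ 2 / (8 * L ^ 2) :=
      Finset.sum_lt_sum_of_nonempty hQne hcon
    rw [Finset.sum_sub_distrib, ← Finset.mul_sum, Finset.sum_const, nsmul_eq_mul] at f1
    have f2 : (Q.card : ℝ) * (m ^ 2 / (8 * L ^ 2)) ≤ m * (m ^ 2 / (8 * L ^ 2)) := by gcongr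
    have f3 : 32 * L * ∑ q ∈ Q, (bd q : ℝ) ≤ 32 * L * (ε * m ^ 3) := by gcongr
    have f4 : m ^ 3 / (4 * L ^ 2) = m * (m ^ 2 / (8 * L ^ 2)) + 32 * L * (ε * m ^ 3) := by
      rw [hε]; field_simp; ring
    linarith
  obtain ⟨q0, hq0, hq0'⟩ := e4
  obtain ⟨V, hV⟩ : ∃ V, V = U q0 := ⟨_, rfl⟩
  rw [← hV] at hq0'
  set u : ℝ := (V.card : ℝ) with hu
  have hVP1 : V ⊆ P1 := by rw [hV]; exact Finset.filter_subset _ _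
  have hVP : V ⊆ P := hVP1.trans (Finset.filter_subset _ _)
  have hu0 : 0 ≤ u := by positivity
  have g1 : m ^ 2 / (8 * L ^ 2) ≤ u ^ 2 := by
    have : 0 ≤ 32 * L * (bd q0 : ℝ) := by positivity
    linarith
  have g2 : 32 * L * (bd q0 : ℝ) ≤ u ^ 2 := by
    have : 0 ≤ m ^ 2 / (8 * L ^ 2) := by positivity
    linarith
  have g3 : m / (3 * L) ≤ u := by
    apply le_of_sq_le_sq _ hu0
    refine le_trans ?_ g1
    rw [div_pow]
    apply div_le_div_of_nonneg_left (by positivity) (by positivity)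
    nlinarith [sq_nonneg L]
  have hupos : 0 < u := lt_of_lt_of_le (by positivity) g3
  set P' := V.filter (fun p => ((V.filter (fun p' => bad p p')).card : ℝ) ≤ u / (8 * L)) with hP'
  set Q' := Q.filter (fun q => u / (4 * L) ≤ ((V.filter (fun p => r p q)).card : ℝ)) with hQ'
  have hP'V : P' ⊆ V := Finset.filter_subset _ _
  -- P' large
  have k1 : 3 / 4 * u ≤ (P'.card : ℝ) := by
    have l1 : (bd q0 : ℝ) = ∑ p ∈ V, ((V.filter (fun p' => bad p p')).card : ℝ) := by
      simp only [hbd]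
      rw [← hV, card_filter_prod V V bad]; push_cast; rfl
    have l2 : ∑ p ∈ V, u / (8 * L) ≤ ∑ p ∈ V, ((V.filter (fun p' => bad p p')).card : ℝ) +
        ∑ p ∈ P', u / (8 * L) := by
      rw [hP', Finset.sum_filter, ← Finset.sum_add_distrib]
      apply Finset.sum_le_sum
      intro p hp
      split_ifs with h
      · linarith [Nat.cast_nonneg (α := ℝ) (V.filter (fun p' => bad p p')).card]
      · push Not at h; linarith
    rw [← l1, Finset.sum_const, Finset.sum_const, nsmul_eq_mul, nsmul_eq_mul, ← hu] at l2
    have l3 : u * (u / (8 * L)) * (32 * L) = 4 * u ^ 2 := by field_simp; ring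
    have l4 : (P'.card : ℝ) * (u / (8 * L)) * (32 * L) = 4 * u * P'.card := by field_simp; ring
    have l5 := mul_le_mul_of_nonneg_right l2 (show 0 ≤ 32 * L by positivity)
    rw [add_mul, l3, l4] at l5
    have l6 : 4 * u * (3 / 4 * u) ≤ 4 * u * P'.card := by nlinarith
    exact le_of_mul_le_mul_left l6 (by positivity)
  refine ⟨P', hP'V.trans hVP, Q', Finset.filter_subset _ _, ?_, ?_⟩
  · -- edges
    have n1 : 3 / 4 * u * (m / (2 * L)) ≤ ∑ p ∈ P', ((Q.filter (fun q => r p q)).card : ℝ) := by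
      calc _ ≤ (P'.card : ℝ) * (m / (2 * L)) := by gcongr
        _ = ∑ p ∈ P', m / (2 * L) := by rw [Finset.sum_const, nsmul_eq_mul]
        _ ≤ _ := by
          apply Finset.sum_le_sum; intro p hp
          exact (Finset.mem_filter.1 (hVP1 (hP'V hp))).2
    have n2 : ∑ p ∈ P', ((Q.filter (fun q => r p q)).card : ℝ)
        = ∑ q ∈ Q, ((P'.filter (fun p => r p q)).card : ℝ) := by
      have := card_filter_prod P' Q r
      rw [card_filter_prod' P' Q r] at this
      exact_mod_cast this.symm
    have n3 : (((P' ×ˢ Q').filter (fun x => r x.1 x.2)).card : ℝ)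
        = ∑ q ∈ Q', ((P'.filter (fun p => r p q)).card : ℝ) := by
      rw [card_filter_prod']; push_cast; rfl
    have n4 : ∑ q ∈ Q, ((P'.filter (fun p => r p q)).card : ℝ) ≤
        ∑ q ∈ Q', ((P'.filter (fun p => r p q)).card : ℝ) + ∑ q ∈ Q, u / (4 * L) := by
      rw [hQ', Finset.sum_filter, ← Finset.sum_add_distrib]
      apply Finset.sum_le_sum
      intro q hq
      split_ifs with h
      · have : 0 ≤ u / (4 * L) := by positivity
        linarith
      · push Not at h
        have : ((P'.filter (fun p => r p q)).card : ℝ) ≤ ((V.filter (fun p => r p q)).card : ℝ) := by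
          exact_mod_cast Finset.card_le_card (Finset.filter_subset_filter _ hP'V)
        linarith
    rw [Finset.sum_const, nsmul_eq_mul] at n4
    have n5 : (Q.card : ℝ) * (u / (4 * L)) ≤ m * (u / (4 * L)) := by gcongr
    have n6 : 3 / 4 * u * (m / (2 * L)) - m * (u / (4 * L)) = u * m / (8 * L) := by
      field_simp; ring
    have n7 : m ^ 2 / (24 * L ^ 2) ≤ u * m / (8 * L) := by
      calc m ^ 2 / (24 * L ^ 2) = (m / (3 * L)) * m / (8 * L) := by field_simp; ring
        _ ≤ _ := by gcongr
    rw [n3]; linarith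
  · intro p hp q hq
    have hp2 := (Finset.mem_filter.1 hp).2
    have hq2 := (Finset.mem_filter.1 hq).2
    set G := V.filter (fun p1 => r p1 q ∧ ¬ bad p p1) with hG
    have o1 : u / (8 * L) ≤ (G.card : ℝ) := by
      have : (V.filter (fun p1 => r p1 q)) ⊆ G ∪ V.filter (fun p1 => bad p p1) := by
        intro x hx
        rw [Finset.mem_filter] at hx
        rw [Finset.mem_union, hG, Finset.mem_filter, Finset.mem_filter]
        tauto
      have h1 := (Finset.card_le_card this).trans (Finset.card_union_le _ _)
      have h2 : ((V.filter (fun p1 => r p1 q)).card : ℝ) ≤ G.card + (V.filter (fun p1 => bad p p1)).card := by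
        exact_mod_cast h1
      have h3 : u / (4 * L) = u / (8 * L) + u / (8 * L) := by field_simp; ring
      linarith
    have o2 : (∑ p1 ∈ G, (cod p p1 : ℝ)) ≤
        (((P ×ˢ Q).filter (fun x => r p x.2 ∧ r x.1 x.2 ∧ r x.1 q)).card : ℝ) := by
      have h1 : ((G ×ˢ Q).filter (fun x => r p x.2 ∧ r x.1 x.2)).card = ∑ p1 ∈ G, cod p p1 :=
        card_filter_prod G Q (fun p1 q1 => r p q1 ∧ r p1 q1)
      have h2 : ((G ×ˢ Q).filter (fun x => r p x.2 ∧ r x.1 x.2)) ⊆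
         ((P ×ˢ Q).filter (fun x => r p x.2 ∧ r x.1 x.2 ∧ r x.1 q)) := by
        intro x hx
        simp only [Finset.mem_filter, Finset.mem_product, hG] at hx ⊢
        have := hVP hx.1.1.1
        tauto
      have h3 := Finset.card_le_card h2
      rw [h1] at h3
      exact_mod_cast h3
    refine le_trans ?_ o2
    calc m ^ 2 / (6144 * L ^ 5) = (m / (3 * L)) / (8 * L) * (ε * m) := by
          rw [hε]; field_simp; ring
      _ ≤ u / (8 * L) * (ε * m) := by
          have : 0 ≤ ε * m := by rw [hε]; positivity
          gcongr
      _ ≤ (G.card : ℝ) * (ε * m) := by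
          have : 0 ≤ ε * m := by rw [hε]; positivity
          gcongr
      _ = ∑ p1 ∈ G, ε * m := by rw [Finset.sum_const, nsmul_eq_mul]
      _ ≤ _ := by
          apply Finset.sum_le_sum; intro p1 hp1
          have := (Finset.mem_filter.1 hp1).2.2
          simp only [hbad] at this
          push Not at this
          exact this

lemma bsg {α β : Type*} (P : Finset α) (Q : Finset β) (r : α → β → Prop)
    [∀ a b, Decidable (r a b)] (f : α → ℤ) (g : β → ℤ) (S : Finset ℤ) (L m : ℝ) (hL : 100 ≤ L)
    (hm : 0 < m) (hP : (P.card : ℝ) ≤ m) (hQ : (Q.card : ℝ) ≤ m)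
    (hE : m ^ 2 / L ≤ (((P ×ˢ Q).filter (fun x => r x.1 x.2)).card : ℝ))
    (hf : ∀ z, ((P.filter (fun p => f p = z)).card : ℝ) ≤ L)
    (hg : ∀ z, ((Q.filter (fun p => g p = z)).card : ℝ) ≤ L)
    (hS : ∀ p ∈ P, ∀ q ∈ Q, r p q → f p + g q ∈ S) (hSc : (S.card : ℝ) ≤ L * m) :
    ∃ P' ⊆ P, ∃ Q' ⊆ Q, m ^ 2 / L ^ 3 ≤
        (((P' ×ˢ Q').filter (fun x => r x.1 x.2)).card : ℝ) ∧
        ((P'.image f + Q'.image g).card : ℝ) ≤ L ^ 12 * m := by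
  classical
  obtain ⟨P', hP', Q', hQ', h1, h2⟩ := bsg_graph P Q r L m (by linarith) hm hP hQ hE
  have hL0 : 0 < L := by linarith
  refine ⟨P', hP', Q', hQ', le_trans ?_ h1, ?_⟩
  · apply div_le_div_of_nonneg_left (by positivity) (by positivity)
    nlinarith [sq_nonneg L]
  set X := P'.image f + Q'.image g with hX
  -- each x has many triples
  set T : ℤ → Finset (ℤ × ℤ × ℤ) := fun x => (S ×ˢ S ×ˢ S).filter (fun s => s.1 - s.2.1 + s.2.2 = x)
    with hT
  have t1 : ∀ x ∈ X, m ^ 2 / (6144 * L ^ 7) ≤ ((T x).card : ℝ) := by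
    intro x hx
    rw [hX, Finset.mem_add] at hx
    obtain ⟨a, ha, b, hb, rfl⟩ := hx
    obtain ⟨p, hp, rfl⟩ := Finset.mem_image.1 ha
    obtain ⟨q, hq, rfl⟩ := Finset.mem_image.1 hb
    have h3 := h2 p hp q hq
    have h4 := fiber_card ((P ×ˢ Q).filter (fun x => r p x.2 ∧ r x.1 x.2 ∧ r x.1 q))
      (fun x => ((f p + g x.2, f x.1 + g x.2, f x.1 + g q) : ℤ × ℤ × ℤ)) (T (f p + g q)) (L ^ 2)
      (by
        intro y hy
        simp only [Finset.mem_filter, Finset.mem_product] at hy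
        simp only [hT, Finset.mem_filter, Finset.mem_product]
        refine ⟨⟨hS _ (hP' hp) _ hy.1.2 hy.2.1, hS _ hy.1.1 _ hy.1.2 hy.2.2.1,
          hS _ hy.1.1 _ (hQ' hq) hy.2.2.2⟩, by ring⟩)
      (by
        intro s _
        have : (((P ×ˢ Q).filter (fun x => r p x.2 ∧ r x.1 x.2 ∧ r x.1 q)).filter
           (fun x => ((f p + g x.2, f x.1 + g x.2, f x.1 + g q) : ℤ × ℤ × ℤ) = s)) ⊆
           (P.filter (fun p1 => f p1 = s.2.2 - g q)) ×ˢ (Q.filter (fun q1 => g q1 = s.1 - f p)) := by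
          intro y hy
          simp only [Finset.mem_filter, Finset.mem_product] at hy ⊢
          obtain ⟨⟨⟨y1, y2⟩, _⟩, rfl⟩ := hy
          refine ⟨⟨y1, by simp⟩, y2, by simp⟩
        have h5 := Finset.card_le_card this
        rw [Finset.card_product] at h5
        calc _ ≤ (((P.filter (fun p1 => f p1 = s.2.2 - g q)).card * (Q.filter (fun q1 => g q1 = s.1 - f p)).card : ℕ) : ℝ) := by exact_mod_cast h5
          _ ≤ L * L := by push_cast; gcongr; exact hf _; exact hg _
          _ = L ^ 2 := by ring)
    have h6 : L ^ 2 * (m ^ 2 / (6144 * L ^ 7)) ≤ L ^ 2 * ((T (f p + g q)).card : ℝ) := by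
      refine le_trans (le_of_eq ?_) (h3.trans h4)
      field_simp
    exact le_of_mul_le_mul_left h6 (by positivity)
  have t2 : ∑ x ∈ X, (T x).card ≤ (S ×ˢ S ×ˢ S).card := by
    have := Finset.card_eq_sum_card_fiberwise (f := fun s : ℤ × ℤ × ℤ => s.1 - s.2.1 + s.2.2)
      (s := (S ×ˢ S ×ˢ S).filter (fun s => s.1 - s.2.1 + s.2.2 ∈ X)) (t := X)
      (by intro s hs; simp at hs; exact hs.2)
    calc _ = ∑ x ∈ X, (((S ×ˢ S ×ˢ S).filter (fun s => s.1 - s.2.1 + s.2.2 ∈ X)).filter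
          (fun s => s.1 - s.2.1 + s.2.2 = x)).card := by
            apply Finset.sum_congr rfl
            intro x hx
            congr 1
            ext s
            simp only [hT, Finset.mem_filter]
            constructor
            · rintro ⟨a, b⟩; exact ⟨⟨a, by rw [b]; exact hx⟩, b⟩
            · rintro ⟨⟨a, _⟩, b⟩; exact ⟨a, b⟩
      _ = _ := this.symm
      _ ≤ _ := Finset.card_filter_le _ _
  have t3 : (X.card : ℝ) * (m ^ 2 / (6144 * L ^ 7)) ≤ (L * m) ^ 3 := by
    calc _ = ∑ x ∈ X, m ^ 2 / (6144 * L ^ 7) := by rw [Finset.sum_const, nsmul_eq_mul]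
      _ ≤ ∑ x ∈ X, ((T x).card : ℝ) := Finset.sum_le_sum t1
      _ ≤ ((S ×ˢ S ×ˢ S).card : ℝ) := by exact_mod_cast t2
      _ = (S.card : ℝ) ^ 3 := by rw [Finset.card_product, Finset.card_product]; push_cast; ring
      _ ≤ _ := by gcongr
  have t4 : (X.card : ℝ) ≤ 6144 * L ^ 10 * m := by
    have : (X.card : ℝ) * (m ^ 2 / (6144 * L ^ 7)) ≤ (6144 * L ^ 10 * m) * (m ^ 2 / (6144 * L ^ 7)) := by
      refine t3.trans (le_of_eq ?_)
      field_simp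
    exact le_of_mul_le_mul_right this (by positivity)
  refine t4.trans ?_
  have : (6144 : ℝ) ≤ L ^ 2 := by nlinarith
  calc 6144 * L ^ 10 * m ≤ L ^ 2 * L ^ 10 * m := by gcongr
    _ = _ := by ring

end PartNo2

section PartNo3

open scoped Pointwise

/-- Integer dilation of a finite set of integers. -/
noncomputable def dil (t : ℝ) (A : Finset ℤ) : Finset ℤ := A.image (fun a : ℤ => ⌊t * (a : ℝ)⌋)

lemma mem_dil {t : ℝ} {A : Finset ℤ} {z : ℤ} : z ∈ dil t A ↔ ∃ a ∈ A, ⌊t * (a : ℝ)⌋ = z := by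
  simp [dil]

lemma dil_one (A : Finset ℤ) : dil 1 A = A := by
  ext z; simp [mem_dil]

lemma plun (A B : Finset ℤ) (hA : A.Nonempty) (K : ℝ) (h : ((A + B).card : ℝ) ≤ K * A.card)
    (m n : ℕ) : ((m • B - n • B).card : ℝ) ≤ K ^ (m + n) * A.card := by
  have h1 := Finset.pluennecke_ruzsa_inequality_nsmul_sub_nsmul_add hA B m n
  have h2 : ((m • B - n • B).card : ℝ) ≤ (((A + B).card : ℝ) / A.card) ^ (m + n) * A.card := by
    have h3 := (NNRat.cast_le (K := ℝ)).2 h1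
    push_cast at h3
    exact h3
  have hA' : (0 : ℝ) < A.card := by exact_mod_cast hA.card_pos
  refine h2.trans ?_
  gcongr
  rw [div_le_iff₀ hA']; exact h

lemma plun0 (A B : Finset ℤ) (hA : A.Nonempty) (K : ℝ) (h : ((A + B).card : ℝ) ≤ K * A.card)
    (m : ℕ) : ((m • B).card : ℝ) ≤ K ^ m * A.card := by
  have := plun A B hA K h m 0
  simpa using this

lemma floor_close (x : ℝ) : |(⌊x⌋ : ℝ) - x| ≤ 1 := by
  rw [abs_le]; constructor <;> linarith [Int.floor_le x, Int.lt_floor_add_one x]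

structure GK (X : Finset ℤ) (y0 : ℤ) (L η κ : ℝ) : Prop where
  hL : 100 ≤ L
  hη : 1 ≤ η
  κ0 : 0 < κ
  κ1 : κ ≤ 1
  bd : ∀ x ∈ X, |(x : ℝ)| ≤ L * η
  y0mem : y0 ∈ X
  y0big : η / L ≤ |(y0 : ℝ)|
  big : η ^ κ / L ≤ X.card
  loc : ∀ a l : ℝ, 1 ≤ l → ((X.filter (fun x : ℤ => |(x : ℝ) - a| ≤ l)).card : ℝ) ≤ L * l ^ κ
  sums : ∀ y ∈ X, ((X + dil ((y : ℝ) / y0) X).card : ℝ) ≤ L * η ^ κ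

section
variable {X : Finset ℤ} {y0 : ℤ} {L η κ : ℝ}

lemma GK.npos (h : GK X y0 L η κ) : 0 < η ^ κ := Real.rpow_pos_of_pos (by linarith [h.hη]) _

lemma GK.n_le (h : GK X y0 L η κ) : η ^ κ ≤ L * X.card := by
  have := h.big
  have hL := h.hL
  rw [div_le_iff₀ (by linarith)] at this
  linarith

lemma GK.y0ne (h : GK X y0 L η κ) : (y0 : ℝ) ≠ 0 := by
  intro h0
  have := h.y0big
  have hL := h.hL
  have hη := h.hη
  rw [h0, abs_zero] at this
  have : 0 < η / L := div_pos (by linarith) (by linarith)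
  linarith

set_option maxHeartbeats 1000000 in
lemma GK.diff (h : GK X y0 L η κ) (y y' : ℤ) (hy : y ∈ X) (hy' : y' ∈ X) :
    ((X + dil (((y - y' : ℤ) : ℝ) / y0) X).card : ℝ) ≤ L ^ 10 * η ^ κ := by
  have hL := h.hL
  have hn := h.npos
  have hne := h.y0ne
  set B := X ∪ dil ((y : ℝ) / y0) X ∪ dil ((y' : ℝ) / y0) X with hB
  have hXX : ((X + X).card : ℝ) ≤ L * η ^ κ := by
    have := h.sums y0 h.y0mem
    rwa [div_self hne, dil_one] at this
  have h1 : ((X + B).card : ℝ) ≤ (3 * L ^ 2) * X.card := by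
    have e : X + B = (X + X) ∪ (X + dil ((y : ℝ) / y0) X) ∪ (X + dil ((y' : ℝ) / y0) X) := by
      rw [hB, Finset.add_union, Finset.add_union]
    have c : (X + B).card ≤ (X + X).card + (X + dil ((y : ℝ) / y0) X).card + (X + dil ((y' : ℝ) / y0) X).card := by
      rw [e]
      refine (Finset.card_union_le _ _).trans ?_
      gcongr
      exact Finset.card_union_le _ _
    have c' : ((X + B).card : ℝ) ≤ (X + X).card + (X + dil ((y : ℝ) / y0) X).card + (X + dil ((y' : ℝ) / y0) X).card := by
      exact_mod_cast c
    have := h.sums y hy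
    have := h.sums y' hy'
    have := h.n_le
    nlinarith
  have hne' : X.Nonempty := ⟨y0, h.y0mem⟩
  have h2 := plun X B hne' _ h1 2 1
  have hXc : (X.card : ℝ) ≤ L * η ^ κ := by
    refine le_trans ?_ hXX
    exact_mod_cast Finset.card_le_card_add_right hne'
  have h3 := cover_card (X + dil (((y - y' : ℤ) : ℝ) / y0) X) (2 • B - 1 • B) (fun z : ℤ => (z : ℝ)) 3 (by norm_num)
    (by
      intro z hz
      obtain ⟨a, ha, b, hb, rfl⟩ := Finset.mem_add.1 hz
      obtain ⟨d, hd, rfl⟩ := mem_dil.1 hb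
      refine ⟨a + ⌊((y : ℝ) / y0) * d⌋ - ⌊((y' : ℝ) / y0) * d⌋, ?_, ?_⟩
      · rw [two_nsmul, one_nsmul]
        refine Finset.sub_mem_sub (Finset.add_mem_add ?_ ?_) ?_
        · simp [hB, ha]
        · rw [hB, Finset.mem_union, Finset.mem_union]; left; right; exact mem_dil.2 ⟨d, hd, rfl⟩
        · rw [hB, Finset.mem_union, Finset.mem_union]; right; exact mem_dil.2 ⟨d, hd, rfl⟩
      · push_cast
        have e : ((y : ℝ) - y') / y0 * d = (y : ℝ) / y0 * d - (y' : ℝ) / y0 * d := by field_simp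
        rw [e]
        have f1 := abs_le.1 (floor_close ((y : ℝ) / y0 * d - (y' : ℝ) / y0 * d))
        have f2 := abs_le.1 (floor_close ((y : ℝ) / y0 * d))
        have f3 := abs_le.1 (floor_close ((y' : ℝ) / y0 * d))
        rw [abs_le]
        constructor <;> linarith)
  calc _ ≤ (2 * 3 + 1) * ((2 • B - 1 • B).card : ℝ) := h3
    _ ≤ (2 * 3 + 1) * ((3 * L ^ 2) ^ 3 * (L * η ^ κ)) := by
        gcongr
        exact h2.trans (by gcongr)
    _ = 189 * (L ^ 7 * η ^ κ) := by ring
    _ ≤ L ^ 3 * (L ^ 7 * η ^ κ) := by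
        gcongr
        calc (189 : ℝ) ≤ 100 ^ 3 := by norm_num
          _ ≤ L ^ 3 := by gcongr
    _ = _ := by ring

set_option maxHeartbeats 1000000 in
lemma GK.local' (h : GK X y0 L η κ) (t s : ℝ) (hs : |s| ≤ 2 * |t|) (h1 : 1 ≤ |t| * η)
    (ht : ((X + dil t X).card : ℝ) ≤ L ^ 10 * η ^ κ)
    (hsc : ((X + dil s X).card : ℝ) ≤ L ^ 10 * η ^ κ) (m : ℕ) :
    ((m • (dil t X ∪ dil s X)).card : ℝ) ≤ L ^ (14 * m + 1) * (|t| * η) ^ κ := by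
  classical
  have hL := h.hL
  have hn := h.npos
  have hη := h.hη
  set W := dil t X ∪ dil s X with hW
  set H := |t| * η with hH
  have hXW : ((X + W).card : ℝ) ≤ 2 * L ^ 10 * η ^ κ := by
    have : (X + W).card ≤ (X + dil t X).card + (X + dil s X).card := by
      rw [hW, Finset.add_union]; exact Finset.card_union_le _ _
    have : ((X + W).card : ℝ) ≤ (X + dil t X).card + (X + dil s X).card := by exact_mod_cast this
    linarith
  have hWb : ∀ w ∈ W, |(w : ℝ)| ≤ 3 * L * H := by
    intro w hw
    have key : ∀ r : ℝ, |r| ≤ 2 * |t| → w ∈ dil r X → |(w : ℝ)| ≤ 3 * L * H := by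
      intro r hr hw
      obtain ⟨a, ha, rfl⟩ := mem_dil.1 hw
      have e1 := floor_close (r * a)
      have e2 : |r * a| ≤ 2 * |t| * (L * η) := by
        rw [abs_mul]; exact mul_le_mul hr (h.bd a ha) (abs_nonneg _) (by positivity)
      have e3 : |(⌊r * a⌋ : ℝ)| ≤ 1 + |r * a| := by
        have := abs_add_le ((⌊r * a⌋ : ℝ) - r * a) (r * a)
        rw [sub_add_cancel] at this
        linarith
      have e4 : 2 * |t| * (L * η) = 2 * (L * H) := by rw [hH]; ring
      nlinarith
    rw [hW, Finset.mem_union] at hw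
    rcases hw with hw | hw
    · exact key t (by linarith [abs_nonneg t]) hw
    · exact key s hs hw
  set c : ℤ → ℤ := fun x => ⌊(x : ℝ) / H⌋ with hc
  set C := X.image c with hC
  set Xc : ℤ → Finset ℤ := fun k => X.filter (fun x => c x = k) with hXc
  have hH0 : 0 < H := by linarith
  have hsum : ∑ k ∈ C, ((Xc k + W).card : ℝ) ≤ (6 * L + 3) * (X + W).card := by
    have s1 : ∑ k ∈ C, (Xc k + W).card = ((C ×ˢ (X + W)).filter (fun x => x.2 ∈ Xc x.1 + W)).card := by
      rw [card_filter_prod C (X + W) (fun k z => z ∈ Xc k + W)]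
      apply Finset.sum_congr rfl
      intro k _
      congr 1
      ext z
      simp only [Finset.mem_filter]
      constructor
      · intro hz
        exact ⟨Finset.add_subset_add_right (Finset.filter_subset _ _) hz, hz⟩
      · exact fun hz => hz.2
    rw [card_filter_prod' C (X + W) (fun k z => z ∈ Xc k + W)] at s1
    have s2 : ∑ k ∈ C, ((Xc k + W).card : ℝ) = ∑ z ∈ X + W, ((C.filter (fun k => z ∈ Xc k + W)).card : ℝ) := by
      exact_mod_cast s1
    rw [s2]
    calc _ ≤ ∑ z ∈ X + W, (6 * L + 3) := by
          apply Finset.sum_le_sum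
          intro z _
          have := card_int_near (C.filter (fun k => z ∈ Xc k + W)) ((z : ℝ) / H) (3 * L + 1) (by linarith)
            (by
              intro k hk
              obtain ⟨x, hx, w, hw, hz⟩ := Finset.mem_add.1 (Finset.mem_filter.1 hk).2
              have hk2 : ⌊(x : ℝ) / H⌋ = k := (Finset.mem_filter.1 hx).2
              have f1 := floor_close ((x : ℝ) / H)
              rw [hk2] at f1
              have f2 := hWb w hw
              have f3 : |(w : ℝ) / H| ≤ 3 * L := by
                rw [abs_div, abs_of_pos hH0, div_le_iff₀ hH0]; exact f2
              have e : (k : ℝ) - z / H = (k - x / H) - w / H := by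
                rw [← hz]; push_cast; field_simp; ring
              rw [e]
              refine (abs_sub _ _).trans ?_
              linarith)
          linarith
      _ = _ := by rw [Finset.sum_const, nsmul_eq_mul, mul_comm]
  have hXsum : (X.card : ℝ) = ∑ k ∈ C, ((Xc k).card : ℝ) := by
    have := Finset.card_eq_sum_card_image c X
    exact_mod_cast this
  have hex : ∃ k ∈ C, ((Xc k + W).card : ℝ) ≤ L ^ 14 * (Xc k).card := by
    by_contra hcon
    push Not at hcon
    have hCne : C.Nonempty := ⟨c y0, Finset.mem_image_of_mem _ h.y0mem⟩
    have l1 := Finset.sum_lt_sum_of_nonempty hCne hcon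
    rw [← Finset.mul_sum, ← hXsum] at l1
    have l2 : L ^ 14 * (X.card : ℝ) < (6 * L + 3) * (2 * L ^ 10 * (L * X.card)) := by
      calc _ < _ := l1
        _ ≤ _ := hsum
        _ ≤ (6 * L + 3) * (2 * L ^ 10 * η ^ κ) := by gcongr
        _ ≤ _ := by
          have := h.n_le
          gcongr
    have hXp : (0 : ℝ) < X.card := by
      exact_mod_cast Finset.card_pos.2 ⟨y0, h.y0mem⟩
    have l3 : (6 * L + 3) * (2 * L ^ 10 * (L * X.card)) ≤ L ^ 14 * (X.card : ℝ) := by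
      have : (6 * L + 3) * 2 ≤ L ^ 3 := by nlinarith [sq_nonneg L, mul_nonneg (sq_nonneg L) (by linarith : 0 ≤ L - 100)]
      calc (6 * L + 3) * (2 * L ^ 10 * (L * X.card)) = ((6 * L + 3) * 2) * (L ^ 11 * X.card) := by ring
        _ ≤ L ^ 3 * (L ^ 11 * X.card) := by gcongr
        _ = _ := by ring
    linarith
  obtain ⟨k, hk, hkc⟩ := hex
  have hne : (Xc k).Nonempty := by
    obtain ⟨x, hx, hxk⟩ := Finset.mem_image.1 hk
    exact ⟨x, Finset.mem_filter.2 ⟨hx, hxk⟩⟩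
  have hXck : ((Xc k).card : ℝ) ≤ L * H ^ κ := by
    refine le_trans ?_ (h.loc (k * H) H h1)
    have : Xc k ⊆ X.filter (fun x : ℤ => |(x : ℝ) - k * H| ≤ H) := by
      intro x hx
      obtain ⟨hx1, hx2⟩ := Finset.mem_filter.1 hx
      refine Finset.mem_filter.2 ⟨hx1, ?_⟩
      have f1 := floor_close ((x : ℝ) / H)
      have hk2 : ⌊(x : ℝ) / H⌋ = k := hx2
      rw [hk2] at f1
      have : (x : ℝ) - k * H = -(k - x / H) * H := by field_simp; ring
      rw [this, abs_mul, abs_neg, abs_of_pos hH0]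
      nlinarith
    exact_mod_cast Finset.card_le_card this
  have := plun0 (Xc k) W hne _ hkc m
  calc _ ≤ _ := this
    _ ≤ (L ^ 14) ^ m * (L * H ^ κ) := by gcongr
    _ = _ := by rw [← pow_mul]; ring
end

end PartNo3

section PartNo4

open scoped Pointwise

def inQ (X : Finset ℤ) (R q : ℝ) : Prop :=
  ∃ u1 ∈ X, ∃ u2 ∈ X, ∃ v1 ∈ X, ∃ v2 ∈ X, R ≤ |((v1 - v2 : ℤ) : ℝ)| ∧
    q = ((u1 - u2 : ℤ) : ℝ) / ((v1 - v2 : ℤ) : ℝ)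

section
variable {X : Finset ℤ} {y0 : ℤ} {L η κ : ℝ}

lemma GK.tbounds (h : GK X y0 L η κ) (R : ℝ) (hR : L ≤ R) (v1 v2 : ℤ) (h1 : v1 ∈ X) (h2 : v2 ∈ X)
    (hv : R ≤ |((v1 - v2 : ℤ) : ℝ)|) :
    R / (L * η) ≤ |((v1 - v2 : ℤ) : ℝ) / y0| ∧ |((v1 - v2 : ℤ) : ℝ) / y0| ≤ 2 * L ^ 2 ∧
     1 ≤ |((v1 - v2 : ℤ) : ℝ) / y0| * η := by
  have hL := h.hL
  have hη := h.hη
  have hy := abs_pos.2 h.y0ne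
  have hyb := h.bd y0 h.y0mem
  have hyl := h.y0big
  have a1 : R / (L * η) ≤ |((v1 - v2 : ℤ) : ℝ) / y0| := by
    rw [abs_div]
    apply div_le_div₀ (abs_nonneg _) hv hy hyb
  refine ⟨a1, ?_, ?_⟩
  · rw [abs_div, div_le_iff₀ hy]
    have b1 : |((v1 - v2 : ℤ) : ℝ)| ≤ 2 * L * η := by
      push_cast
      have := abs_sub (v1 : ℝ) v2
      have := h.bd v1 h1
      have := h.bd v2 h2
      linarith
    have b2 : 2 * L ^ 2 * (η / L) = 2 * L * η := by field_simp
    have b3 : 2 * L ^ 2 * (η / L) ≤ 2 * L ^ 2 * |(y0 : ℝ)| := by gcongr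
    linarith
  · have : R / (L * η) * η ≤ |((v1 - v2 : ℤ) : ℝ) / y0| * η := by gcongr
    have e : R / (L * η) * η = R / L := by field_simp
    have : 1 ≤ R / L := by rw [le_div_iff₀ (by linarith)]; linarith
    linarith

set_option maxHeartbeats 1000000 in
lemma GK.Vcard (h : GK X y0 L η κ) (t s : ℝ) (hs : |s| ≤ 2 * |t|) (h1 : 1 ≤ |t| * η)
    (ht : ((X + dil t X).card : ℝ) ≤ L ^ 10 * η ^ κ)
    (hsc : ((X + dil s X).card : ℝ) ≤ L ^ 10 * η ^ κ) (b : ℝ) (hb : b = 0 ∨ b = 1) :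
    (((X ×ˢ X).image (fun p : ℤ × ℤ => ⌊2 * t * (p.1 : ℝ)⌋ + ⌊(s + b * t) * (p.2 : ℝ)⌋)).card : ℝ)
      ≤ L ^ 58 * (|t| * η) ^ κ := by
  classical
  have hL := h.hL
  have hL1 : 1 ≤ L := by linarith
  have hloc := h.local' t s hs h1 ht hsc
  set W := dil t X ∪ dil s X with hW
  have hpos : 0 < (|t| * η) ^ κ := Real.rpow_pos_of_pos (by linarith) _
  have hWt : ∀ a ∈ X, ⌊t * (a : ℝ)⌋ ∈ W := fun a ha =>
    Finset.mem_union_left _ (mem_dil.2 ⟨a, ha, rfl⟩)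
  have hWs : ∀ a ∈ X, ⌊s * (a : ℝ)⌋ ∈ W := fun a ha =>
    Finset.mem_union_right _ (mem_dil.2 ⟨a, ha, rfl⟩)
  have key : ∃ m : ℕ, m ≤ 4 ∧ (((X ×ˢ X).image (fun p : ℤ × ℤ => ⌊2 * t * (p.1 : ℝ)⌋ + ⌊(s + b * t) * (p.2 : ℝ)⌋)).card : ℝ)
      ≤ (2 * 7 + 1) * ((m • W).card : ℝ) := by
    rcases hb with rfl | rfl
    · refine ⟨3, by norm_num, ?_⟩
      apply cover_card _ (3 • W) (fun z : ℤ => (z : ℝ)) 7 (by norm_num)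
      intro z hz
      obtain ⟨⟨a, d⟩, hp, rfl⟩ := Finset.mem_image.1 hz
      rw [Finset.mem_product] at hp
      refine ⟨⌊t * (a : ℝ)⌋ + ⌊t * (a : ℝ)⌋ + ⌊s * (d : ℝ)⌋, ?_, ?_⟩
      · rw [show 3 • W = W + W + W by rw [succ_nsmul, two_nsmul]]
        exact Finset.add_mem_add (Finset.add_mem_add (hWt _ hp.1) (hWt _ hp.1)) (hWs _ hp.2)
      · have f1 := abs_le.1 (floor_close (2 * t * (a : ℝ)))
        have f2 := abs_le.1 (floor_close (t * (a : ℝ)))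
        have f3 := abs_le.1 (floor_close ((s + 0 * t) * (d : ℝ)))
        have f4 := abs_le.1 (floor_close (s * (d : ℝ)))
        push_cast
        rw [abs_le]
        constructor <;> linarith
    · refine ⟨4, by norm_num, ?_⟩
      apply cover_card _ (4 • W) (fun z : ℤ => (z : ℝ)) 7 (by norm_num)
      intro z hz
      obtain ⟨⟨a, d⟩, hp, rfl⟩ := Finset.mem_image.1 hz
      rw [Finset.mem_product] at hp
      refine ⟨⌊t * (a : ℝ)⌋ + ⌊t * (a : ℝ)⌋ + ⌊s * (d : ℝ)⌋ + ⌊t * (d : ℝ)⌋, ?_, ?_⟩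
      · rw [show 4 • W = W + W + W + W by rw [succ_nsmul, succ_nsmul, two_nsmul]]
        exact Finset.add_mem_add (Finset.add_mem_add (Finset.add_mem_add (hWt _ hp.1) (hWt _ hp.1)) (hWs _ hp.2)) (hWt _ hp.2)
      · have f1 := abs_le.1 (floor_close (2 * t * (a : ℝ)))
        have f2 := abs_le.1 (floor_close (t * (a : ℝ)))
        have f3 := abs_le.1 (floor_close ((s + 1 * t) * (d : ℝ)))
        have f4 := abs_le.1 (floor_close (s * (d : ℝ)))
        have f5 := abs_le.1 (floor_close (t * (d : ℝ)))
        push_cast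
        rw [abs_le]
        constructor <;> linarith
  obtain ⟨m, hm, hcard⟩ := key
  calc _ ≤ _ := hcard
    _ ≤ (2 * 7 + 1) * (L ^ (14 * m + 1) * (|t| * η) ^ κ) := by gcongr; exact hloc m
    _ ≤ (2 * 7 + 1) * (L ^ 57 * (|t| * η) ^ κ) := by
        gcongr
        omega
    _ ≤ L * (L ^ 57 * (|t| * η) ^ κ) := by gcongr; linarith
    _ = _ := by ring

set_option maxHeartbeats 1000000 in
lemma GK.closure (h : GK X y0 L η κ) (R : ℝ) (hR : L ≤ R) (hRκ : 2 * L ^ 64 * R ^ κ < η ^ κ)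
    (q : ℝ) (hq : inQ X R q) (hq2 : |q| ≤ 2) (b : ℝ) (hb : b = 0 ∨ b = 1) :
    ∃ q', inQ X R q' ∧ |(q + b) / 2 - q'| ≤ L * η / R ^ 2 := by
  classical
  by_contra hcon
  push Not at hcon
  obtain ⟨u1, hu1, u2, hu2, v1, hv1, v2, hv2, hv, rfl⟩ := hq
  have hL := h.hL
  have hη := h.hη
  have hn := h.npos
  have hκ := h.κ0
  have hκ1 := h.κ1
  have hR0 : 0 < R := by linarith
  obtain ⟨t1, t2, t3⟩ := h.tbounds R hR v1 v2 hv1 hv2 hv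
  have dv := h.diff v1 v2 hv1 hv2
  have du := h.diff u1 u2 hu1 hu2
  set u : ℝ := ((u1 - u2 : ℤ) : ℝ)
  set v : ℝ := ((v1 - v2 : ℤ) : ℝ)
  have hv0 : v ≠ 0 := by
    intro h0; rw [h0, abs_zero] at hv; linarith
  have hy0 := h.y0ne
  set t := v / y0 with ht
  set s := u / y0 with hs
  have ht0 : t ≠ 0 := div_ne_zero hv0 hy0
  set r := |t| with hr
  have hr0 : 0 < r := abs_pos.2 ht0
  have hsu : u / v = s / t := by rw [hs, ht]; field_simp
  rw [hsu] at hq2 hcon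
  have hst : |s| ≤ 2 * r := by
    rw [abs_div, div_le_iff₀ hr0] at hq2; exact hq2
  have hV := h.Vcard t s hst t3 dv du b hb
  set φ : ℤ × ℤ → ℤ := fun p : ℤ × ℤ => ⌊2 * t * (p.1 : ℝ)⌋ + ⌊(s + b * t) * (p.2 : ℝ)⌋ with hφ
  set x := (s / t + b) / 2 with hx
  have hxt : s + b * t = 2 * t * x := by rw [hx]; field_simp
  have hs1 : 1 / (r * R) ≤ L * η / R ^ 2 := by
    rw [div_le_div_iff₀ (by positivity) (by positivity)]
    rw [div_le_iff₀ (by positivity)] at t1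
    nlinarith
  have hr1 : 1 ≤ 2 * L ^ 2 / r := by rw [le_div_iff₀ hr0]; linarith
  have hfib : ∀ z ∈ (X ×ˢ X).image φ, (((X ×ˢ X).filter (fun p => φ p = z)).card : ℝ) ≤
      L * (2 * L ^ 2 / r) ^ κ * (L * R ^ κ) := by
    intro z hz
    obtain ⟨⟨a0, d0⟩, hp0, rfl⟩ := Finset.mem_image.1 hz
    have hcol : ∀ p ∈ (X ×ˢ X).filter (fun p => φ p = φ (a0, d0)),
        |((p.1 : ℝ) - a0) + x * ((p.2 : ℝ) - d0)| ≤ 1 / r := by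
      rintro ⟨a, d⟩ hp
      have e := (Finset.mem_filter.1 hp).2
      simp only [hφ] at e
      have e' : (⌊2 * t * (a : ℝ)⌋ : ℝ) + ⌊(s + b * t) * (d : ℝ)⌋ = ⌊2 * t * (a0 : ℝ)⌋ + ⌊(s + b * t) * (d0 : ℝ)⌋ := by
        exact_mod_cast e
      rw [hxt] at e'
      have f1 := Int.floor_le (2 * t * (a : ℝ))
      have f2 := Int.lt_floor_add_one (2 * t * (a : ℝ))
      have f3 := Int.floor_le (2 * t * x * (d : ℝ))
      have f4 := Int.lt_floor_add_one (2 * t * x * (d : ℝ))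
      have f5 := Int.floor_le (2 * t * (a0 : ℝ))
      have f6 := Int.lt_floor_add_one (2 * t * (a0 : ℝ))
      have f7 := Int.floor_le (2 * t * x * (d0 : ℝ))
      have f8 := Int.lt_floor_add_one (2 * t * x * (d0 : ℝ))
      have g : |2 * t * (((a : ℝ) - a0) + x * ((d : ℝ) - d0))| ≤ 2 := by
        rw [abs_le]; constructor <;> linarith
      rw [abs_mul, abs_mul, abs_two] at g
      simp only
      rw [le_div_iff₀ hr0]
      linarith
    have hd : ∀ p ∈ (X ×ˢ X).filter (fun p => φ p = φ (a0, d0)),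
        p.2 ∈ X.filter (fun d : ℤ => |(d : ℝ) - d0| ≤ R) := by
      rintro ⟨a, d⟩ hp
      have c := hcol _ hp
      simp only at c ⊢
      obtain ⟨hp1, _⟩ := Finset.mem_filter.1 hp
      rw [Finset.mem_product] at hp1 hp0
      refine Finset.mem_filter.2 ⟨hp1.2, ?_⟩
      by_contra hlt
      push Not at hlt
      have hd0 : (d : ℝ) - d0 ≠ 0 := by
        intro h0; rw [h0, abs_zero] at hlt; linarith
      have := hcon (((a0 - a : ℤ) : ℝ) / ((d - d0 : ℤ) : ℝ))
        ⟨a0, hp0.1, a, hp1.1, d, hp1.2, d0, hp0.2, by push_cast; exact hlt.le, rfl⟩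
      push_cast at this
      have e : x - ((a0 : ℝ) - a) / (d - d0) = (((a : ℝ) - a0) + x * ((d : ℝ) - d0)) / (d - d0) := by
        field_simp; ring
      rw [e, abs_div] at this
      have e2 : |((a : ℝ) - a0) + x * ((d : ℝ) - d0)| / |(d : ℝ) - d0| ≤ (1 / r) / R :=
        div_le_div₀ (by positivity) c hR0 hlt.le
      rw [div_div] at e2
      linarith
    have h1 := fiber_card ((X ×ˢ X).filter (fun p => φ p = φ (a0, d0))) (fun p => p.2)
      (X.filter (fun d : ℤ => |(d : ℝ) - d0| ≤ R)) (L * (2 * L ^ 2 / r) ^ κ) hd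
      (by
        intro d _
        refine le_trans ?_ (h.loc (a0 - x * (d - d0)) (2 * L ^ 2 / r) hr1)
        have : (((X ×ˢ X).filter (fun p => φ p = φ (a0, d0))).filter (fun p => p.2 = d)).card ≤
            (X.filter (fun y : ℤ => |(y : ℝ) - (a0 - x * (d - d0))| ≤ 2 * L ^ 2 / r)).card := by
          apply Finset.card_le_card_of_injOn (fun p => p.1)
          · intro p hp
            rw [Finset.mem_coe, Finset.mem_filter] at hp
            have c := hcol p hp.1
            obtain ⟨hp1, _⟩ := Finset.mem_filter.1 hp.1
            rw [Finset.mem_product] at hp1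
            rw [hp.2] at c
            refine Finset.mem_coe.2 (Finset.mem_filter.2 ⟨hp1.1, ?_⟩)
            have e : (p.1 : ℝ) - (a0 - x * (d - d0)) = ((p.1 : ℝ) - a0) + x * ((d : ℝ) - d0) := by ring
            rw [e]
            refine c.trans ?_
            gcongr
            nlinarith
          · intro p hp p' hp' hpp
            rw [Finset.mem_coe, Finset.mem_filter] at hp hp'
            exact Prod.ext hpp (hp.2.trans hp'.2.symm)
        exact_mod_cast this)
    refine h1.trans ?_
    gcongr
    exact h.loc d0 R (by linarith)
  have hfc := fiber_card (X ×ˢ X) φ ((X ×ˢ X).image φ) _ (fun p hp => Finset.mem_image_of_mem _ hp) hfib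
  rw [Finset.card_product] at hfc
  push_cast at hfc
  have e1 : (2 * L ^ 2 / r) ^ κ * (r * η) ^ κ ≤ 2 * L ^ 2 * η ^ κ := by
    rw [← Real.mul_rpow (by positivity) (by positivity)]
    have : 2 * L ^ 2 / r * (r * η) = (2 * L ^ 2) * η := by field_simp
    rw [this, Real.mul_rpow (by positivity) (by positivity)]
    gcongr
    calc (2 * L ^ 2) ^ κ ≤ (2 * L ^ 2) ^ (1:ℝ) := Real.rpow_le_rpow_of_exponent_le (by nlinarith) hκ1
      _ = _ := Real.rpow_one _
  have hRp : 0 < R ^ κ := Real.rpow_pos_of_pos hR0 _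
  have e2 : (X.card : ℝ) * X.card ≤ 2 * L ^ 62 * R ^ κ * η ^ κ := by
    calc (X.card : ℝ) * X.card ≤ _ := hfc
      _ ≤ L * (2 * L ^ 2 / r) ^ κ * (L * R ^ κ) * (L ^ 58 * (r * η) ^ κ) := by gcongr
      _ = L ^ 60 * R ^ κ * ((2 * L ^ 2 / r) ^ κ * (r * η) ^ κ) := by ring
      _ ≤ L ^ 60 * R ^ κ * (2 * L ^ 2 * η ^ κ) := by gcongr
      _ = _ := by ring
  have e3 := h.n_le
  have e4 : η ^ κ * η ^ κ ≤ (2 * L ^ 64 * R ^ κ) * η ^ κ := by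
    calc η ^ κ * η ^ κ ≤ (L * X.card) * (L * X.card) := by gcongr
      _ = L ^ 2 * ((X.card : ℝ) * X.card) := by ring
      _ ≤ L ^ 2 * (2 * L ^ 62 * R ^ κ * η ^ κ) := by gcongr
      _ = _ := by ring
  have := le_of_mul_le_mul_right e4 hn
  linarith

lemma GK.zero_inQ (h : GK X y0 L η κ) (R : ℝ) (hR : L ≤ R) (hRκ : 2 * L ^ 64 * R ^ κ < η ^ κ) :
    inQ X R 0 := by
  have hL := h.hL
  by_contra hcon
  have : ∀ v ∈ X, |(v : ℝ) - y0| ≤ R := by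
    intro v hv
    by_contra hlt
    push Not at hlt
    exact hcon ⟨y0, h.y0mem, y0, h.y0mem, v, hv, y0, h.y0mem, by push_cast; exact hlt.le, by simp⟩
  have h1 := h.loc y0 R (by linarith)
  rw [Finset.filter_true_of_mem this] at h1
  have h2 := h.n_le
  have hRp : 0 < R ^ κ := Real.rpow_pos_of_pos (by linarith) _
  have : η ^ κ ≤ 2 * L ^ 64 * R ^ κ := by
    calc η ^ κ ≤ L * (L * R ^ κ) := h2.trans (by gcongr)
      _ = 1 * L ^ 2 * R ^ κ := by ring
      _ ≤ 2 * L ^ 64 * R ^ κ := by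
        gcongr
        · norm_num
        · linarith
        · norm_num
  linarith

lemma GK.dense (h : GK X y0 L η κ) (R : ℝ) (hR : L ≤ R) (hRκ : 2 * L ^ 64 * R ^ κ < η ^ κ)
    (hs : L * η / R ^ 2 ≤ 1 / 8) (x : ℝ) (hx : x ∈ Set.Icc (0:ℝ) 1) :
    ∃ q, inQ X R q ∧ |q| ≤ 2 ∧ |x - q| ≤ 3 * (L * η / R ^ 2) := by
  have hL := h.hL
  have hη := h.hη
  set s := L * η / R ^ 2 with hsdef
  have hs0 : 0 < s := by rw [hsdef]; have : 0 < R := by linarith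
                         positivity
  have key : ∀ j : ℕ, ∀ x ∈ Set.Icc (0:ℝ) 1, ∃ q, inQ X R q ∧ |q| ≤ 2 ∧ |x - q| ≤ 2 * s + (1/2) ^ j := by
    intro j
    induction j with
    | zero =>
      intro x hx
      refine ⟨0, h.zero_inQ R hR hRκ, by simp, ?_⟩
      rw [sub_zero, abs_of_nonneg hx.1]
      simp; linarith [hx.2]
    | succ j ih =>
      intro x hx
      obtain ⟨b, hb, hx'⟩ : ∃ b : ℝ, (b = 0 ∨ b = 1) ∧ 2 * x - b ∈ Set.Icc (0:ℝ) 1 := by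
        rcases le_or_gt x (1/2) with h1 | h1
        · exact ⟨0, Or.inl rfl, by constructor <;> linarith [hx.1]⟩
        · exact ⟨1, Or.inr rfl, by constructor <;> linarith [hx.2]⟩
      obtain ⟨q, hq, hq2, hqx⟩ := ih _ hx'
      obtain ⟨q', hq', hqq⟩ := h.closure R hR hRκ q hq hq2 b hb
      have hx3 : |x - q'| ≤ 2 * s + (1/2) ^ (j+1) := by
        have e : x - q' = (2 * x - b - q) / 2 + ((q + b) / 2 - q') := by ring
        rw [e]
        refine (abs_add_le _ _).trans ?_
        rw [abs_div, abs_two, pow_succ]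
        linarith
      refine ⟨q', hq', ?_, hx3⟩
      have hp : ((1:ℝ)/2) ^ (j+1) ≤ 1 / 2 := by
        rw [pow_succ]
        have : ((1:ℝ)/2)^j ≤ 1 := pow_le_one₀ (by norm_num) (by norm_num)
        linarith
      have := abs_le.1 (hx3.trans (show _ ≤ (1:ℝ) by linarith))
      rw [abs_le]; constructor <;> linarith [hx.1, hx.2]
  obtain ⟨j, hj⟩ := exists_pow_lt_of_lt_one hs0 (by norm_num : (1/2 : ℝ) < 1)
  obtain ⟨q, h1, h2, h3⟩ := key j x hx
  exact ⟨q, h1, h2, by linarith⟩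
end

end PartNo4

section PartNo5

open scoped Pointwise

lemma collide {α β : Type*} [DecidableEq β] (s : Finset α) (t : Finset β) (f : α → β)
    (hf : ∀ a ∈ s, f a ∈ t) :
    (s.card : ℝ) ^ 2 ≤ t.card * (((s ×ˢ s).filter (fun p => f p.1 = f p.2)).card : ℝ) := by
  have h1 : (s.card : ℝ) = ∑ b ∈ t, ((s.filter (fun a => f a = b)).card : ℝ) := by
    exact_mod_cast Finset.card_eq_sum_card_fiberwise hf
  have h2 : (((s ×ˢ s).filter (fun p => f p.1 = f p.2)).card : ℝ)
      = ∑ b ∈ t, ((s.filter (fun a => f a = b)).card : ℝ) ^ 2 := by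
    have e : ((s ×ˢ s).filter (fun p => f p.1 = f p.2)).card
      = ∑ b ∈ t, ((s.filter (fun a => f a = b)).card) ^ 2 := by
      rw [Finset.card_eq_sum_card_fiberwise (f := fun p => f p.1) (t := t)]
      · apply Finset.sum_congr rfl
        intro b _
        rw [sq, ← Finset.card_product]
        congr 1
        ext p
        simp only [Finset.mem_filter, Finset.mem_product]
        constructor
        · rintro ⟨⟨⟨a, c⟩, d⟩, e⟩; exact ⟨⟨a, e⟩, c, d ▸ e⟩
        · rintro ⟨⟨a, e⟩, c, d⟩; exact ⟨⟨⟨a, c⟩, e.trans d.symm⟩, e⟩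
      · intro p hp
        simp at hp
        exact hf _ hp.1.1
    exact_mod_cast e
  rw [h1, h2]
  exact sq_sum_le_card_mul_sum_sq

section
variable {X : Finset ℤ} {y0 : ℤ} {L η κ : ℝ}

/-- Quadruples. -/
def quad (X : Finset ℤ) : Finset ((ℤ × ℤ) × (ℤ × ℤ)) := (X ×ˢ X) ×ˢ (X ×ˢ X)

def qA (p : (ℤ × ℤ) × (ℤ × ℤ)) : ℝ := (p.1.1 : ℝ) - p.2.1
def qB (p : (ℤ × ℤ) × (ℤ × ℤ)) : ℝ := (p.1.2 : ℝ) - p.2.2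

lemma GK.qB_le (h : GK X y0 L η κ) (p) (hp : p ∈ quad X) : |qB p| ≤ 2 * L * η := by
  simp only [quad, Finset.mem_product] at hp
  have := abs_sub (p.1.2 : ℝ) p.2.2
  have := h.bd _ hp.1.2
  have := h.bd _ hp.2.2
  unfold qB
  linarith

set_option maxHeartbeats 1000000 in
open Classical in
lemma GK.many (h : GK X y0 L η κ) (R : ℝ) (hR : L ≤ R) (hRκ : 2 * L ^ 64 * R ^ κ < η ^ κ)
    (hs : L * η / R ^ 2 ≤ 1 / 8) (H : ℝ) (hH : 2 * L * η / R + 6 * L ^ 2 * η ^ 2 / R ^ 2 ≤ H)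
    (x : ℝ) (hx : x ∈ Set.Icc (0:ℝ) 1) :
    (X.card : ℝ) ^ 3 / L ^ 33 ≤ (((quad X).filter (fun p => |qA p + x * qB p| ≤ H)).card : ℝ) := by
  obtain ⟨q, hq, hq2, hxq⟩ := h.dense R hR hRκ hs x hx
  obtain ⟨u1, hu1, u2, hu2, v1, hv1, v2, hv2, hv, rfl⟩ := hq
  have hL := h.hL
  have hη := h.hη
  have hn := h.npos
  have hκ := h.κ0
  have hκ1 := h.κ1
  have hR0 : 0 < R := by linarith
  obtain ⟨t1, t2, t3⟩ := h.tbounds R hR v1 v2 hv1 hv2 hv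
  have dv := h.diff v1 v2 hv1 hv2
  have du := h.diff u1 u2 hu1 hu2
  set u : ℝ := ((u1 - u2 : ℤ) : ℝ)
  set v : ℝ := ((v1 - v2 : ℤ) : ℝ)
  have hv0 : v ≠ 0 := by
    intro h0; rw [h0, abs_zero] at hv; linarith
  have hy0 := h.y0ne
  set t := v / y0 with ht
  set s := u / y0 with hs
  have ht0 : t ≠ 0 := div_ne_zero hv0 hy0
  set r := |t| with hr
  have hr0 : 0 < r := abs_pos.2 ht0
  have hsu : u / v = s / t := by rw [hs, ht]; field_simp
  rw [hsu] at hq2 hxq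
  have hst : |s| ≤ 2 * r := by
    rw [abs_div, div_le_iff₀ hr0] at hq2; exact hq2
  have hV := h.local' t s hst t3 dv du 2
  set W := dil t X ∪ dil s X with hW
  set φ : ℤ × ℤ → ℤ := fun p : ℤ × ℤ => ⌊t * (p.1 : ℝ)⌋ + ⌊s * (p.2 : ℝ)⌋ with hφ
  have hc := collide (X ×ˢ X) (2 • W) φ (by
    intro p hp
    rw [Finset.mem_product] at hp
    rw [two_nsmul]
    exact Finset.add_mem_add (Finset.mem_union_left _ (mem_dil.2 ⟨_, hp.1, rfl⟩))
      (Finset.mem_union_right _ (mem_dil.2 ⟨_, hp.2, rfl⟩)))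
  have hsub : ((X ×ˢ X) ×ˢ (X ×ˢ X)).filter (fun p => φ p.1 = φ p.2) ⊆
      (quad X).filter (fun p => |qA p + x * qB p| ≤ H) := by
    intro p hp
    obtain ⟨hp1, hp2⟩ := Finset.mem_filter.1 hp
    refine Finset.mem_filter.2 ⟨hp1, ?_⟩
    have hB := h.qB_le p hp1
    have g : |qA p + s / t * qB p| ≤ 2 / r := by
      simp only [hφ] at hp2
      have e' : (⌊t * (p.1.1 : ℝ)⌋ : ℝ) + ⌊s * (p.1.2 : ℝ)⌋ = ⌊t * (p.2.1 : ℝ)⌋ + ⌊s * (p.2.2 : ℝ)⌋ := by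
        exact_mod_cast hp2
      have f1 := Int.floor_le (t * (p.1.1 : ℝ))
      have f2 := Int.lt_floor_add_one (t * (p.1.1 : ℝ))
      have f3 := Int.floor_le (s * (p.1.2 : ℝ))
      have f4 := Int.lt_floor_add_one (s * (p.1.2 : ℝ))
      have f5 := Int.floor_le (t * (p.2.1 : ℝ))
      have f6 := Int.lt_floor_add_one (t * (p.2.1 : ℝ))
      have f7 := Int.floor_le (s * (p.2.2 : ℝ))
      have f8 := Int.lt_floor_add_one (s * (p.2.2 : ℝ))
      rw [le_div_iff₀ hr0, hr, ← abs_mul]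
      have e : (qA p + s / t * qB p) * t = t * qA p + s * qB p := by field_simp
      rw [e, abs_le]
      unfold qA qB
      constructor <;> linarith
    have e : qA p + x * qB p = (qA p + s / t * qB p) + (x - s / t) * qB p := by ring
    rw [e]
    refine (abs_add_le _ _).trans (le_trans ?_ hH)
    rw [abs_mul]
    have g2 : 2 / r ≤ 2 * L * η / R := by
      rw [div_le_div_iff₀ hr0 hR0]
      rw [div_le_iff₀ (by positivity)] at t1
      nlinarith
    have g3 : |x - s / t| * |qB p| ≤ 3 * (L * η / R ^ 2) * (2 * L * η) := by
      gcongr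
    have g4 : 3 * (L * η / R ^ 2) * (2 * L * η) = 6 * L ^ 2 * η ^ 2 / R ^ 2 := by ring
    linarith
  have hsub' : ((((X ×ˢ X) ×ˢ (X ×ˢ X)).filter (fun p => φ p.1 = φ p.2)).card : ℝ) ≤
      (((quad X).filter (fun p => |qA p + x * qB p| ≤ H)).card : ℝ) := by
    exact_mod_cast Finset.card_le_card hsub
  refine le_trans ?_ hsub'
  set Ncol := ((((X ×ˢ X) ×ˢ (X ×ˢ X)).filter (fun p => φ p.1 = φ p.2)).card : ℝ)
  have hXp : (0 : ℝ) < X.card := by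
    exact_mod_cast Finset.card_pos.2 ⟨y0, h.y0mem⟩
  rw [Finset.card_product] at hc
  have hWb : ((2 • W).card : ℝ) ≤ L ^ 33 * X.card := by
    calc ((2 • W).card : ℝ) ≤ _ := hV
      _ ≤ L ^ (14 * 2 + 1) * ((2 * L ^ 2) * η ^ κ) := by
        gcongr
        rw [Real.mul_rpow (by positivity) (by positivity)]
        gcongr
        calc r ^ κ ≤ (2 * L ^ 2) ^ κ := by gcongr
          _ ≤ (2 * L ^ 2) ^ (1:ℝ) := Real.rpow_le_rpow_of_exponent_le (by nlinarith) hκ1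
          _ = _ := Real.rpow_one _
      _ ≤ L ^ (14 * 2 + 1) * ((2 * L ^ 2) * (L * X.card)) := by gcongr; exact h.n_le
      _ = L ^ 32 * (2 * X.card) := by ring
      _ ≤ L ^ 32 * (L * X.card) := by gcongr; linarith
      _ = _ := by ring
  rw [div_le_iff₀ (by positivity)]
  have : (X.card : ℝ) * (X.card : ℝ) ^ 3 ≤ (X.card : ℝ) * (Ncol * L ^ 33) := by
    calc (X.card : ℝ) * (X.card : ℝ) ^ 3 = (((X.card * X.card : ℕ) : ℝ)) ^ 2 := by push_cast; ring
      _ ≤ _ := hc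
      _ ≤ (L ^ 33 * X.card) * Ncol := by gcongr
      _ = _ := by ring
  exact le_of_mul_le_mul_left this hXp

/-- size of the second difference, at least one -/
noncomputable def qd (p : (ℤ × ℤ) × (ℤ × ℤ)) : ℝ := max 1 |qB p|

lemma count_j (p : (ℤ × ℤ) × (ℤ × ℤ)) (N : ℤ) (H : ℝ) (hH : 1 ≤ H) (hN : 1 ≤ N) (hB : |qB p| ≤ N) :
    (((Finset.Ico 0 N).filter (fun j : ℤ => |qA p + (j : ℝ) / N * qB p| ≤ H)).card : ℝ) ≤
      if |qA p| ≤ 2 * H * qd p then 3 * H * N * (qd p) ^ (-1 : ℝ) else 0 := by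
  have hN' : (1 : ℝ) ≤ N := by exact_mod_cast hN
  have hd1 : 1 ≤ qd p := le_max_left _ _
  have hd2 : |qB p| ≤ qd p := le_max_right _ _
  split_ifs with hc
  · rw [Real.rpow_neg_one]
    by_cases h0 : p.1.2 = p.2.2
    · have hq : qd p = 1 := by
        unfold qd qB; rw [h0]; simp
      rw [hq, inv_one, mul_one]
      have h1 : ((Finset.Ico 0 N).filter (fun j : ℤ => |qA p + (j : ℝ) / N * qB p| ≤ H)).card ≤ N.toNat := by
        refine (Finset.card_filter_le _ _).trans ?_
        rw [Int.card_Ico]; simp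
      have h2 : ((N.toNat : ℕ) : ℝ) = N := by
        exact_mod_cast Int.toNat_of_nonneg (by linarith)
      have h3 : (((Finset.Ico 0 N).filter (fun j : ℤ => |qA p + (j : ℝ) / N * qB p| ≤ H)).card : ℝ) ≤ (N.toNat : ℝ) := by
        exact_mod_cast h1
      rw [h2] at h3
      nlinarith
    · have hB1 : 1 ≤ |qB p| := by
        have : (1 : ℤ) ≤ |p.1.2 - p.2.2| := Int.one_le_abs (sub_ne_zero.2 h0)
        unfold qB
        exact_mod_cast this
      have hq : qd p = |qB p| := max_eq_right hB1
      have hB0 : qB p ≠ 0 := by intro h; rw [h, abs_zero] at hB1; linarith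
      rw [hq]
      have := card_int_near ((Finset.Ico 0 N).filter (fun j : ℤ => |qA p + (j : ℝ) / N * qB p| ≤ H))
        (- qA p * N / qB p) (H * N / |qB p|) (by positivity)
        (by
          intro j hj
          have hj2 := (Finset.mem_filter.1 hj).2
          have e : (j : ℝ) - (- qA p * N / qB p) = (qA p + (j : ℝ) / N * qB p) * (N / qB p) := by
            field_simp
            ring
          rw [e, abs_mul, abs_div, abs_of_pos (by linarith : (0:ℝ) < N), mul_div_assoc]
          gcongr)
      refine this.trans ?_
      have h1 : 1 ≤ H * N / |qB p| := by
        rw [le_div_iff₀ (by linarith)]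
        nlinarith
      have e : 3 * H * N * |qB p|⁻¹ = 3 * (H * N / |qB p|) := by field_simp
      rw [e]; linarith
  · have : ((Finset.Ico 0 N).filter (fun j : ℤ => |qA p + (j : ℝ) / N * qB p| ≤ H)) = ∅ := by
      rw [Finset.filter_eq_empty_iff]
      intro j hj hjH
      apply hc
      rw [Finset.mem_Ico] at hj
      have hj0 : (0 : ℝ) ≤ (j : ℝ) / N := div_nonneg (by exact_mod_cast hj.1) (by linarith)
      have hj1 : (j : ℝ) / N ≤ 1 := by
        rw [div_le_one (by linarith)]; exact_mod_cast hj.2.le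
      have e : qA p = (qA p + (j : ℝ) / N * qB p) - (j : ℝ) / N * qB p := by ring
      rw [e]
      refine (abs_sub _ _).trans ?_
      rw [abs_mul, abs_of_nonneg hj0]
      nlinarith [abs_nonneg (qB p)]
    rw [this]; simp

set_option maxHeartbeats 1000000 in
open Classical in
lemma GK.final (h : GK X y0 L η κ) (κ₀ : ℝ) (h0 : 0 < κ₀) (h1 : κ₀ ≤ 1 / 3) (h2 : κ₀ ≤ κ)
    (h3 : κ ≤ 2 / 3) (hLκ : 16 / κ₀ + 2 ≤ L) (M : ℕ) (hM : 65 ≤ M * κ₀)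
    (hLη : L ^ (8 * M + 100) ≤ η ^ κ₀) : False := by
  have hL := h.hL
  have hη := h.hη
  have hn := h.npos
  have hκ := h.κ0
  have hκ1 := h.κ1
  have hL0 : 0 < L := by linarith
  have hη0 : 0 < η := by linarith
  have hL1 : 1 ≤ L := by linarith
  have hLη1 : L ^ (8 * M + 100) ≤ η := by
    refine hLη.trans ?_
    calc η ^ κ₀ ≤ η ^ (1 : ℝ) := Real.rpow_le_rpow_of_exponent_le hη (by linarith)
      _ = η := Real.rpow_one _
  have hpw : ∀ a : ℕ, a ≤ 8 * M + 100 → L ^ a ≤ η := fun a ha =>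
    (pow_le_pow_right₀ hL1 ha).trans hLη1
  set R := η / L ^ M with hR
  have hRL : L ≤ R := by
    rw [hR, le_div_iff₀ (by positivity), ← pow_succ']
    exact hpw _ (by omega)
  have hR0 : 0 < R := by linarith
  have hRκ : 2 * L ^ 64 * R ^ κ < η ^ κ := by
    rw [hR, Real.div_rpow hη0.le (by positivity)]
    have e1 : L ^ 65 ≤ (L ^ M) ^ κ := by
      rw [← Real.rpow_natCast L M, ← Real.rpow_mul hL0.le, ← Real.rpow_natCast L 65]
      apply Real.rpow_le_rpow_of_exponent_le hL1
      push_cast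
      have : (M : ℝ) * κ₀ ≤ M * κ := by gcongr
      linarith
    have e2 : 0 < (L ^ M) ^ κ := by positivity
    rw [← mul_div_assoc, div_lt_iff₀ e2]
    have e3 : 2 * L ^ 64 < (L ^ M) ^ κ := by
      refine lt_of_lt_of_le ?_ e1
      rw [pow_succ' L 64]
      have : 0 < L ^ 64 := by positivity
      nlinarith
    nlinarith
  have hηR : η / R = L ^ M := by rw [hR]; field_simp
  have hs : L * η / R ^ 2 ≤ 1 / 8 := by
    have e : L * η / R ^ 2 = L * (L ^ M) ^ 2 / η := by rw [← hηR]; field_simp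
    rw [e, div_le_iff₀ hη0]
    have : L ^ (2 * M + 2) ≤ η := hpw _ (by omega)
    have e2 : L ^ (2 * M + 2) = L * (L * (L ^ M) ^ 2) := by ring
    have : 0 < L * (L ^ M) ^ 2 := by positivity
    nlinarith
  set H := 8 * L ^ (2 * M + 2) with hH
  have hHb : 2 * L * η / R + 6 * L ^ 2 * η ^ 2 / R ^ 2 ≤ H := by
    have e : 2 * L * η / R + 6 * L ^ 2 * η ^ 2 / R ^ 2 = 2 * L * (η / R) + 6 * L ^ 2 * (η / R) ^ 2 := by
      field_simp
    rw [e, hηR, hH]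
    have e1 : L * L ^ M ≤ (L * L ^ M) ^ 2 := by
      have : 1 ≤ L * L ^ M := by
        have : 1 ≤ L ^ M := one_le_pow₀ hL1
        nlinarith
      nlinarith
    have e2 : L ^ (2 * M + 2) = (L * L ^ M) ^ 2 := by ring
    rw [e2]; nlinarith
  have hH1 : 1 ≤ H := by
    have : 1 ≤ L ^ (2 * M + 2) := one_le_pow₀ hL1
    rw [hH]; linarith
  have hmany := h.many R hRL hRκ hs H hHb
  set N : ℤ := ⌈2 * L * η⌉ with hN
  have hNb : 2 * L * η ≤ N := Int.le_ceil _
  have hN1' : (1 : ℝ) ≤ N := by nlinarith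
  have hN1 : 1 ≤ N := by exact_mod_cast hN1'
  -- double count
  have d1 : (N : ℝ) * ((X.card : ℝ) ^ 3 / L ^ 33) ≤
      ∑ p ∈ quad X, (if |qA p| ≤ 2 * H * qd p then 3 * H * N * (qd p) ^ (-1 : ℝ) else 0) := by
    have c1 : (N : ℝ) * ((X.card : ℝ) ^ 3 / L ^ 33) ≤ ∑ j ∈ Finset.Ico 0 N,
        (((quad X).filter (fun p => |qA p + (j : ℝ) / N * qB p| ≤ H)).card : ℝ) := by
      calc (N : ℝ) * ((X.card : ℝ) ^ 3 / L ^ 33) = ∑ j ∈ Finset.Ico 0 N, ((X.card : ℝ) ^ 3 / L ^ 33) := by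
            rw [Finset.sum_const, Int.card_Ico, nsmul_eq_mul]
            congr 1
            rw [sub_zero]
            symm
            exact_mod_cast Int.toNat_of_nonneg (by linarith : 0 ≤ N)
        _ ≤ _ := by
          apply Finset.sum_le_sum
          intro j hj
          apply hmany
          rw [Finset.mem_Ico] at hj
          constructor
          · exact div_nonneg (by exact_mod_cast hj.1) (by linarith)
          · rw [div_le_one (by linarith)]; exact_mod_cast hj.2.le
    refine c1.trans ?_
    have c2 := card_filter_prod (Finset.Ico 0 N) (quad X) (fun j p => |qA p + (j : ℝ) / N * qB p| ≤ H)
    rw [card_filter_prod' (Finset.Ico 0 N) (quad X) (fun j p => |qA p + (j : ℝ) / N * qB p| ≤ H)] at c2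
    have c3 : ∑ j ∈ Finset.Ico 0 N,
        (((quad X).filter (fun p => |qA p + (j : ℝ) / N * qB p| ≤ H)).card : ℝ) =
        ∑ p ∈ quad X, (((Finset.Ico 0 N).filter (fun j : ℤ => |qA p + (j : ℝ) / N * qB p| ≤ H)).card : ℝ) := by
      exact_mod_cast c2.symm
    rw [c3]
    apply Finset.sum_le_sum
    intro p hp
    exact count_j p N H hH1 hN1 ((h.qB_le p hp).trans hNb)
  rw [← Finset.sum_filter, ← Finset.mul_sum] at d1
  set P := (quad X).filter (fun p => |qA p| ≤ 2 * H * qd p) with hP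
  have hXp : (0 : ℝ) < X.card := by
    exact_mod_cast Finset.card_pos.2 ⟨y0, h.y0mem⟩
  have hLη2 : 1 ≤ 2 * L * η := by nlinarith
  set J := ⌈16 / κ₀⌉₊ with hJ
  have hJ1 : 16 / κ₀ ≤ J := Nat.le_ceil _
  have hJ2 : (J : ℝ) + 1 ≤ L := by
    have := Nat.ceil_lt_add_one (show 0 ≤ 16 / κ₀ by positivity)
    linarith
  have hdP : ∀ p ∈ P, qd p ≤ 2 * L * η := by
    intro p hp
    exact max_le hLη2 (h.qB_le p (Finset.mem_filter.1 hp).1)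
  have hBl := block_sum P (fun _ => 1) qd 1 (4 * H * L ^ 3 * X.card ^ 2 * η ^ (κ - κ₀)) (η ^ (κ₀ / 8)) J
    (by norm_num) (Real.one_le_rpow hη (by positivity)) (by intros; norm_num)
    (fun p _ => le_max_left _ _)
    (by
      intro p hp
      refine (hdP p hp).trans ?_
      rw [← Real.rpow_natCast, ← Real.rpow_mul hη0.le]
      have : (2 : ℝ) ≤ κ₀ / 8 * J := by
        rw [div_le_iff₀ h0] at hJ1
        linarith
      calc 2 * L * η ≤ L ^ 2 * η := by gcongr; nlinarith
        _ ≤ η * η := by gcongr; exact hpw 2 (by omega)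
        _ = η ^ (2 : ℝ) := by rw [Real.rpow_two]; ring
        _ ≤ _ := Real.rpow_le_rpow_of_exponent_le hη this)
    (by
      intro l hl
      rw [Finset.sum_const, nsmul_eq_mul, mul_one, Real.rpow_one]
      set l' := min l (2 * L * η) with hl'
      have hl1 : 1 ≤ l' := le_min hl hLη2
      have hl'l : l' ≤ l := min_le_left _ _
      have hl'2 : l' ≤ 2 * L * η := min_le_right _ _
      have fc := fiber_card (P.filter (fun p => qd p ≤ l)) (fun p => p.1) (X ×ˢ X)
        ((L * (2 * H * l') ^ κ) * (L * l' ^ κ))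
        (by
          intro p hp
          have hp1 := (Finset.mem_filter.1 (Finset.mem_filter.1 hp).1).1
          simp only [quad] at hp1
          exact (Finset.mem_product.1 hp1).1)
        (by
          intro c hc
          have hsub : ((P.filter (fun p => qd p ≤ l)).filter (fun p => p.1 = c)).card ≤
            ((X.filter (fun x : ℤ => |(x : ℝ) - c.1| ≤ 2 * H * l')) ×ˢ
              (X.filter (fun x : ℤ => |(x : ℝ) - c.2| ≤ l'))).card := by
            apply Finset.card_le_card_of_injOn (fun p => p.2)
            · intro p hp
              rw [Finset.mem_coe, Finset.mem_filter, Finset.mem_filter] at hp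
              obtain ⟨⟨hpP, hpl⟩, rfl⟩ := hp
              have hd := hdP p hpP
              have hdl : qd p ≤ l' := le_min hpl hd
              obtain ⟨hpq, hpA⟩ := Finset.mem_filter.1 hpP
              simp only [quad, Finset.mem_product] at hpq
              rw [Finset.mem_coe, Finset.mem_product, Finset.mem_filter, Finset.mem_filter]
              refine ⟨⟨hpq.2.1, ?_⟩, hpq.2.2, ?_⟩
              · rw [abs_sub_comm]
                refine hpA.trans ?_
                gcongr
              · rw [abs_sub_comm]
                exact (le_max_right 1 _).trans hdl
            · intro p hp p' hp' hpp
              rw [Finset.mem_coe, Finset.mem_filter] at hp hp'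
              exact Prod.ext (hp.2.trans hp'.2.symm) hpp
          rw [Finset.card_product] at hsub
          calc _ ≤ (((X.filter (fun x : ℤ => |(x : ℝ) - c.1| ≤ 2 * H * l')).card *
              (X.filter (fun x : ℤ => |(x : ℝ) - c.2| ≤ l')).card : ℕ) : ℝ) := by exact_mod_cast hsub
            _ ≤ _ := by
              push_cast
              gcongr
              · exact h.loc _ _ (by nlinarith)
              · exact h.loc _ _ hl1)
      rw [Finset.card_product] at fc
      push_cast at fc
      refine fc.trans ?_
      have k1 : (2 * H * l') ^ κ ≤ 2 * H * l' ^ κ := by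
        rw [Real.mul_rpow (by positivity) (by positivity)]
        gcongr
        calc (2 * H) ^ κ ≤ (2 * H) ^ (1 : ℝ) := Real.rpow_le_rpow_of_exponent_le (by linarith) hκ1
          _ = _ := Real.rpow_one _
      have k2 : l' ^ κ * l' ^ κ ≤ l * (2 * L * η ^ (κ - κ₀)) := by
        have hl0 : 0 < l' := by linarith
        calc l' ^ κ * l' ^ κ = l' ^ (1 : ℝ) * l' ^ (2 * κ - 1) := by
              rw [← Real.rpow_add hl0, ← Real.rpow_add hl0]; congr 1; ring
          _ ≤ l * (2 * L * η) ^ (κ - κ₀) := by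
              rw [Real.rpow_one]
              have : l' ^ (2 * κ - 1) ≤ (2 * L * η) ^ (κ - κ₀) := by
                calc l' ^ (2 * κ - 1) ≤ l' ^ (κ - κ₀) :=
                      Real.rpow_le_rpow_of_exponent_le hl1 (by linarith)
                  _ ≤ _ := Real.rpow_le_rpow hl0.le hl'2 (by linarith)
              gcongr
          _ ≤ _ := by
              rw [Real.mul_rpow (by positivity) (by positivity)]
              gcongr
              calc (2 * L) ^ (κ - κ₀) ≤ (2 * L) ^ (1 : ℝ) := Real.rpow_le_rpow_of_exponent_le (by linarith) (by linarith)
                _ = _ := Real.rpow_one _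
      calc L * (2 * H * l') ^ κ * (L * l' ^ κ) * (↑X.card * ↑X.card)
          ≤ L * (2 * H * l' ^ κ) * (L * l' ^ κ) * (↑X.card * ↑X.card) := by gcongr
        _ = 2 * H * L ^ 2 * X.card ^ 2 * (l' ^ κ * l' ^ κ) := by ring
        _ ≤ 2 * H * L ^ 2 * X.card ^ 2 * (l * (2 * L * η ^ (κ - κ₀))) := by gcongr
        _ = _ := by ring)
  simp only [one_mul] at hBl
  rw [Real.rpow_one] at hBl
  have m1 : (N : ℝ) * ((X.card : ℝ) ^ 3 / L ^ 33) ≤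
      3 * H * N * (L * (4 * H * L ^ 3 * X.card ^ 2 * η ^ (κ - κ₀)) * η ^ (κ₀ / 8)) := by
    refine d1.trans ?_
    gcongr
    exact hBl.trans (by gcongr)
  have hN0 : (0:ℝ) < N := by linarith
  have m2 : (X.card : ℝ) ≤ 12 * H ^ 2 * L ^ 37 * (η ^ (κ - κ₀) * η ^ (κ₀ / 8)) := by
    have e : (N : ℝ) * ((X.card : ℝ) ^ 2 / L ^ 33) * X.card ≤ (N : ℝ) * ((X.card : ℝ) ^ 2 / L ^ 33) * (12 * H ^ 2 * L ^ 37 * (η ^ (κ - κ₀) * η ^ (κ₀ / 8))) := by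
      calc _ = (N : ℝ) * ((X.card : ℝ) ^ 3 / L ^ 33) := by ring
        _ ≤ _ := m1
        _ = _ := by field_simp; ring
    exact le_of_mul_le_mul_left e (by positivity)
  have m3 : η ^ κ ≤ L * (12 * H ^ 2 * L ^ 37 * (η ^ (κ - κ₀) * η ^ (κ₀ / 8))) :=
    h.n_le.trans (by gcongr)
  have m4 : η ^ κ = η ^ (κ₀ / 2) * η ^ (3 * κ₀ / 8) * (η ^ (κ - κ₀) * η ^ (κ₀ / 8)) := by
    rw [← Real.rpow_add hη0, ← Real.rpow_add hη0, ← Real.rpow_add hη0]; congr 1; ring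
  have m5 : η ^ (κ₀ / 2) * η ^ (3 * κ₀ / 8) ≤ L * (12 * H ^ 2 * L ^ 37) := by
    have e : η ^ (κ₀ / 2) * η ^ (3 * κ₀ / 8) * (η ^ (κ - κ₀) * η ^ (κ₀ / 8)) ≤
        L * (12 * H ^ 2 * L ^ 37) * (η ^ (κ - κ₀) * η ^ (κ₀ / 8)) := by
      rw [← m4]; refine m3.trans (le_of_eq (by ring))
    exact le_of_mul_le_mul_right e (by positivity)
  have m6 : L ^ (4 * M + 50) ≤ η ^ (κ₀ / 2) := by
    have : (L ^ (4 * M + 50)) ^ 2 ≤ (η ^ (κ₀ / 2)) ^ 2 := by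
      rw [← pow_mul, ← Real.rpow_natCast (η ^ (κ₀ / 2)), ← Real.rpow_mul hη0.le]
      rw [show (4 * M + 50) * 2 = 8 * M + 100 by ring]
      refine hLη.trans (le_of_eq ?_)
      congr 1; push_cast; ring
    exact le_of_sq_le_sq this (by positivity)
  have m7 : 1 ≤ η ^ (3 * κ₀ / 8) := Real.one_le_rpow hη (by positivity)
  have m8 : L * (12 * H ^ 2 * L ^ 37) < L ^ (4 * M + 50) := by
    have e : L * (12 * H ^ 2 * L ^ 37) = 768 * L ^ (4 * M + 42) := by rw [hH]; ring
    have e2 : L ^ (4 * M + 50) = L ^ 8 * L ^ (4 * M + 42) := by ring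
    rw [e, e2]
    have : (768:ℝ) < L ^ 8 := by
      calc (768:ℝ) < 100 ^ 8 := by norm_num
        _ ≤ _ := by gcongr
    gcongr
  have : 0 < η ^ (κ₀ / 2) := by positivity
  nlinarith
end

end PartNo5

section PartNo6

open scoped Pointwise

lemma cs_inter {α β : Type*} [DecidableEq β] (Y : Finset α) (F : α → Finset β) (U : Finset β)
    (hF : ∀ y ∈ Y, F y ⊆ U) :
    (∑ y ∈ Y, ((F y).card : ℝ)) ^ 2 ≤ U.card * ∑ y0 ∈ Y, ∑ y ∈ Y, ((F y ∩ F y0).card : ℝ) := by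
  have h1 : ∑ y ∈ Y, ((F y).card : ℝ) = ∑ u ∈ U, ∑ y ∈ Y, (if u ∈ F y then (1:ℝ) else 0) := by
    rw [Finset.sum_comm]
    apply Finset.sum_congr rfl
    intro y hy
    rw [Finset.sum_ite_mem, Finset.inter_eq_right.2 (hF y hy)]
    simp
  have h2 : ∑ y0 ∈ Y, ∑ y ∈ Y, ((F y ∩ F y0).card : ℝ) =
      ∑ u ∈ U, (∑ y ∈ Y, (if u ∈ F y then (1:ℝ) else 0)) ^ 2 := by
    simp_rw [sq, Finset.sum_mul_sum]
    symm
    rw [Finset.sum_comm]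
    apply Finset.sum_congr rfl
    intro y hy
    rw [Finset.sum_comm]
    apply Finset.sum_congr rfl
    intro y' hy'
    have e : ∀ u, (if u ∈ F y then (1:ℝ) else 0) * (if u ∈ F y' then (1:ℝ) else 0) =
        if u ∈ F y' ∩ F y then (1:ℝ) else 0 := by
      intro u
      by_cases c1 : u ∈ F y <;> by_cases c2 : u ∈ F y' <;> simp [c1, c2]
    simp_rw [e]
    rw [Finset.sum_ite_mem, Finset.inter_eq_right.2 (Finset.inter_subset_left.trans (hF y' hy'))]
    simp
  rw [h1, h2]
  exact sq_sum_le_card_mul_sum_sq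

lemma rz (P Q R : Finset ℤ) (α β γ m : ℝ) (hm : 0 < m) (hα : 0 ≤ α) (hγ : 0 < γ)
    (h1 : ((P + Q).card : ℝ) ≤ α * m) (h2 : ((Q + R).card : ℝ) ≤ β * m) (h3 : m / γ ≤ Q.card) :
    ((P + R).card : ℝ) ≤ α * β * γ * m := by
  have h := Finset.ruzsa_triangle_inequality_add_add_add P Q R
  have h' : ((P + R).card : ℝ) * Q.card ≤ (P + Q).card * (Q + R).card := by exact_mod_cast h
  have h4 : ((P + R).card : ℝ) * (m / γ) ≤ (α * m) * (β * m) := by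
    calc _ ≤ ((P + R).card : ℝ) * Q.card := by gcongr
      _ ≤ _ := h'
      _ ≤ _ := by gcongr
  have h5 : ((P + R).card : ℝ) * (m / γ) ≤ (α * β * γ * m) * (m / γ) := by
    refine h4.trans (le_of_eq ?_); field_simp
  exact le_of_mul_le_mul_right h5 (by positivity)

lemma dil_scale (A A' : Finset ℤ) (t s s' : ℝ) :
    ((dil (t * s) A + dil (t * s') A').card : ℝ) ≤ (4 * |t| + 5) * (dil s A + dil s' A').card := by
  have := cover_card (dil (t * s) A + dil (t * s') A') (dil s A + dil s' A') (fun w : ℤ => t * (w : ℝ))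
    (2 * |t| + 2) (by positivity) (by
      intro z hz
      obtain ⟨p, hp, q, hq, rfl⟩ := Finset.mem_add.1 hz
      obtain ⟨a, ha, rfl⟩ := mem_dil.1 hp
      obtain ⟨b, hb, rfl⟩ := mem_dil.1 hq
      refine ⟨⌊s * (a : ℝ)⌋ + ⌊s' * (b : ℝ)⌋, Finset.add_mem_add (mem_dil.2 ⟨a, ha, rfl⟩) (mem_dil.2 ⟨b, hb, rfl⟩), ?_⟩
      push_cast
      have e : (⌊t * s * (a : ℝ)⌋ : ℝ) + ⌊t * s' * (b : ℝ)⌋ - t * (⌊s * (a : ℝ)⌋ + ⌊s' * (b : ℝ)⌋)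
        = ((⌊t * s * (a : ℝ)⌋ : ℝ) - t * s * a) + ((⌊t * s' * (b : ℝ)⌋ : ℝ) - t * s' * b)
          - t * (((⌊s * (a : ℝ)⌋ : ℝ) - s * a) + ((⌊s' * (b : ℝ)⌋ : ℝ) - s' * b)) := by ring
      rw [e]
      have f1 := floor_close (t * s * (a : ℝ))
      have f2 := floor_close (t * s' * (b : ℝ))
      have f3 := floor_close (s * (a : ℝ))
      have f4 := floor_close (s' * (b : ℝ))
      refine (abs_sub _ _).trans ?_
      have g1 := abs_add_le ((⌊t * s * (a : ℝ)⌋ : ℝ) - t * s * a) ((⌊t * s' * (b : ℝ)⌋ : ℝ) - t * s' * b)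
      have g2 := abs_add_le ((⌊s * (a : ℝ)⌋ : ℝ) - s * a) ((⌊s' * (b : ℝ)⌋ : ℝ) - s' * b)
      rw [abs_mul]
      have g3 : |t| * |((⌊s * (a : ℝ)⌋ : ℝ) - s * a) + ((⌊s' * (b : ℝ)⌋ : ℝ) - s' * b)| ≤ |t| * 2 := by
        gcongr; linarith
      linarith)
  linarith

lemma dil_card_ge (A : Finset ℤ) (t L : ℝ) (hL : 0 < L) (ht : 1 / L ≤ |t|) :
    (A.card : ℝ) ≤ (2 * L + 1) * (dil t A).card := by
  have htp : 0 < |t| := lt_of_lt_of_le (by positivity) ht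
  have ht0 : t ≠ 0 := abs_pos.1 htp
  apply cover_card A (dil t A) (fun z : ℤ => (z : ℝ) / t) L hL.le
  intro x hx
  refine ⟨⌊t * (x : ℝ)⌋, mem_dil.2 ⟨x, hx, rfl⟩, ?_⟩
  have e : (x : ℝ) - (⌊t * (x : ℝ)⌋ : ℝ) / t = -(((⌊t * (x : ℝ)⌋ : ℝ) - t * x) / t) := by
    field_simp; ring
  rw [e, abs_neg, abs_div, div_le_iff₀ htp]
  have := floor_close (t * (x : ℝ))
  rw [div_le_iff₀ hL] at ht
  linarith

lemma dil_fiber (A : Finset ℤ) (t L : ℝ) (hL : 0 < L) (ht : 1 / L ≤ |t|) (z : ℤ) :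
    ((A.filter (fun a : ℤ => ⌊t * (a : ℝ)⌋ = z)).card : ℝ) ≤ 2 * L + 1 := by
  have htp : 0 < |t| := lt_of_lt_of_le (by positivity) ht
  have ht0 : t ≠ 0 := abs_pos.1 htp
  apply card_int_near _ ((z : ℝ) / t) L hL.le
  intro x hx
  have hz := (Finset.mem_filter.1 hx).2
  rw [← hz]
  have e : (x : ℝ) - (⌊t * (x : ℝ)⌋ : ℝ) / t = -(((⌊t * (x : ℝ)⌋ : ℝ) - t * x) / t) := by
    field_simp; ring
  rw [e, abs_neg, abs_div, div_le_iff₀ htp]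
  have := floor_close (t * (x : ℝ))
  rw [div_le_iff₀ hL] at ht
  linarith

structure EX (D Ds : Finset ℤ) (E : Finset (ℤ × ℤ × ℤ)) (m1 m3 Z L η κ : ℝ) : Prop where
  hL : 100 ≤ L
  hη : 1 ≤ η
  Dcard : (D.card : ℝ) ≤ L * η ^ κ
  Dbd : ∀ x ∈ D, |(x : ℝ)| ≤ L * η
  Dloc : ∀ a l : ℝ, 1 ≤ l → ((D.filter (fun x : ℤ => |(x : ℝ) - a| ≤ l)).card : ℝ) ≤ L * l ^ κ
  sub : Ds ⊆ D
  Dsbig : ∀ x ∈ Ds, η / L ≤ |(x : ℝ)|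
  m1l : η / L ≤ |m1|
  Esub : E ⊆ D ×ˢ Ds ×ˢ Ds
  Ed : ∀ e ∈ E, ∃ d ∈ D, |m1 * (e.1 : ℝ) + (e.2.1 : ℝ) * (e.2.2 : ℝ) - m3 * (d : ℝ) - Z| ≤ L * η
  Ecard : (η ^ κ) ^ 3 / L ≤ E.card

section
variable {D Ds : Finset ℤ} {E : Finset (ℤ × ℤ × ℤ)} {m1 m3 Z L η κ : ℝ}

set_option maxHeartbeats 1000000 in
lemma EX.exS (h : EX D Ds E m1 m3 Z L η κ) : ∃ S : Finset ℤ, (S.card : ℝ) ≤ L ^ 3 * (L * η ^ κ) ∧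
    ∀ e ∈ E, ⌊m1 / η * (e.1 : ℝ)⌋ + ⌊(e.2.1 : ℝ) / η * (e.2.2 : ℝ)⌋ ∈ S ∧
      ⌊m1 / η * (e.1 : ℝ)⌋ + ⌊(e.2.2 : ℝ) / η * (e.2.1 : ℝ)⌋ ∈ S := by
  classical
  have hL := h.hL
  have hη := h.hη
  have hη0 : 0 < η := by linarith
  set c : ℤ → ℝ := fun d => m3 / η * d + Z / η
  set S := D.biUnion (fun d => Finset.Icc ⌈c d - (L + 2)⌉ ⌊c d + (L + 2)⌋) with hS
  refine ⟨S, ?_, ?_⟩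
  · have := cover_card S D c (L + 2) (by linarith) (by
      intro x hx
      rw [hS, Finset.mem_biUnion] at hx
      obtain ⟨d, hd, hx⟩ := hx
      rw [Finset.mem_Icc, Int.ceil_le, Int.le_floor] at hx
      exact ⟨d, hd, by rw [abs_le]; constructor <;> linarith⟩)
    have hn : 0 < η ^ κ := Real.rpow_pos_of_pos hη0 _
    calc (S.card : ℝ) ≤ _ := this
      _ ≤ L ^ 3 * (L * η ^ κ) := by
        gcongr
        · nlinarith [sq_nonneg L, mul_nonneg (sq_nonneg L) (by linarith : 0 ≤ L - 100)]
        · exact h.Dcard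
  · intro e he
    obtain ⟨d, hd, hde⟩ := h.Ed e he
    have key : |m1 / η * (e.1 : ℝ) + (e.2.1 : ℝ) / η * (e.2.2 : ℝ) - c d| ≤ L := by
      have e1 : m1 / η * (e.1 : ℝ) + (e.2.1 : ℝ) / η * (e.2.2 : ℝ) - c d =
        (m1 * (e.1 : ℝ) + (e.2.1 : ℝ) * (e.2.2 : ℝ) - m3 * (d : ℝ) - Z) / η := by
        simp only [c]; field_simp; ring
      rw [e1, abs_div, abs_of_pos hη0, div_le_iff₀ hη0]; exact hde
    have sw : (e.2.2 : ℝ) / η * (e.2.1 : ℝ) = (e.2.1 : ℝ) / η * (e.2.2 : ℝ) := by ring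
    have mem : ⌊m1 / η * (e.1 : ℝ)⌋ + ⌊(e.2.1 : ℝ) / η * (e.2.2 : ℝ)⌋ ∈ S := by
      rw [hS, Finset.mem_biUnion]
      refine ⟨d, hd, ?_⟩
      rw [Finset.mem_Icc, Int.ceil_le, Int.le_floor]
      push_cast
      have f1 := abs_le.1 (floor_close (m1 / η * (e.1 : ℝ)))
      have f2 := abs_le.1 (floor_close ((e.2.1 : ℝ) / η * (e.2.2 : ℝ)))
      have f3 := abs_le.1 key
      constructor <;> linarith
    exact ⟨mem, by rw [sw]; exact mem⟩
end

end PartNo6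

section PartNo7

open scoped Pointwise

/-- Markov-type pigeonhole. -/
lemma heavy_sum {α : Type*} (Y : Finset α) (w : α → ℝ) (c T m : ℝ) (hc : 0 ≤ c) (hm : (Y.card : ℝ) ≤ m)
    (h : T ≤ ∑ y ∈ Y, w y) : T - m * c ≤ ∑ y ∈ Y with c ≤ w y, w y := by
  classical
  have : ∑ y ∈ Y, w y ≤ (∑ y ∈ Y with c ≤ w y, w y) + ∑ y ∈ Y, c := by
    rw [Finset.sum_filter, ← Finset.sum_add_distrib]
    apply Finset.sum_le_sum
    intro y _
    split_ifs with h
    · linarith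
    · push Not at h; linarith
  rw [Finset.sum_const, nsmul_eq_mul] at this
  have : (Y.card : ℝ) * c ≤ m * c := by gcongr
  linarith

lemma pigeon {α : Type*} (Y : Finset α) (w : α → ℝ) (c m : ℝ) (hm : (Y.card : ℝ) ≤ m) (hm0 : 0 < m)
    (hc : 0 < c) (h : c * m ≤ ∑ y ∈ Y, w y) : ∃ y ∈ Y, c ≤ w y := by
  by_contra hcon
  push Not at hcon
  rcases Y.eq_empty_or_nonempty with rfl | hne
  · simp at h; nlinarith
  · have := Finset.sum_lt_sum_of_nonempty hne hcon
    rw [Finset.sum_const, nsmul_eq_mul] at this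
    have : (Y.card : ℝ) * c ≤ m * c := by gcongr
    linarith

section
variable {D Ds : Finset ℤ} {E : Finset (ℤ × ℤ × ℤ)} {m1 m3 Z L η κ : ℝ}

set_option maxHeartbeats 4000000 in
/-- Extraction of one set with small sum sets. -/
lemma EX.extract (h : EX D Ds E m1 m3 Z L η κ) (hκ0 : 0 < κ) (hκ1 : κ ≤ 1) :
    ∃ (X : Finset ℤ) (y1 : ℤ), GK X y1 (L ^ 2300) η κ := by
  classical
  have hL := h.hL
  have hη := h.hη
  have hη0 : 0 < η := by linarith
  have hL0 : 0 < L := by linarith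
  have hL1 : 1 ≤ L := by linarith
  have hn : 0 < η ^ κ := Real.rpow_pos_of_pos hη0 _
  obtain ⟨S, hSc, hS⟩ := h.exS
  obtain ⟨m, hmdef⟩ : ∃ m, m = L * η ^ κ := ⟨_, rfl⟩
  rw [← hmdef] at hSc
  have hm : 0 < m := by rw [hmdef]; positivity
  have hDm : (D.card : ℝ) ≤ m := by rw [hmdef]; exact h.Dcard
  have hsubm : ∀ A ⊆ D, (A.card : ℝ) ≤ m := fun A hA =>
    le_trans (by exact_mod_cast Finset.card_le_card hA) hDm
  have hDsm : (Ds.card : ℝ) ≤ m := hsubm _ h.sub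
  have hE3 : m ^ 3 / L ^ 4 ≤ E.card := by
    refine le_trans (le_of_eq ?_) h.Ecard
    rw [hmdef]; field_simp
  have hfac : 2 * L + 1 ≤ L ^ 2 := by nlinarith
  have hpow : ∀ a b : ℕ, a ≤ b → L ^ a ≤ L ^ b := fun a b hab => pow_le_pow_right₀ hL1 hab
  -- slopes
  have hslope : ∀ y ∈ Ds, 1 / L ≤ |(y : ℝ) / η| := by
    intro y hy
    rw [abs_div, abs_of_pos hη0, div_le_div_iff₀ hL0 hη0]
    have := h.Dsbig y hy
    rw [div_le_iff₀ hL0] at this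
    linarith
  have hslope1 : 1 / L ≤ |m1 / η| := by
    rw [abs_div, abs_of_pos hη0, div_le_div_iff₀ hL0 hη0]
    have := h.m1l
    rw [div_le_iff₀ hL0] at this
    linarith
  have hlow : ∀ (A : Finset ℤ) (t : ℝ) (a : ℕ), 1 / L ≤ |t| → m / L ^ a ≤ A.card →
      m / L ^ (a + 2) ≤ ((dil t A).card : ℝ) := by
    intro A t a ht hA
    have h1 := dil_card_ge A t L hL0 ht
    have h2 : (A.card : ℝ) ≤ L ^ 2 * (dil t A).card := h1.trans (by gcongr)
    rw [div_le_iff₀ (by positivity)] at hA ⊢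
    calc m ≤ A.card * L ^ a := hA
      _ ≤ (L ^ 2 * (dil t A).card) * L ^ a := by gcongr
      _ = _ := by ring
  -- ratio of two elements of Ds
  have hratio : ∀ y ∈ Ds, ∀ y' ∈ Ds, |(y : ℝ) / y'| ≤ L ^ 2 := by
    intro y hy y' hy'
    have a1 := h.Dbd y (h.sub hy)
    have a2 := h.Dsbig y' hy'
    have a3 : 0 < η / L := by positivity
    rw [abs_div, div_le_iff₀ (by linarith)]
    have a4 : L ^ 2 * (η / L) ≤ L ^ 2 * |(y' : ℝ)| := by gcongr
    have a5 : L ^ 2 * (η / L) = L * η := by field_simp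
    linarith
  have hDs0 : ∀ y ∈ Ds, (y : ℝ) ≠ 0 := by
    intro y hy h0
    have a2 := h.Dsbig y hy
    have a3 : 0 < η / L := by positivity
    rw [h0, abs_zero] at a2; linarith
  have hscale : ∀ (A A' : Finset ℤ) (t s s' : ℝ) (α : ℝ), 0 ≤ α → |t| ≤ L ^ 2 →
      ((dil s A + dil s' A').card : ℝ) ≤ α * m → ((dil (t * s) A + dil (t * s') A').card : ℝ) ≤ (L ^ 3 * α) * m := by
    intro A A' t s s' α hα ht hs
    refine (dil_scale A A' t s s').trans ?_
    have : 4 * |t| + 5 ≤ L ^ 3 := by nlinarith [sq_nonneg L, mul_nonneg (sq_nonneg L) (by linarith : 0 ≤ L - 100)]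
    calc _ ≤ L ^ 3 * (α * m) := by gcongr
      _ = _ := by ring
  -- fibres over y
  set Ey : ℤ → Finset (ℤ × ℤ) := fun y => (D ×ˢ Ds).filter (fun x => (x.1, y, x.2) ∈ E) with hEy
  have hEsum : (E.card : ℝ) = ∑ y ∈ Ds, ((Ey y).card : ℝ) := by
    have e : E.card = ∑ y ∈ Ds, (Ey y).card := by
      rw [Finset.card_eq_sum_card_fiberwise (f := fun e : ℤ × ℤ × ℤ => e.2.1) (t := Ds)]
      · apply Finset.sum_congr rfl
        intro y hy
        apply Finset.card_bij (fun e _ => (e.1, e.2.2))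
        · intro e he
          obtain ⟨he1, rfl⟩ := Finset.mem_filter.1 he
          have := h.Esub he1
          simp only [Finset.mem_product] at this
          simp only [hEy, Finset.mem_filter, Finset.mem_product]
          exact ⟨⟨this.1, this.2.2⟩, he1⟩
        · intro e he e' he' hee
          have a1 := (Finset.mem_filter.1 he).2
          have a2 := (Finset.mem_filter.1 he').2
          simp only [Prod.mk.injEq] at hee
          exact Prod.ext hee.1 (Prod.ext (a1.trans a2.symm) hee.2)
        · rintro ⟨a, b⟩ hab
          simp only [hEy, Finset.mem_filter] at hab
          exact ⟨(a, y, b), Finset.mem_filter.2 ⟨hab.2, rfl⟩, rfl⟩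
      · intro e he
        have := h.Esub he
        simp only [Finset.mem_product] at this
        exact this.2.1
    exact_mod_cast e
  set Y1 := Ds.filter (fun y => m ^ 2 / L ^ 5 ≤ ((Ey y).card : ℝ)) with hY1
  have hY1s : Y1 ⊆ Ds := Finset.filter_subset _ _
  have hY1m : (Y1.card : ℝ) ≤ m := hsubm _ (hY1s.trans h.sub)
  have hL54 : ∀ a : ℕ, m ^ 3 / L ^ (a + 1) ≤ m ^ 3 / L ^ a - m * (m ^ 2 / L ^ (a + 1)) := by
    intro a
    have e1 : m ^ 3 / L ^ a = L * (m ^ 3 / L ^ (a + 1)) := by field_simp; exact pow_succ L a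
    have e2 : m * (m ^ 2 / L ^ (a + 1)) = m ^ 3 / L ^ (a + 1) := by ring
    rw [e1, e2]
    have : 0 < m ^ 3 / L ^ (a + 1) := by positivity
    nlinarith
  have hY1sum : m ^ 3 / L ^ 5 ≤ ∑ y ∈ Y1, ((Ey y).card : ℝ) := by
    refine (hL54 4).trans ?_
    exact heavy_sum Ds _ _ _ m (by positivity) hDsm (by rw [← hEsum]; exact hE3)
  have hY1c : m / L ^ 5 ≤ Y1.card := by
    have e1 : ∑ y ∈ Y1, ((Ey y).card : ℝ) ≤ Y1.card * m ^ 2 := by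
      rw [← nsmul_eq_mul, ← Finset.sum_const]
      apply Finset.sum_le_sum
      intro y _
      have : (Ey y).card ≤ D.card * Ds.card := by
        rw [← Finset.card_product]; exact Finset.card_filter_le _ _
      calc ((Ey y).card : ℝ) ≤ ((D.card * Ds.card : ℕ) : ℝ) := by exact_mod_cast this
        _ ≤ m * m := by push_cast; gcongr
        _ = _ := by ring
    have e2 : m / L ^ 5 * m ^ 2 ≤ Y1.card * m ^ 2 := by
      refine le_trans (le_of_eq ?_) (hY1sum.trans e1)
      ring
    exact le_of_mul_le_mul_right e2 (by positivity)
  -- BSG for each y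
  have hb : ∀ y ∈ Y1, ∃ A ⊆ D, ∃ B ⊆ Ds,
      m ^ 2 / L ^ 15 ≤ (((A ×ˢ B).filter (fun x => (x.1, y, x.2) ∈ E)).card : ℝ) ∧
      ((dil (m1 / η) A + dil ((y : ℝ) / η) B).card : ℝ) ≤ L ^ 60 * m := by
    intro y hy
    obtain ⟨hyD, hyE⟩ := Finset.mem_filter.1 hy
    obtain ⟨A, hA, B, hB, e1, e2⟩ := bsg D Ds (fun a b => (a, y, b) ∈ E) (fun a : ℤ => ⌊m1 / η * (a : ℝ)⌋)
      (fun b : ℤ => ⌊(y : ℝ) / η * (b : ℝ)⌋) S (L ^ 5) m (by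
        calc (100 : ℝ) ≤ L := hL
          _ = L ^ 1 := (pow_one L).symm
          _ ≤ L ^ 5 := hpow _ _ (by norm_num)) hm hDm hDsm hyE
      (by
        intro z
        refine (dil_fiber D (m1 / η) L hL0 hslope1 z).trans (hfac.trans (hpow _ _ (by norm_num))))
      (by
        intro z
        refine (dil_fiber Ds (y / η) L hL0 (hslope y hyD) z).trans (hfac.trans (hpow _ _ (by norm_num))))
      (by
        intro a _ b _ hab
        exact (hS _ hab).1)
      (hSc.trans (mul_le_mul_of_nonneg_right (hpow 3 5 (by norm_num)) hm.le))
    refine ⟨A, hA, B, hB, ?_, ?_⟩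
    · rw [← pow_mul] at e1; exact e1
    · rw [← pow_mul] at e2; exact e2
  choose! A hAD B hBD hAB1 hAB2 using hb
  set F : ℤ → Finset (ℤ × ℤ) := fun y => (A y ×ˢ B y).filter (fun x => (x.1, y, x.2) ∈ E) with hF
  have hFsub : ∀ y ∈ Y1, F y ⊆ D ×ˢ D := by
    intro y hy
    exact (Finset.filter_subset _ _).trans (Finset.product_subset_product (hAD y hy) ((hBD y hy).trans h.sub))
  have hFsum : m ^ 3 / L ^ 20 ≤ ∑ y ∈ Y1, ((F y).card : ℝ) := by
    calc m ^ 3 / L ^ 20 = m / L ^ 5 * (m ^ 2 / L ^ 15) := by field_simp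
      _ ≤ Y1.card * (m ^ 2 / L ^ 15) := by gcongr
      _ = ∑ y ∈ Y1, m ^ 2 / L ^ 15 := by rw [Finset.sum_const, nsmul_eq_mul]
      _ ≤ _ := Finset.sum_le_sum hAB1
  have hcs := cs_inter Y1 F (D ×ˢ D) hFsub
  have hcs2 : m ^ 3 / L ^ 40 * m ≤ ∑ y0 ∈ Y1, ∑ y ∈ Y1, ((F y ∩ F y0).card : ℝ) := by
    have e1 : (m ^ 3 / L ^ 20) ^ 2 ≤ m ^ 2 * ∑ y0 ∈ Y1, ∑ y ∈ Y1, ((F y ∩ F y0).card : ℝ) := by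
      calc (m ^ 3 / L ^ 20) ^ 2 ≤ (∑ y ∈ Y1, ((F y).card : ℝ)) ^ 2 := pow_le_pow_left₀ (by positivity) hFsum 2
        _ ≤ _ := hcs
        _ ≤ _ := by
          apply mul_le_mul_of_nonneg_right
          · rw [Finset.card_product]; push_cast
            calc (D.card : ℝ) * D.card ≤ m * m := by gcongr
              _ = _ := by ring
          · exact Finset.sum_nonneg (fun _ _ => Finset.sum_nonneg (fun _ _ => Nat.cast_nonneg _))
    have e2 : m ^ 2 * (m ^ 3 / L ^ 40 * m) ≤ m ^ 2 * ∑ y0 ∈ Y1, ∑ y ∈ Y1, ((F y ∩ F y0).card : ℝ) := by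
      refine le_trans (le_of_eq ?_) e1
      field_simp
    exact le_of_mul_le_mul_left e2 (by positivity)
  obtain ⟨y0, hy0, hy0s⟩ := pigeon Y1 _ _ m hY1m hm (by positivity) hcs2
  have hy0D := hY1s hy0
  set Y' := Y1.filter (fun y => m ^ 2 / L ^ 41 ≤ ((F y ∩ F y0).card : ℝ)) with hY'
  have hY's : Y' ⊆ Y1 := Finset.filter_subset _ _
  have hY'm : (Y'.card : ℝ) ≤ m := hsubm _ (hY's.trans (hY1s.trans h.sub))
  have hY'sum : m ^ 3 / L ^ 41 ≤ ∑ y ∈ Y', ((F y ∩ F y0).card : ℝ) :=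
    (hL54 40).trans (heavy_sum Y1 _ _ _ m (by positivity) hY1m hy0s)
  have hlarge : ∀ (P Q : Finset ℤ) (G : Finset (ℤ × ℤ)) (a : ℕ), G ⊆ P ×ˢ Q → (P.card : ℝ) ≤ m →
      (Q.card : ℝ) ≤ m → m ^ 2 / L ^ a ≤ G.card → m / L ^ a ≤ P.card ∧ m / L ^ a ≤ Q.card := by
    intro P Q G a hG hP hQ hc
    have e1 : (G.card : ℝ) ≤ P.card * Q.card := by
      have := Finset.card_le_card hG
      rw [Finset.card_product] at this
      exact_mod_cast this
    have e3 : m ^ 2 / L ^ a = m / L ^ a * m := by ring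
    constructor
    · have e2 : m / L ^ a * m ≤ P.card * m := by
        rw [← e3]
        exact (hc.trans e1).trans (by gcongr)
      exact le_of_mul_le_mul_right e2 hm
    · have e2 : m / L ^ a * m ≤ Q.card * m := by
        rw [← e3, mul_comm (Q.card : ℝ)]
        exact (hc.trans e1).trans (by gcongr)
      exact le_of_mul_le_mul_right e2 hm
  have hA0D := hAD y0 hy0
  have hB0D := hBD y0 hy0
  have h00 := hAB2 y0 hy0
  obtain ⟨hA0c, hB0c⟩ := hlarge (A y0) (B y0) (F y0) 15 (Finset.filter_subset _ _) (hsubm _ hA0D)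
    (hsubm _ (hB0D.trans h.sub)) (hAB1 y0 hy0)
  -- doubling of A and B
  have hAA : ((dil (m1 / η) (A y0) + dil (m1 / η) (A y0)).card : ℝ) ≤ L ^ 137 * m := by
    have := rz (dil (m1 / η) (A y0)) (dil ((y0 : ℝ) / η) (B y0)) (dil (m1 / η) (A y0)) (L ^ 60) (L ^ 60) (L ^ 17) m hm
      (by positivity) (by positivity) h00 (by rw [add_comm]; exact h00) (hlow _ _ 15 (hslope y0 hy0D) hB0c)
    exact this.trans (le_of_eq (by ring))
  have hBB0 : ((dil ((y0 : ℝ) / η) (B y0) + dil ((y0 : ℝ) / η) (B y0)).card : ℝ) ≤ L ^ 137 * m := by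
    have := rz (dil ((y0 : ℝ) / η) (B y0)) (dil (m1 / η) (A y0)) (dil ((y0 : ℝ) / η) (B y0)) (L ^ 60) (L ^ 60) (L ^ 17) m hm
      (by positivity) (by positivity) (by rw [add_comm]; exact h00) h00 (hlow _ _ 15 hslope1 hA0c)
    exact this.trans (le_of_eq (by ring))
  have hBB : ∀ y ∈ Ds, ((dil ((y : ℝ) / η) (B y0) + dil ((y : ℝ) / η) (B y0)).card : ℝ) ≤ L ^ 140 * m := by
    intro y hy
    have := hscale (B y0) (B y0) ((y : ℝ) / y0) ((y0 : ℝ) / η) ((y0 : ℝ) / η) (L ^ 137) (by positivity) (hratio y hy y0 hy0D) hBB0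
    have e : (y : ℝ) / y0 * ((y0 : ℝ) / η) = y / η := by
      have := hDs0 y0 hy0D
      field_simp
    rw [e] at this
    exact this.trans (le_of_eq (by ring))
  have hABy : ∀ y ∈ Y', ((dil (m1 / η) (A y0) + dil ((y : ℝ) / η) (B y0)).card : ℝ) ≤ L ^ 423 * m := by
    intro y hy
    obtain ⟨hy1, hyc⟩ := Finset.mem_filter.1 hy
    have hyD := hY1s hy1
    obtain ⟨c1, c2⟩ := hlarge (A y ∩ A y0) (B y ∩ B y0) (F y ∩ F y0) 41 (by
        intro p hp
        rw [Finset.mem_inter] at hp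
        have a1 := Finset.mem_product.1 (Finset.mem_filter.1 hp.1).1
        have a2 := Finset.mem_product.1 (Finset.mem_filter.1 hp.2).1
        exact Finset.mem_product.2 ⟨Finset.mem_inter.2 ⟨a1.1, a2.1⟩, Finset.mem_inter.2 ⟨a1.2, a2.2⟩⟩)
      (hsubm _ (Finset.inter_subset_right.trans hA0D))
      (hsubm _ (Finset.inter_subset_right.trans (hB0D.trans h.sub))) hyc
    have dsub : ∀ (t : ℝ) (U V : Finset ℤ), U ⊆ V → dil t U ⊆ dil t V := fun t U V hUV =>
      Finset.image_subset_image hUV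
    have s1 : ((dil (m1 / η) (A y0) + dil (m1 / η) (A y ∩ A y0)).card : ℝ) ≤ L ^ 137 * m := by
      refine le_trans ?_ hAA
      exact_mod_cast Finset.card_le_card (Finset.add_subset_add_left (dsub _ _ _ Finset.inter_subset_right))
    have s2 : ((dil (m1 / η) (A y ∩ A y0) + dil ((y : ℝ) / η) (B y ∩ B y0)).card : ℝ) ≤ L ^ 60 * m := by
      refine le_trans ?_ (hAB2 y hy1)
      exact_mod_cast Finset.card_le_card (Finset.add_subset_add (dsub _ _ _ Finset.inter_subset_left) (dsub _ _ _ Finset.inter_subset_left))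
    have s3 := rz _ _ _ _ _ _ m hm (by positivity) (by positivity) s1 s2 (hlow _ _ 41 hslope1 c1)
    have s4 : ((dil ((y : ℝ) / η) (B y ∩ B y0) + dil ((y : ℝ) / η) (B y0)).card : ℝ) ≤ L ^ 140 * m := by
      refine le_trans ?_ (hBB y hyD)
      exact_mod_cast Finset.card_le_card (Finset.add_subset_add_right (dsub _ _ _ Finset.inter_subset_right))
    have s5 := rz _ _ _ _ _ _ m hm (by positivity) (by positivity) s3 s4 (hlow _ _ 41 (hslope y hyD) c2)
    exact s5.trans (le_of_eq (by ring))
  -- choose b0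
  have hb0 : ∃ b0 ∈ Ds, m ^ 2 / L ^ 41 ≤ (((A y0 ×ˢ Y').filter (fun x => (x.1, x.2, b0) ∈ E)).card : ℝ) := by
    apply pigeon Ds _ _ m hDsm hm (by positivity)
    have e1 : ∀ y ∈ Y', ((F y ∩ F y0).card : ℝ) ≤ ∑ b ∈ Ds, (((A y0).filter (fun a => (a, y, b) ∈ E)).card : ℝ) := by
      intro y _
      have : (F y ∩ F y0).card ≤ ((A y0 ×ˢ Ds).filter (fun x => (x.1, y, x.2) ∈ E)).card := by
        apply Finset.card_le_card
        intro p hp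
        rw [Finset.mem_inter] at hp
        obtain ⟨a1, a2⟩ := Finset.mem_filter.1 hp.1
        have a3 := Finset.mem_product.1 (Finset.mem_filter.1 hp.2).1
        exact Finset.mem_filter.2 ⟨Finset.mem_product.2 ⟨a3.1, hB0D a3.2⟩, a2⟩
      rw [card_filter_prod' (A y0) Ds (fun a b => (a, y, b) ∈ E)] at this
      exact_mod_cast this
    have e2 := hY'sum.trans (Finset.sum_le_sum e1)
    rw [Finset.sum_comm] at e2
    refine le_trans (le_of_eq (by ring)) (e2.trans (le_of_eq ?_))
    apply Finset.sum_congr rfl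
    intro b _
    rw [card_filter_prod' (A y0) Y' (fun a y => (a, y, b) ∈ E)]
    push_cast; rfl
  obtain ⟨b0, hb0D, hb0c⟩ := hb0
  have hb0s := hslope b0 hb0D
  have hY'D : Y' ⊆ Ds := hY's.trans hY1s
  obtain ⟨A', hA', X, hX, e1, e2⟩ := bsg (A y0) Y' (fun a y => (a, y, b0) ∈ E) (fun a : ℤ => ⌊m1 / η * (a : ℝ)⌋)
      (fun b : ℤ => ⌊(b0 : ℝ) / η * (b : ℝ)⌋) S (L ^ 41) m (by
        calc (100 : ℝ) ≤ L := hL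
          _ = L ^ 1 := (pow_one L).symm
          _ ≤ L ^ 41 := hpow _ _ (by norm_num)) hm (hsubm _ hA0D) hY'm hb0c
      (by
        intro z
        refine (dil_fiber _ (m1 / η) L hL0 hslope1 z).trans (hfac.trans (hpow _ _ (by norm_num))))
      (by
        intro z
        refine (dil_fiber _ (b0 / η) L hL0 hb0s z).trans (hfac.trans (hpow _ _ (by norm_num))))
      (by
        intro a _ b _ hab
        exact (hS _ hab).2)
      (hSc.trans (mul_le_mul_of_nonneg_right (hpow 3 41 (by norm_num)) hm.le))
  rw [← pow_mul] at e1 e2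
  have hXD : X ⊆ Ds := hX.trans hY'D
  obtain ⟨hA'c, hXc⟩ := hlarge A' X _ (41 * 3) (Finset.filter_subset _ _) (hsubm _ (hA'.trans hA0D))
    (hsubm _ (hXD.trans h.sub)) e1
  have e2' : ((dil ((b0 : ℝ) / η) X + dil (m1 / η) A').card : ℝ) ≤ L ^ 492 * m := by
    rw [add_comm]; exact e2
  have hXB : ∀ y ∈ X, ((dil ((b0 : ℝ) / η) X + dil ((y : ℝ) / η) (B y0)).card : ℝ) ≤ L ^ 1040 * m := by
    intro y hy
    have s1 : ((dil (m1 / η) A' + dil ((y : ℝ) / η) (B y0)).card : ℝ) ≤ L ^ 423 * m := by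
      refine le_trans ?_ (hABy y (hX hy))
      exact_mod_cast Finset.card_le_card (Finset.add_subset_add_right (Finset.image_subset_image hA'))
    have s5 := rz _ _ _ _ _ _ m hm (by positivity) (by positivity) e2' s1 (hlow _ _ _ hslope1 hA'c)
    exact s5.trans (le_of_eq (by ring))
  have hXne : X.Nonempty := by
    rw [← Finset.card_pos]
    have : 0 < m / L ^ (41 * 3) := by positivity
    exact_mod_cast lt_of_lt_of_le this hXc
  obtain ⟨y1, hy1⟩ := hXne
  have hy1D := hXD hy1
  have hfin : ∀ y ∈ X, ((X + dil ((y : ℝ) / y1) X).card : ℝ) ≤ L ^ 2103 * m := by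
    intro y hy
    have hyD := hXD hy
    have s1 := hXB y hy
    have s2 := hscale X (B y0) ((y : ℝ) / y1) ((b0 : ℝ) / η) ((y1 : ℝ) / η) _ (by positivity) (hratio y hyD y1 hy1D) (hXB y1 hy1)
    have e : (y : ℝ) / y1 * ((y1 : ℝ) / η) = y / η := by
      have := hDs0 y1 hy1D
      field_simp
    rw [e, add_comm] at s2
    have s3 := rz _ _ _ _ _ _ m hm (by positivity) (by positivity) s1 s2 (hlow _ _ 15 (hslope y hyD) hB0c)
    have hb00 : (b0 : ℝ) / η ≠ 0 := div_ne_zero (hDs0 b0 hb0D) hη0.ne'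
    have s4 := hscale X X (((b0 : ℝ) / η)⁻¹) ((b0 : ℝ) / η) ((y : ℝ) / y1 * ((b0 : ℝ) / η)) _ (by positivity) (by
      rw [abs_inv]
      have : (|(b0 : ℝ) / η|)⁻¹ ≤ L := by
        rw [inv_le_comm₀ (abs_pos.2 hb00) hL0]
        rw [← one_div]; exact hb0s
      nlinarith) s3
    rw [inv_mul_cancel₀ hb00, dil_one] at s4
    have e' : ((b0 : ℝ) / η)⁻¹ * ((y : ℝ) / y1 * ((b0 : ℝ) / η)) = y / y1 := by
      rw [mul_comm, mul_assoc, mul_inv_cancel₀ hb00, mul_one]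
    rw [e'] at s4
    exact s4.trans (le_of_eq (by ring))
  have hLP : L ≤ L ^ 2300 := by
    calc L = L ^ 1 := (pow_one L).symm
      _ ≤ _ := hpow _ _ (by norm_num)
  refine ⟨X, y1, ?_⟩
  constructor
  · linarith
  · exact hη
  · exact hκ0
  · exact hκ1
  · intro x hx
    exact (h.Dbd x (h.sub (hXD hx))).trans (by gcongr)
  · exact hy1
  · refine le_trans ?_ (h.Dsbig y1 hy1D)
    gcongr
  · refine le_trans ?_ hXc
    calc η ^ κ / L ^ 2300 ≤ η ^ κ / L ^ (41 * 3) := by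
          apply div_le_div_of_nonneg_left hn.le (by positivity) (hpow _ _ (by norm_num))
      _ ≤ _ := by
          gcongr
          rw [hmdef]; nlinarith
  · intro a l hl
    refine le_trans ?_ ((h.Dloc a l hl).trans ?_)
    · exact_mod_cast Finset.card_le_card (Finset.filter_subset_filter _ (hXD.trans h.sub))
    · have : 0 < l ^ κ := Real.rpow_pos_of_pos (by linarith) _
      gcongr
  · intro y hy
    refine (hfin y hy).trans ?_
    rw [hmdef]
    calc L ^ 2103 * (L * η ^ κ) = L ^ 2104 * η ^ κ := by rw [← mul_assoc, ← pow_succ]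
      _ ≤ _ := mul_le_mul_of_nonneg_right (hpow _ _ (by norm_num)) hn.le
end

end PartNo7

section PartNo8

/-- Indicator of a proposition. -/
noncomputable def ind (P : Prop) : ℝ := open Classical in if P then 1 else 0

lemma ind_nonneg (P : Prop) : 0 ≤ ind P := by unfold ind; split_ifs <;> norm_num
lemma ind_le_one (P : Prop) : ind P ≤ 1 := by unfold ind; split_ifs <;> norm_num
lemma ind_true {P : Prop} (h : P) : ind P = 1 := by unfold ind; rw [if_pos h]
lemma ind_false {P : Prop} (h : ¬ P) : ind P = 0 := by unfold ind; rw [if_neg h]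
lemma ind_mono {P Q : Prop} (h : P → Q) : ind P ≤ ind Q := by
  by_cases hP : P
  · rw [ind_true hP, ind_true (h hP)]
  · rw [ind_false hP]; exact ind_nonneg _

/-- Weighted sum. -/
noncomputable def TT {α : Type*} (U : Finset α) (w : α → ℝ) (f : α → ℝ) : ℝ := ∑ n ∈ U, w n * f n

section
variable {α : Type*} {U : Finset α} {w : α → ℝ}

lemma TT_mono (hw : ∀ n ∈ U, 0 ≤ w n) {f g : α → ℝ} (h : ∀ n ∈ U, f n ≤ g n) : TT U w f ≤ TT U w g := by
  unfold TT
  exact Finset.sum_le_sum fun n hn => mul_le_mul_of_nonneg_left (h n hn) (hw n hn)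

lemma TT_nonneg (hw : ∀ n ∈ U, 0 ≤ w n) {f : α → ℝ} (h : ∀ n ∈ U, 0 ≤ f n) : 0 ≤ TT U w f :=
  Finset.sum_nonneg fun n hn => mul_nonneg (hw n hn) (h n hn)

lemma TT_le (hw : ∀ n ∈ U, 0 ≤ w n) (h1 : ∑ n ∈ U, w n ≤ 1) {f : α → ℝ} {c : ℝ} (hc : 0 ≤ c)
    (h : ∀ n ∈ U, f n ≤ c) : TT U w f ≤ c := by
  refine (TT_mono hw (g := fun _ => c) h).trans ?_
  unfold TT
  rw [← Finset.sum_mul]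
  nlinarith

lemma TT_add (f g : α → ℝ) : TT U w (fun n => f n + g n) = TT U w f + TT U w g := by
  unfold TT
  rw [← Finset.sum_add_distrib]
  exact Finset.sum_congr rfl fun n _ => by ring

lemma TT_smul (c : ℝ) (f : α → ℝ) : TT U w (fun n => c * f n) = c * TT U w f := by
  unfold TT
  rw [Finset.mul_sum]
  exact Finset.sum_congr rfl fun n _ => by ring

lemma TT_comm (f : α → α → ℝ) :
    TT U w (fun x => TT U w (fun y => f x y)) = TT U w (fun y => TT U w (fun x => f x y)) := by
  unfold TT
  simp only [Finset.mul_sum]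
  rw [Finset.sum_comm]
  refine Finset.sum_congr rfl fun n _ => Finset.sum_congr rfl fun m _ => by ring

lemma TT_ind (P : α → Prop) [DecidablePred P] : TT U w (fun n => ind (P n)) = ∑ n ∈ U with P n, w n := by
  unfold TT ind
  rw [Finset.sum_filter]
  refine Finset.sum_congr rfl fun n _ => ?_
  by_cases h : P n <;> simp [h]
end

/-- A weight on integers with Frostman-type bounds. -/
structure IW (U : Finset ℤ) (w : ℤ → ℝ) (K η κ : ℝ) : Prop where
  hK : 100 ≤ K
  hη : 1 ≤ η
  κ0 : 0 < κ
  κ1 : κ ≤ 1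
  w0 : ∀ n ∈ U, 0 ≤ w n
  w1 : ∑ n ∈ U, w n ≤ 1
  bd : ∀ n ∈ U, |(n : ℝ)| ≤ K * η
  loc : ∀ a l : ℝ, 1 ≤ l → TT U w (fun n => ind (|(n : ℝ) - a| ≤ l)) ≤ K * (l / η) ^ κ

section
variable {U : Finset ℤ} {w : ℤ → ℝ} {K η κ : ℝ}

lemma div_mul_rpow_le {l η κ : ℝ} (hl : 1 ≤ l) (hη : 1 ≤ η) (κ1 : κ ≤ 1) : (l / η) ^ κ ≤ l * η ^ (-κ) := by
  rw [Real.div_rpow (by linarith) (by linarith), Real.rpow_neg (by linarith), div_eq_mul_inv]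
  have : l ^ κ ≤ l := by
    calc l ^ κ ≤ l ^ (1 : ℝ) := Real.rpow_le_rpow_of_exponent_le hl κ1
      _ = l := Real.rpow_one l
  have : 0 < η ^ κ := Real.rpow_pos_of_pos (by linarith) _
  gcongr

/-- mass of the solutions of a linear inequality -/
lemma IW.lin (h : IW U w K η κ) (t Z R : ℝ) (hR : 1 ≤ R) (ht : η / R ≤ |t|) :
    TT U w (fun n => ind (|t * (n : ℝ) - Z| ≤ K * η)) ≤ K ^ 2 * R * η ^ (-κ) := by
  have hη := h.hη
  have hK := h.hK
  have ht0 : 0 < |t| := lt_of_lt_of_le (by positivity) ht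
  have ht1 : t ≠ 0 := abs_pos.1 ht0
  refine (TT_mono h.w0 (g := fun n => ind (|(n : ℝ) - Z / t| ≤ K * R)) ?_).trans ?_
  · intro n _
    apply ind_mono
    intro hn
    have e : t * (n : ℝ) - Z = t * (n - Z / t) := by field_simp
    rw [e, abs_mul] at hn
    by_contra! hc
    have : η / R * (K * R) < |t| * |(n : ℝ) - Z / t| := 
      mul_lt_mul' ht hc (by positivity) ht0
    have e2 : η / R * (K * R) = K * η := by field_simp
    linarith
  · have hKR : 1 ≤ K * R := by nlinarith
    refine (h.loc _ _ hKR).trans ?_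
    have := div_mul_rpow_le hKR hη h.κ1
    calc K * (K * R / η) ^ κ ≤ K * (K * R * η ^ (-κ)) := by gcongr
      _ = _ := by ring

/-- number of light solutions of a linear inequality -/
lemma IW.light (h : IW U w K η κ) (t Z R c : ℝ) (hc : 0 ≤ c) (hR : 1 ≤ R) (ht : η / R ≤ |t|) (P : ℤ → Prop)
    (hP : ∀ n ∈ U, P n → w n ≤ c) :
    TT U w (fun n => ind (|t * (n : ℝ) - Z| ≤ K * η ∧ P n)) ≤ K ^ 2 * R * c := by
  classical
  have hη := h.hη
  have hK := h.hK
  have ht0 : 0 < |t| := lt_of_lt_of_le (by positivity) ht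
  have ht1 : t ≠ 0 := abs_pos.1 ht0
  rw [TT_ind]
  have h1 : ∑ n ∈ U.filter (fun n : ℤ => |t * (n : ℝ) - Z| ≤ K * η ∧ P n), w n ≤
      ∑ n ∈ U.filter (fun n : ℤ => |t * (n : ℝ) - Z| ≤ K * η ∧ P n), c := by
    apply Finset.sum_le_sum
    intro n hn
    rw [Finset.mem_filter] at hn
    exact hP n hn.1 hn.2.2
  rw [Finset.sum_const, nsmul_eq_mul] at h1
  have h2 := card_int_near (U.filter (fun n : ℤ => |t * (n : ℝ) - Z| ≤ K * η ∧ P n)) (Z / t) (K * R) (by positivity) (by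
    intro n hn
    rw [Finset.mem_filter] at hn
    have hn := hn.2.1
    have e : t * (n : ℝ) - Z = t * (n - Z / t) := by field_simp
    rw [e, abs_mul] at hn
    by_contra! hc
    have : η / R * (K * R) < |t| * |(n : ℝ) - Z / t| := 
      mul_lt_mul' ht hc (by positivity) ht0
    have e2 : η / R * (K * R) = K * η := by field_simp
    linarith)
  refine h1.trans ?_
  have h3 : 2 * (K * R) + 1 ≤ K ^ 2 * R := by nlinarith
  exact mul_le_mul_of_nonneg_right (h2.trans h3) hc

/-- mass of small points -/
lemma IW.small (h : IW U w K η κ) (R : ℝ) (hR : 0 < R) (hRη : R ≤ η) :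
    TT U w (fun n => ind (|(n : ℝ)| < η / R)) ≤ K * R ^ (-κ) := by
  have hη := h.hη
  refine (TT_mono h.w0 (g := fun n => ind (|(n : ℝ) - 0| ≤ η / R)) ?_).trans ?_
  · intro n _
    apply ind_mono
    intro hn
    rw [sub_zero]; exact hn.le
  · refine (h.loc 0 _ ((one_le_div hR).2 hRη)).trans (le_of_eq ?_)
    congr 1
    rw [div_div, mul_comm R η, ← div_div, div_self (by linarith), one_div, Real.inv_rpow hR.le, Real.rpow_neg hR.le]

/-- the bilinear bound -/
lemma IW.bil (h : IW U w K η κ) (J : ℕ) (hJ : (J : ℝ) + 1 ≤ K) (hJ2 : K * η ≤ K ^ J) (Z : ℝ) :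
    TT U w (fun m => TT U w (fun n => ind (|(n : ℝ) * m - Z| ≤ K * η))) ≤ K ^ 5 * η ^ (-κ) := by
  have hη := h.hη
  have hK := h.hK
  have hη0 : (0 : ℝ) < η := by linarith
  have key : ∀ m ∈ U, TT U w (fun n => ind (|(n : ℝ) * m - Z| ≤ K * η)) ≤ K ^ 2 * (max |(m : ℝ)| 1) ^ (-κ) := by
    intro m hm
    by_cases hm0 : m = 0
    · subst hm0
      simp only [Int.cast_zero, abs_zero]
      rw [max_eq_right (by norm_num), Real.one_rpow]
      refine (TT_le h.w0 h.w1 zero_le_one fun n _ => ind_le_one _).trans ?_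
      nlinarith
    · have hm1 : (1 : ℝ) ≤ |(m : ℝ)| := by exact_mod_cast Int.one_le_abs hm0
      rw [max_eq_left hm1]
      have hmb := h.bd m hm
      have hmne : (m : ℝ) ≠ 0 := by exact_mod_cast hm0
      have hl : 1 ≤ K * η / |(m : ℝ)| := (one_le_div (by linarith)).2 hmb
      refine (TT_mono h.w0 (g := fun n => ind (|(n : ℝ) - Z / m| ≤ K * η / |(m : ℝ)|)) ?_).trans ?_
      · intro n _
        apply ind_mono
        intro hn
        rw [le_div_iff₀ (by linarith), ← abs_mul]
        rw [sub_mul, div_mul_cancel₀ _ hmne]; exact hn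
      · refine (h.loc _ _ hl).trans ?_
        have e : K * η / |(m : ℝ)| / η = K / |(m : ℝ)| := by field_simp
        rw [e, Real.div_rpow (by linarith) (by linarith), Real.rpow_neg (by linarith), div_eq_mul_inv]
        have : K ^ κ ≤ K := by
          calc K ^ κ ≤ K ^ (1 : ℝ) := Real.rpow_le_rpow_of_exponent_le (by linarith) h.κ1
            _ = K := Real.rpow_one K
        have h3 : 0 < |(m : ℝ)| ^ κ := Real.rpow_pos_of_pos (by linarith) _
        calc K * (K ^ κ * (|(m : ℝ)| ^ κ)⁻¹) ≤ K * (K * (|(m : ℝ)| ^ κ)⁻¹) := by gcongr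
          _ = _ := by ring
  refine (TT_mono h.w0 key).trans ?_
  rw [TT_smul]
  have hb := block_sum U w (fun m => max |(m : ℝ)| 1) κ (K * η ^ (-κ)) K J h.κ0.le (by linarith) h.w0
    (fun m _ => le_max_right _ _) (fun m hm => (max_le (h.bd m hm) (by nlinarith)).trans hJ2) (by
      intro l hl
      classical
      have := h.loc 0 l hl
      rw [TT_ind] at this
      refine le_trans (le_of_eq ?_) (this.trans (le_of_eq ?_))
      · apply Finset.sum_congr _ fun _ _ => rfl
        apply Finset.filter_congr
        intro x _
        rw [sub_zero, max_le_iff]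
        exact ⟨fun h => h.1, fun h => ⟨h, hl⟩⟩
      · rw [Real.div_rpow (by linarith) (by linarith), Real.rpow_neg (by linarith)]
        ring)
  have hp : 0 < η ^ (-κ) := Real.rpow_pos_of_pos hη0 _
  have hKκ : K ^ κ ≤ K := by
    calc K ^ κ ≤ K ^ (1 : ℝ) := Real.rpow_le_rpow_of_exponent_le (by linarith) h.κ1
      _ = K := Real.rpow_one K
  calc K ^ 2 * TT U w (fun m => (max |(m : ℝ)| 1) ^ (-κ)) ≤ K ^ 2 * ((J + 1) * (K * η ^ (-κ)) * K ^ κ) := by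
        unfold TT; gcongr
    _ ≤ K ^ 2 * (K * (K * η ^ (-κ)) * K) := by gcongr
    _ = _ := by ring
end

end PartNo8

section PartNo9

section
variable {U : Finset ℤ} {w : ℤ → ℝ} {K η κ : ℝ}

lemma sum_ind {α : Type*} (s : Finset α) (P : α → Prop) [DecidablePred P] :
    ∑ x ∈ s, ind (P x) = ((s.filter P).card : ℝ) := by
  rw [Finset.card_filter]
  push_cast
  refine Finset.sum_congr rfl fun x _ => ?_
  unfold ind
  by_cases h : P x <;> simp [h]

lemma TT_rot (f : ℤ → ℤ → ℤ → ℝ) : TT U w (fun x => TT U w fun y => TT U w fun z => f x y z) =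
    TT U w (fun y => TT U w fun z => TT U w fun x => f x y z) := by
  rw [TT_comm (fun x y => TT U w fun z => f x y z)]
  congr 1
  funext y
  exact TT_comm (fun x z => f x y z)

/-- Fourfold weighted sum. -/
noncomputable def T4 (U : Finset ℤ) (w : ℤ → ℝ) (f : ℤ → ℤ → ℤ → ℤ → ℝ) : ℝ :=
  TT U w fun y => TT U w fun b => TT U w fun a => TT U w fun d => f y b a d

lemma T4_add (f g : ℤ → ℤ → ℤ → ℤ → ℝ) :
    T4 U w (fun y b a d => f y b a d + g y b a d) = T4 U w f + T4 U w g := by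
  simp only [T4, TT_add]

lemma T4_mono (hw : ∀ n ∈ U, 0 ≤ w n) {f g : ℤ → ℤ → ℤ → ℤ → ℝ}
    (h : ∀ y ∈ U, ∀ b ∈ U, ∀ a ∈ U, ∀ d ∈ U, f y b a d ≤ g y b a d) : T4 U w f ≤ T4 U w g :=
  TT_mono hw fun y hy => TT_mono hw fun b hb => TT_mono hw fun a ha => TT_mono hw fun d hd => h y hy b hb a ha d hd

lemma T4_a (f : ℤ → ℤ → ℤ → ℤ → ℝ) : T4 U w f =
    TT U w fun y => TT U w fun b => TT U w fun d => TT U w fun a => f y b a d := by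
  unfold T4
  congr 1; funext y; congr 1; funext b
  exact TT_comm _

lemma T4_b (f : ℤ → ℤ → ℤ → ℤ → ℝ) : T4 U w f =
    TT U w fun y => TT U w fun a => TT U w fun d => TT U w fun b => f y b a d := by
  unfold T4
  congr 1; funext y
  exact TT_rot _

lemma T4_y (f : ℤ → ℤ → ℤ → ℤ → ℝ) : T4 U w f =
    TT U w fun b => TT U w fun a => TT U w fun d => TT U w fun y => f y b a d := by
  unfold T4
  rw [TT_comm]
  congr 1; funext b
  exact TT_rot _

lemma T4_ad (f : ℤ → ℤ → ℤ → ℤ → ℝ) : T4 U w f =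
    TT U w fun a => TT U w fun d => TT U w fun y => TT U w fun b => f y b a d := by
  rw [T4_y, TT_rot]
  congr 1; funext a; congr 1; funext d
  exact TT_comm _

lemma IW.quad (h : IW U w K η κ) (q s : ℕ) (hqs : q ≤ s) (hs : K ^ s ≤ η)
    (hsκ : (K ^ s) ^ (-κ) ≤ (K ^ (q + 20))⁻¹)
    (hEX : ∀ D Ds E m1 m3 Z, ¬ EX D Ds E m1 m3 Z (K ^ (s + 25)) η κ)
    (m1 m3 Z : ℝ) (hm1 : η / K ^ q ≤ |m1|) (hm3 : η / K ^ q ≤ |m3|) :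
    T4 U w (fun y b a d => ind (|m1 * (a : ℝ) + (y : ℝ) * b - m3 * d - Z| ≤ K * η)) ≤ η ^ (-κ) * (K ^ 2)⁻¹ := by
  classical
  have hK := h.hK
  have hη := h.hη
  have hK0 : 0 < K := by linarith
  have hK1 : 1 ≤ K := by linarith
  have hη0 : 0 < η := by linarith
  set N := η ^ (-κ) with hN
  have hN0 : 0 < N := Real.rpow_pos_of_pos hη0 _
  have hq1 : (1 : ℝ) ≤ K ^ q := one_le_pow₀ hK1
  have hs1 : (1 : ℝ) ≤ K ^ s := one_le_pow₀ hK1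
  set c := N * (K ^ (s + 20))⁻¹ with hc
  have hc0 : 0 < c := by positivity
  set ev : ℤ → ℤ → ℤ → ℤ → Prop := fun y b a d => |m1 * (a : ℝ) + (y : ℝ) * b - m3 * d - Z| ≤ K * η with hev
  set sm : ℤ → Prop := fun y => |(y : ℝ)| < η / K ^ s with hsm
  set good : ℤ → ℤ → ℤ → ℤ → Prop := fun y b a d => (¬ sm y ∧ c < w y) ∧ (¬ sm b ∧ c < w b) ∧ c < w a ∧ c < w d with hgood
  have hsmass : TT U w (fun y => ind (sm y)) ≤ K * (K ^ (q + 20))⁻¹ :=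
    (h.small (K ^ s) (by positivity) hs).trans (by gcongr)
  have split : ∀ y b a d, ind (ev y b a d) ≤ ind (ev y b a d ∧ sm y) + (ind (ev y b a d ∧ sm b) +
      (ind (ev y b a d ∧ w a ≤ c) + (ind (ev y b a d ∧ w d ≤ c) + (ind (ev y b a d ∧ (¬ sm y ∧ w b ≤ c)) +
      (ind (ev y b a d ∧ (¬ sm b ∧ w y ≤ c)) + ind (ev y b a d ∧ good y b a d)))))) := by
    intro y b a d
    have p1 := ind_nonneg (ev y b a d ∧ sm y)
    have p2 := ind_nonneg (ev y b a d ∧ sm b)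
    have p3 := ind_nonneg (ev y b a d ∧ w a ≤ c)
    have p4 := ind_nonneg (ev y b a d ∧ w d ≤ c)
    have p5 := ind_nonneg (ev y b a d ∧ (¬ sm y ∧ w b ≤ c))
    have p6 := ind_nonneg (ev y b a d ∧ (¬ sm b ∧ w y ≤ c))
    have p7 := ind_nonneg (ev y b a d ∧ good y b a d)
    by_cases he : ev y b a d
    swap
    · rw [ind_false he]; linarith
    rw [ind_true he]
    by_cases c1 : sm y
    · rw [ind_true (And.intro he c1)]; linarith
    by_cases c2 : sm b
    · rw [ind_true (And.intro he c2)]; linarith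
    by_cases c3 : w a ≤ c
    · rw [ind_true (And.intro he c3)]; linarith
    by_cases c4 : w d ≤ c
    · rw [ind_true (And.intro he c4)]; linarith
    by_cases c5 : w b ≤ c
    · rw [ind_true (And.intro he (And.intro c1 c5))]; linarith
    by_cases c6 : w y ≤ c
    · rw [ind_true (And.intro he (And.intro c2 c6))]; linarith
    have : ev y b a d ∧ good y b a d := ⟨he, ⟨c1, not_le.1 c6⟩, ⟨c2, not_le.1 c5⟩, not_le.1 c3, not_le.1 c4⟩
    rw [ind_true this]; linarith
  have lind : ∀ y b a, TT U w (fun d => ind (ev y b a d)) ≤ K ^ 2 * K ^ q * N := by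
    intro y b a
    refine le_trans (TT_mono h.w0 fun d _ => ?_) (h.lin m3 (m1 * a + y * b - Z) (K ^ q) hq1 hm3)
    apply ind_mono
    intro he
    rw [← abs_neg]
    convert he using 2
    ring
  have lindP : ∀ y b a (P : Prop), TT U w (fun d => ind (ev y b a d ∧ P)) ≤ K ^ 2 * K ^ q * N * ind P := by
    intro y b a P
    by_cases hP : P
    · rw [ind_true hP, mul_one]
      exact le_trans (TT_mono h.w0 fun d _ => ind_mono (fun h => h.1)) (lind y b a)
    · rw [ind_false hP, mul_zero]
      refine TT_le h.w0 h.w1 le_rfl fun d _ => ?_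
      rw [ind_false (fun h => hP h.2)]
  have hcC : 0 ≤ K ^ 2 * K ^ q * N := by positivity
  -- small y
  have b1 : T4 U w (fun y b a d => ind (ev y b a d ∧ sm y)) ≤ N * (K ^ 4)⁻¹ := by
    have : T4 U w (fun y b a d => ind (ev y b a d ∧ sm y)) ≤ TT U w (fun y => K ^ 2 * K ^ q * N * ind (sm y)) := by
      refine TT_mono h.w0 fun y _ => ?_
      have : 0 ≤ K ^ 2 * K ^ q * N * ind (sm y) := mul_nonneg hcC (ind_nonneg _)
      exact TT_le h.w0 h.w1 this fun b _ => TT_le h.w0 h.w1 this fun a _ => lindP _ _ _ _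
    rw [TT_smul] at this
    refine this.trans ((mul_le_mul_of_nonneg_left hsmass hcC).trans ?_)
    have e : K ^ 2 * K ^ q * N * (K * (K ^ (q + 20))⁻¹) = N * (K ^ 17)⁻¹ := by
      rw [pow_add]; field_simp
    rw [e]
    gcongr <;> norm_num [hK1]
  have b2 : T4 U w (fun y b a d => ind (ev y b a d ∧ sm b)) ≤ N * (K ^ 4)⁻¹ := by
    have : T4 U w (fun y b a d => ind (ev y b a d ∧ sm b)) ≤
        TT U w (fun y => TT U w fun b => K ^ 2 * K ^ q * N * ind (sm b)) := by
      refine TT_mono h.w0 fun y _ => TT_mono h.w0 fun b _ => ?_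
      have : 0 ≤ K ^ 2 * K ^ q * N * ind (sm b) := mul_nonneg hcC (ind_nonneg _)
      exact TT_le h.w0 h.w1 this fun a _ => lindP _ _ _ _
    refine this.trans (TT_le h.w0 h.w1 (by positivity) fun y _ => ?_)
    rw [TT_smul]
    refine ((mul_le_mul_of_nonneg_left hsmass hcC).trans ?_)
    have e : K ^ 2 * K ^ q * N * (K * (K ^ (q + 20))⁻¹) = N * (K ^ 17)⁻¹ := by
      rw [pow_add]; field_simp
    rw [e]
    gcongr <;> norm_num [hK1]
  have hcs : K ^ 2 * K ^ s * c ≤ N * (K ^ 4)⁻¹ := by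
    have e : K ^ 2 * K ^ s * c = N * (K ^ 18)⁻¹ := by
      rw [hc, pow_add]; field_simp
    rw [e]
    gcongr <;> norm_num [hK1]
  have hcq : K ^ 2 * K ^ q * c ≤ N * (K ^ 4)⁻¹ := by
    refine le_trans ?_ hcs
    gcongr
  have hp4 : 0 ≤ N * (K ^ 4)⁻¹ := by positivity
  have b3 : T4 U w (fun y b a d => ind (ev y b a d ∧ w a ≤ c)) ≤ N * (K ^ 4)⁻¹ := by
    rw [T4_a]
    refine TT_le h.w0 h.w1 hp4 fun y _ => TT_le h.w0 h.w1 hp4 fun b _ => TT_le h.w0 h.w1 hp4 fun d _ => ?_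
    refine le_trans (TT_mono h.w0 fun a _ => ?_)
      ((h.light m1 (m3 * d + Z - y * b) (K ^ q) c hc0.le hq1 hm1 (fun a => w a ≤ c) (fun _ _ h => h)).trans hcq)
    apply ind_mono
    rintro ⟨he, h2⟩
    refine ⟨?_, h2⟩
    convert he using 2
    ring
  have b4 : T4 U w (fun y b a d => ind (ev y b a d ∧ w d ≤ c)) ≤ N * (K ^ 4)⁻¹ := by
    refine TT_le h.w0 h.w1 hp4 fun y _ => TT_le h.w0 h.w1 hp4 fun b _ => TT_le h.w0 h.w1 hp4 fun a _ => ?_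
    refine le_trans (TT_mono h.w0 fun d _ => ?_)
      ((h.light m3 (m1 * a + y * b - Z) (K ^ q) c hc0.le hq1 hm3 (fun a => w a ≤ c) (fun _ _ h => h)).trans hcq)
    apply ind_mono
    rintro ⟨he, h2⟩
    refine ⟨?_, h2⟩
    rw [← abs_neg]
    convert he using 2
    ring
  have b5 : T4 U w (fun y b a d => ind (ev y b a d ∧ (¬ sm y ∧ w b ≤ c))) ≤ N * (K ^ 4)⁻¹ := by
    rw [T4_b]
    refine TT_le h.w0 h.w1 hp4 fun y _ => TT_le h.w0 h.w1 hp4 fun a _ => TT_le h.w0 h.w1 hp4 fun d _ => ?_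
    by_cases hy : sm y
    · refine TT_le h.w0 h.w1 hp4 fun b _ => ?_
      rw [ind_false (fun h => h.2.1 hy)]; exact hp4
    refine le_trans (TT_mono h.w0 fun b _ => ?_)
      ((h.light y (m3 * d + Z - m1 * a) (K ^ s) c hc0.le hs1 (not_lt.1 hy) (fun a => w a ≤ c) (fun _ _ h => h)).trans hcs)
    apply ind_mono
    rintro ⟨he, _, h2⟩
    refine ⟨?_, h2⟩
    convert he using 2
    ring
  have b6 : T4 U w (fun y b a d => ind (ev y b a d ∧ (¬ sm b ∧ w y ≤ c))) ≤ N * (K ^ 4)⁻¹ := by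
    rw [T4_y]
    refine TT_le h.w0 h.w1 hp4 fun b _ => TT_le h.w0 h.w1 hp4 fun a _ => TT_le h.w0 h.w1 hp4 fun d _ => ?_
    by_cases hb : sm b
    · refine TT_le h.w0 h.w1 hp4 fun y _ => ?_
      rw [ind_false (fun h => h.2.1 hb)]; exact hp4
    refine le_trans (TT_mono h.w0 fun y _ => ?_)
      ((h.light b (m3 * d + Z - m1 * a) (K ^ s) c hc0.le hs1 (not_lt.1 hb) (fun a => w a ≤ c) (fun _ _ h => h)).trans hcs)
    apply ind_mono
    rintro ⟨he, _, h2⟩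
    refine ⟨?_, h2⟩
    convert he using 2
    ring
  -- single weights
  have hloc1 : ∀ n ∈ U, w n ≤ K * N := by
    intro n hn
    have := h.loc n 1 le_rfl
    rw [TT_ind, Real.div_rpow zero_le_one hη0.le, Real.one_rpow, one_div, ← Real.rpow_neg hη0.le] at this
    refine le_trans ?_ this
    apply Finset.single_le_sum (f := w) (fun i hi => h.w0 i (Finset.mem_filter.1 hi).1)
    rw [Finset.mem_filter]
    exact ⟨hn, by simp⟩
  set D := U.filter (fun n => c < w n) with hD
  set Ds := D.filter (fun n => ¬ sm n) with hDs
  set E := (D ×ˢ Ds ×ˢ Ds).filter (fun e => ∃ d ∈ D, ev e.2.1 e.2.2 e.1 d) with hE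
  have b7 : T4 U w (fun y b a d => ind (ev y b a d ∧ good y b a d)) ≤ K ^ 2 * K ^ q * (K * N) * ((K * N) ^ 3 * E.card) := by
    have s1 : T4 U w (fun y b a d => ind (ev y b a d ∧ good y b a d)) ≤
        TT U w fun y => TT U w fun b => TT U w fun a => K ^ 2 * K ^ q * (K * N) * ind ((a, y, b) ∈ E) := by
      refine TT_mono h.w0 fun y hy => TT_mono h.w0 fun b hb => TT_mono h.w0 fun a ha => ?_
      by_cases hm : (a, y, b) ∈ E
      · rw [ind_true hm, mul_one]
        refine le_trans (TT_mono h.w0 fun d _ => ?_)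
          (h.light m3 (m1 * a + y * b - Z) (K ^ q) (K * N) (by positivity) hq1 hm3 (fun _ => True) (fun n hn _ => hloc1 n hn))
        apply ind_mono
        rintro ⟨he, h2⟩
        refine ⟨?_, trivial⟩
        rw [← abs_neg]
        convert he using 2
        ring
      · rw [ind_false hm, mul_zero]
        refine TT_le h.w0 h.w1 le_rfl fun d hd => ?_
        refine le_of_eq (ind_false ?_)
        rintro ⟨he, g1, g2, g3, g4⟩
        apply hm
        simp only [hE, hDs, hD, Finset.mem_filter, Finset.mem_product]
        exact ⟨⟨⟨ha, g3⟩, ⟨⟨hy, g1.2⟩, g1.1⟩, ⟨hb, g2.2⟩, g2.1⟩, d, ⟨hd, g4⟩, he⟩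
    refine s1.trans ?_
    simp only [TT_smul]
    refine mul_le_mul_of_nonneg_left ?_ (by positivity)
    have hW : ∀ f : ℤ → ℝ, (∀ n, 0 ≤ f n) → TT U w f ≤ K * N * ∑ n ∈ U, f n := by
      intro f hf
      unfold TT
      rw [Finset.mul_sum]
      exact Finset.sum_le_sum fun n hn => mul_le_mul_of_nonneg_right (hloc1 n hn) (hf n)
    have s2 : (TT U w fun y => TT U w fun b => TT U w fun a => ind ((a, y, b) ∈ E)) ≤
        K * N * ∑ y ∈ U, (K * N * ∑ b ∈ U, (K * N * ∑ a ∈ U, ind ((a, y, b) ∈ E))) := by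
      refine le_trans (TT_mono h.w0 fun y _ => le_trans (TT_mono h.w0 fun b _ => hW _ fun a => ind_nonneg _) (hW _ fun b => ?_))
        (hW _ fun y => ?_)
      · exact mul_nonneg (by positivity) (Finset.sum_nonneg fun _ _ => ind_nonneg _)
      · exact mul_nonneg (by positivity) (Finset.sum_nonneg fun _ _ => mul_nonneg (by positivity) (Finset.sum_nonneg fun _ _ => ind_nonneg _))
    have s3 : ∑ y ∈ U, ∑ b ∈ U, ∑ a ∈ U, ind ((a, y, b) ∈ E) ≤ E.card := by
      have e1 : ∑ y ∈ U, ∑ b ∈ U, ∑ a ∈ U, ind ((a, y, b) ∈ E) =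
          ∑ x ∈ U ×ˢ U ×ˢ U, ind ((x.2.2, x.1, x.2.1) ∈ E) := by
        rw [Finset.sum_product]
        refine Finset.sum_congr rfl fun y _ => ?_
        rw [Finset.sum_product]
      rw [e1]
      rw [sum_ind]
      norm_cast
      apply Finset.card_le_card_of_injOn (fun x => (x.2.2, x.1, x.2.1))
      · intro x hx
        simp only [Finset.coe_filter, Set.mem_setOf_eq] at hx
        exact hx.2
      · rintro ⟨x1, x2, x3⟩ _ ⟨y1, y2, y3⟩ _ hxy
        simp only [Prod.mk.injEq] at hxy ⊢
        exact ⟨hxy.2.1, hxy.2.2, hxy.1⟩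
    refine s2.trans ?_
    simp only [← Finset.mul_sum]
    calc _ = (K * N) ^ 3 * ∑ y ∈ U, ∑ b ∈ U, ∑ a ∈ U, ind ((a, y, b) ∈ E) := by ring
      _ ≤ _ := by gcongr
  have b8 : T4 U w (fun y b a d => ind (ev y b a d ∧ good y b a d)) ≤ N * (K ^ 3)⁻¹ := by
    by_contra! hcon
    refine hEX D Ds E m1 m3 Z ⟨?_, hη, ?_, ?_, ?_, Finset.filter_subset _ _, ?_, ?_, Finset.filter_subset _ _, ?_, ?_⟩
    · calc (100 : ℝ) ≤ K := hK
        _ ≤ K ^ (s + 25) := le_self_pow₀ hK1 (by omega)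
    · have : (D.card : ℝ) * c ≤ 1 := by
        refine le_trans ?_ h.w1
        rw [← nsmul_eq_mul, ← Finset.sum_const]
        refine le_trans (Finset.sum_le_sum (g := w) fun n hn => (Finset.mem_filter.1 hn).2.le) ?_
        exact Finset.sum_le_sum_of_subset_of_nonneg (Finset.filter_subset _ _) fun i hi _ => h.w0 i hi
      have e : c * (K ^ (s + 20) * η ^ κ) = 1 := by
        rw [hc, hN, Real.rpow_neg hη0.le]
        have : 0 < η ^ κ := Real.rpow_pos_of_pos hη0 _
        field_simp
      have : (D.card : ℝ) ≤ K ^ (s + 20) * η ^ κ := by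
        have h0 : 0 < K ^ (s + 20) * η ^ κ := mul_pos (by positivity) (Real.rpow_pos_of_pos hη0 _)
        calc (D.card : ℝ) = D.card * c * (K ^ (s + 20) * η ^ κ) := by rw [mul_assoc, e, mul_one]
          _ ≤ 1 * (K ^ (s + 20) * η ^ κ) := by gcongr
          _ = _ := one_mul _
      refine this.trans (mul_le_mul_of_nonneg_right (pow_le_pow_right₀ hK1 (by omega)) (Real.rpow_pos_of_pos hη0 _).le)
    · intro x hx
      refine (h.bd x (Finset.mem_filter.1 hx).1).trans (mul_le_mul_of_nonneg_right (le_self_pow₀ hK1 (by omega)) hη0.le)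
    · intro a l hl
      have h0 : 0 < K ^ (s + 20) * η ^ κ := mul_pos (by positivity) (Real.rpow_pos_of_pos hη0 _)
      set A := D.filter (fun x : ℤ => |(x : ℝ) - a| ≤ l) with hA
      have h1 : (A.card : ℝ) * c ≤ K * (l / η) ^ κ := by
        refine le_trans ?_ (h.loc a l hl)
        rw [TT_ind, ← nsmul_eq_mul, ← Finset.sum_const]
        refine le_trans (Finset.sum_le_sum (g := w) fun n hn => (Finset.mem_filter.1 (Finset.mem_filter.1 hn).1).2.le) ?_
        exact Finset.sum_le_sum_of_subset_of_nonneg (Finset.filter_subset_filter _ (Finset.filter_subset _ _))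
          fun i hi _ => h.w0 i (Finset.mem_filter.1 hi).1
      have e : c * (K ^ (s + 20) * η ^ κ) = 1 := by
        rw [hc, hN, Real.rpow_neg hη0.le]
        have : 0 < η ^ κ := Real.rpow_pos_of_pos hη0 _
        field_simp
      calc (A.card : ℝ) = A.card * c * (K ^ (s + 20) * η ^ κ) := by rw [mul_assoc, e, mul_one]
        _ ≤ K * (l / η) ^ κ * (K ^ (s + 20) * η ^ κ) := by gcongr
        _ = K ^ (s + 21) * l ^ κ := by
          rw [Real.div_rpow (by linarith) hη0.le]
          have : 0 < η ^ κ := Real.rpow_pos_of_pos hη0 _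
          field_simp
          ring
        _ ≤ _ := mul_le_mul_of_nonneg_right (pow_le_pow_right₀ hK1 (by omega)) (Real.rpow_nonneg (by linarith) _)
    · intro x hx
      refine le_trans ?_ (not_lt.1 (Finset.mem_filter.1 hx).2)
      exact div_le_div_of_nonneg_left hη0.le (by positivity) (pow_le_pow_right₀ hK1 (by omega))
    · refine le_trans ?_ hm1
      exact div_le_div_of_nonneg_left hη0.le (by positivity) (pow_le_pow_right₀ hK1 (by omega))
    · intro e he
      obtain ⟨d, hd, hed⟩ := (Finset.mem_filter.1 he).2
      refine ⟨d, hd, le_trans hed ?_⟩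
      exact mul_le_mul_of_nonneg_right (le_self_pow₀ hK1 (by omega)) hη0.le
    · have hlt := lt_of_lt_of_le hcon b7
      have hκp : 0 < η ^ κ := Real.rpow_pos_of_pos hη0 _
      have hNκ : N * η ^ κ = 1 := by rw [hN, Real.rpow_neg hη0.le]; field_simp
      have e1 : (η ^ κ) ^ 3 / K ^ (q + 9) ≤ E.card := by
        rw [div_le_iff₀ (by positivity)]
        have e2 : N * (K ^ 3)⁻¹ * (K ^ 3 * (η ^ κ) ^ 4) ≤ K ^ 2 * K ^ q * (K * N) * ((K * N) ^ 3 * E.card) * (K ^ 3 * (η ^ κ) ^ 4) := by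
          gcongr
        have e3 : N * (K ^ 3)⁻¹ * (K ^ 3 * (η ^ κ) ^ 4) = (N * η ^ κ) * (η ^ κ) ^ 3 := by
          field_simp
        have e4 : K ^ 2 * K ^ q * (K * N) * ((K * N) ^ 3 * E.card) * (K ^ 3 * (η ^ κ) ^ 4) = (N * η ^ κ) ^ 4 * (E.card * K ^ (q + 9)) := by
          ring
        rw [e3, e4, hNκ] at e2
        simpa using e2
      refine le_trans ?_ e1
      exact div_le_div_of_nonneg_left (by positivity) (by positivity) (pow_le_pow_right₀ hK1 (by omega))
  refine (T4_mono h.w0 fun y _ b _ a _ d _ => split y b a d).trans ?_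
  rw [T4_add, T4_add, T4_add, T4_add, T4_add, T4_add]
  have e4 : N * (K ^ 4)⁻¹ = N * (K ^ 2)⁻¹ * (K ^ 2)⁻¹ := by field_simp
  have e3 : N * (K ^ 3)⁻¹ = N * (K ^ 2)⁻¹ * K⁻¹ := by field_simp
  have i1 : K⁻¹ ≤ 1 / 100 := by rw [inv_le_comm₀ hK0 (by norm_num)]; norm_num; linarith
  have i2 : (K ^ 2)⁻¹ ≤ 1 / 100 := by rw [inv_le_comm₀ (by positivity) (by norm_num)]; norm_num; nlinarith
  have hp : 0 < N * (K ^ 2)⁻¹ := by positivity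
  have j1 : N * (K ^ 2)⁻¹ * (K ^ 2)⁻¹ ≤ N * (K ^ 2)⁻¹ * (1 / 100) := by gcongr
  have j2 : N * (K ^ 2)⁻¹ * K⁻¹ ≤ N * (K ^ 2)⁻¹ * (1 / 100) := by gcongr
  linarith
end

end PartNo9

section PartNo10

section
variable {U : Finset ℤ} {w : ℤ → ℝ} {K η κ : ℝ}

lemma IW.hex (h : IW U w K η κ) (q s : ℕ) (hqs : q ≤ s) (hs : K ^ s ≤ η)
    (hsκ : (K ^ s) ^ (-κ) ≤ (K ^ (q + 20))⁻¹) (hqκ : (K ^ q) ^ (-κ) ≤ (K ^ 20)⁻¹)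
    (hEX : ∀ D Ds E m1 m3 Z, ¬ EX D Ds E m1 m3 Z (K ^ (s + 25)) η κ)
    (J : ℕ) (hJ : (J : ℝ) + 1 ≤ K) (hJ2 : K * η ≤ K ^ J) (Z : ℝ) :
    (TT U w fun d => TT U w fun m3 => TT U w fun y => TT U w fun b => TT U w fun a => TT U w fun m1 =>
      ind (|(m1 : ℝ) * (a : ℝ) + (y : ℝ) * b - (m3 : ℝ) * d - Z| ≤ K * η)) ≤ η ^ (-κ) * K⁻¹ := by
  have hK := h.hK
  have hη := h.hη
  have hK0 : 0 < K := by linarith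
  have hK1 : 1 ≤ K := by linarith
  have hη0 : 0 < η := by linarith
  have hN0 : 0 < η ^ (-κ) := Real.rpow_pos_of_pos hη0 _
  have hq : K ^ q ≤ η := (pow_le_pow_right₀ hK1 hqs).trans hs
  have e : (TT U w fun d => TT U w fun m3 => TT U w fun y => TT U w fun b => TT U w fun a => TT U w fun m1 =>
      ind (|(m1 : ℝ) * (a : ℝ) + (y : ℝ) * b - (m3 : ℝ) * d - Z| ≤ K * η)) =
      TT U w fun m3 => TT U w fun m1 => T4 U w (fun y b a d =>
        ind (|(m1 : ℝ) * (a : ℝ) + (y : ℝ) * b - (m3 : ℝ) * d - Z| ≤ K * η)) := by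
    have e1 : ∀ f : ℤ → ℤ → ℤ → ℤ → ℝ, (TT U w fun y => TT U w fun b => TT U w fun a => TT U w fun m1 => f y b a m1) =
      TT U w fun m1 => TT U w fun y => TT U w fun b => TT U w fun a => f y b a m1 := by
      intro f
      exact (T4_y (U := U) (w := w) (fun m1 y b a => f y b a m1)).symm
    simp only [T4]
    have e2 : ∀ d m3 : ℤ, _ := fun d m3 => e1 (fun y b a m1 => ind (|(m1 : ℝ) * (a : ℝ) + (y : ℝ) * b - (m3 : ℝ) * d - Z| ≤ K * η))
    have e3 : ∀ m3 m1 : ℤ, _ := fun m3 m1 => e1 (fun y b a d => ind (|(m1 : ℝ) * (a : ℝ) + (y : ℝ) * b - (m3 : ℝ) * d - Z| ≤ K * η))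
    simp only [e2, e3]
    exact TT_rot _
  rw [e]
  set β := K ^ 5 * η ^ (-κ) with hβ
  have hβ0 : 0 ≤ β := by positivity
  have hbil : ∀ m1 m3 : ℤ, T4 U w (fun y b a d =>
        ind (|(m1 : ℝ) * (a : ℝ) + (y : ℝ) * b - (m3 : ℝ) * d - Z| ≤ K * η)) ≤ β := by
    intro m1 m3
    rw [T4_ad]
    refine TT_le h.w0 h.w1 hβ0 fun a _ => TT_le h.w0 h.w1 hβ0 fun d _ => ?_
    refine le_trans (le_of_eq ?_) (h.bil J hJ hJ2 (m3 * d + Z - m1 * a))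
    congr 1; funext y; congr 1; funext b; congr 2; congr 1; ring
  have hmass : TT U w (fun y => ind (|(y : ℝ)| < η / K ^ q)) ≤ K * (K ^ 20)⁻¹ :=
    (h.small (K ^ q) (by positivity) hq).trans (by gcongr)
  have key : ∀ m3 m1 : ℤ, T4 U w (fun y b a d =>
        ind (|(m1 : ℝ) * (a : ℝ) + (y : ℝ) * b - (m3 : ℝ) * d - Z| ≤ K * η)) ≤
        β * ind (|(m3 : ℝ)| < η / K ^ q) + (β * ind (|(m1 : ℝ)| < η / K ^ q) + η ^ (-κ) * (K ^ 2)⁻¹) := by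
    intro m3 m1
    have p1 := mul_nonneg hβ0 (ind_nonneg (|(m3 : ℝ)| < η / K ^ q))
    have p2 := mul_nonneg hβ0 (ind_nonneg (|(m1 : ℝ)| < η / K ^ q))
    have p3 : 0 ≤ η ^ (-κ) * (K ^ 2)⁻¹ := by positivity
    by_cases c1 : |(m3 : ℝ)| < η / K ^ q
    · refine (hbil m1 m3).trans ?_
      rw [ind_true c1]; linarith
    by_cases c2 : |(m1 : ℝ)| < η / K ^ q
    · refine (hbil m1 m3).trans ?_
      rw [ind_true c2]; linarith
    have := h.quad q s hqs hs hsκ hEX m1 m3 Z (not_lt.1 c2) (not_lt.1 c1)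
    linarith
  refine (TT_mono h.w0 fun m3 _ => TT_mono h.w0 fun m1 _ => key m3 m1).trans ?_
  simp only [TT_add]
  have hc : 0 ≤ β * (K * (K ^ 20)⁻¹) := by positivity
  have hsm : β * TT U w (fun y => ind (|(y : ℝ)| < η / K ^ q)) ≤ β * (K * (K ^ 20)⁻¹) := by gcongr
  have t1 : (TT U w fun m3 : ℤ => TT U w fun _ : ℤ => β * ind (|(m3 : ℝ)| < η / K ^ q)) ≤ β * (K * (K ^ 20)⁻¹) := by
    refine le_trans ?_ hsm
    rw [← TT_smul]
    exact TT_mono h.w0 fun m3 _ => TT_le h.w0 h.w1 (mul_nonneg hβ0 (ind_nonneg _)) fun _ _ => le_rfl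
  have t2 : (TT U w fun _ : ℤ => TT U w fun m1 : ℤ => β * ind (|(m1 : ℝ)| < η / K ^ q)) ≤ β * (K * (K ^ 20)⁻¹) := by
    refine le_trans (TT_le h.w0 h.w1 ?_ fun m3 _ => ?_) hsm
    · exact mul_nonneg hβ0 (TT_nonneg h.w0 fun _ _ => ind_nonneg _)
    · rw [TT_smul]
  have t3 : (TT U w fun _ : ℤ => TT U w fun _ : ℤ => η ^ (-κ) * (K ^ 2)⁻¹) ≤ η ^ (-κ) * (K ^ 2)⁻¹ :=
    TT_le h.w0 h.w1 (by positivity) fun _ _ => TT_le h.w0 h.w1 (by positivity) fun _ _ => le_rfl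
  have e1 : β * (K * (K ^ 20)⁻¹) = η ^ (-κ) * (K ^ 14)⁻¹ := by rw [hβ]; field_simp
  have e2 : η ^ (-κ) * (K ^ 14)⁻¹ ≤ η ^ (-κ) * (K ^ 2)⁻¹ := by
    gcongr <;> norm_num [hK1]
  have e3 : η ^ (-κ) * (K ^ 2)⁻¹ = η ^ (-κ) * K⁻¹ * K⁻¹ := by field_simp
  have i1 : K⁻¹ ≤ 1 / 100 := by rw [inv_le_comm₀ hK0 (by norm_num)]; norm_num; linarith
  have e4 : η ^ (-κ) * K⁻¹ * K⁻¹ ≤ η ^ (-κ) * K⁻¹ * (1 / 100) := by gcongr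
  have e5 : 0 < η ^ (-κ) * K⁻¹ := by positivity
  linarith

end

theorem int_main (κ₀ : ℝ) (h0 : 0 < κ₀) (h1 : κ₀ ≤ 1 / 3) : ∃ C : ℕ, 1 ≤ C ∧
    ∀ (U : Finset ℤ) (w : ℤ → ℝ) (K η κ : ℝ) (J : ℕ), IW U w K η κ → κ₀ ≤ κ → κ ≤ 2 / 3 →
    16 / κ₀ + 2 ≤ K → K ^ C ≤ η ^ κ₀ → (J : ℝ) + 1 ≤ K → K * η ≤ K ^ J → ∀ Z : ℝ,
    (TT U w fun n1 => TT U w fun m1 => TT U w fun n2 => TT U w fun m2 => TT U w fun n3 => TT U w fun m3 =>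
      TT U w fun n4 => TT U w fun m4 =>
      ind (|(n1 : ℝ) * m1 + (n2 : ℝ) * m2 - (n3 : ℝ) * m3 - (n4 : ℝ) * m4 - Z| ≤ K * η)) ≤ η ^ (-κ) * K⁻¹ := by
  obtain ⟨p, hp⟩ := exists_nat_ge (1 / κ₀)
  obtain ⟨M, hM⟩ := exists_nat_ge (65 / κ₀)
  have hp' : 1 ≤ p * κ₀ := by rwa [div_le_iff₀ h0] at hp
  have hM' : 65 ≤ M * κ₀ := by rwa [div_le_iff₀ h0] at hM
  have hp1 : 1 ≤ p := by
    by_contra! hc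
    have : p = 0 := by omega
    subst this; simp at hp'; linarith
  set q := 20 * p with hq
  set s := (q + 20) * p with hs
  have hqs : q ≤ s := by rw [hs]; nlinarith
  refine ⟨(s + 25) * 2300 * (8 * M + 100), by nlinarith, ?_⟩
  intro U w K η κ J h hκ1 hκ2 hKκ hKC hJ hJ2 Z
  have hK := h.hK
  have hη := h.hη
  have hK0 : 0 < K := by linarith
  have hK1 : 1 ≤ K := by linarith
  have hη0 : 0 < η := by linarith
  have hKexp : ∀ r : ℕ, (K ^ (r * p)) ^ (-κ) ≤ (K ^ r)⁻¹ := by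
    intro r
    rw [← Real.rpow_natCast, ← Real.rpow_mul hK0.le, ← Real.rpow_natCast, ← Real.rpow_neg hK0.le]
    apply Real.rpow_le_rpow_of_exponent_le hK1
    push_cast
    have : 1 ≤ p * κ := hp'.trans (by gcongr)
    have hr : (0 : ℝ) ≤ r := by positivity
    nlinarith
  have hEX : ∀ D Ds E m1 m3 Z, ¬ EX D Ds E m1 m3 Z (K ^ (s + 25)) η κ := by
    intro D Ds E m1 m3 Z hE
    obtain ⟨X, y1, hG⟩ := hE.extract h.κ0 h.κ1
    refine hG.final κ₀ h0 h1 hκ1 hκ2 ?_ M hM' ?_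
    · refine hKκ.trans ?_
      rw [← pow_mul]
      exact le_self_pow₀ hK1 (by omega)
    · rw [← pow_mul, ← pow_mul, ← mul_assoc]
      exact hKC
  have hsη : K ^ s ≤ η := by
    calc K ^ s ≤ K ^ ((s + 25) * 2300 * (8 * M + 100)) := pow_le_pow_right₀ hK1 (by nlinarith)
      _ ≤ η ^ κ₀ := hKC
      _ ≤ η ^ (1 : ℝ) := Real.rpow_le_rpow_of_exponent_le hη (by linarith)
      _ = η := Real.rpow_one η
  have hB : 0 ≤ η ^ (-κ) * K⁻¹ := mul_nonneg (Real.rpow_nonneg hη0.le _) (by positivity)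
  refine TT_le h.w0 h.w1 hB fun n1 _ => TT_le h.w0 h.w1 hB fun m1 _ => ?_
  have := h.hex q s hqs hsη (hKexp (q + 20)) (hKexp 20) hEX J hJ hJ2 (n1 * m1 - Z)
  refine le_trans (le_of_eq ?_) this
  congr 1; funext n2; congr 1; funext m2; congr 1; funext n3; congr 1; funext m3; congr 1; funext n4; congr 1; funext m4
  congr 2
  rw [← abs_neg]
  congr 1; ring

end PartNo10

section PartNo11

/-- `T` is integration against a finitely supported sub-probability measure on `[-B, B]`. -/
def RepB (T : (ℝ → ℂ) → ℂ) (B : ℝ) : Prop :=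
  ∃ (Ω : Type) (_ : Fintype Ω) (X w : Ω → ℝ), (∀ i, 0 ≤ w i) ∧ ∑ i, w i ≤ 1 ∧ (∀ i, |X i| ≤ B) ∧
    ∀ f, T f = ∑ i, (w i : ℂ) * f (X i)

/-- Finitely supported sub-probability measures, as functionals. -/
def Law : Type := {T : (ℝ → ℂ) → ℂ // ∃ B, RepB T B}

namespace Law

/-- Integration of a complex function. -/
def I (μ : Law) (f : ℝ → ℂ) : ℂ := μ.1 f
/-- Integration of a real function. -/
noncomputable def IR (μ : Law) (g : ℝ → ℝ) : ℝ := (μ.I (fun x => (g x : ℂ))).re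
/-- Support bound. -/
def Supp (μ : Law) (B : ℝ) : Prop := RepB μ.1 B

lemma ext' {μ ν : Law} (h : ∀ f, μ.I f = ν.I f) : μ = ν := Subtype.ext (funext h)

lemma exSupp (μ : Law) : ∃ B, μ.Supp B := μ.2

lemma rep (μ : Law) {B : ℝ} (h : μ.Supp B) : ∃ (Ω : Type) (_ : Fintype Ω) (X w : Ω → ℝ), (∀ i, 0 ≤ w i) ∧ ∑ i, w i ≤ 1 ∧
    (∀ i, |X i| ≤ B) ∧ (∀ f, μ.I f = ∑ i, (w i : ℂ) * f (X i)) ∧ ∀ g, μ.IR g = ∑ i, w i * g (X i) := by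
  obtain ⟨Ω, _, X, w, h1, h2, h3, h4⟩ := h
  refine ⟨Ω, _, X, w, h1, h2, h3, h4, ?_⟩
  intro g
  unfold IR I
  rw [h4, Complex.re_sum]
  refine Finset.sum_congr rfl fun i _ => ?_
  rw [← Complex.ofReal_mul, Complex.ofReal_re]

lemma rep' (μ : Law) : ∃ (Ω : Type) (_ : Fintype Ω) (X w : Ω → ℝ), (∀ i, 0 ≤ w i) ∧ ∑ i, w i ≤ 1 ∧
    (∀ f, μ.I f = ∑ i, (w i : ℂ) * f (X i)) ∧ ∀ g, μ.IR g = ∑ i, w i * g (X i) := by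
  obtain ⟨B, hB⟩ := μ.2
  obtain ⟨Ω, _, X, w, h1, h2, _, h4⟩ := μ.rep hB
  exact ⟨Ω, _, X, w, h1, h2, h4⟩

lemma I_ofReal (μ : Law) (g : ℝ → ℝ) : μ.I (fun x => (g x : ℂ)) = (μ.IR g : ℂ) := by
  obtain ⟨Ω, _, X, w, h1, h2, h3, h4⟩ := μ.rep'
  rw [h3, h4]; push_cast; rfl

lemma IR_mono (μ : Law) {f g : ℝ → ℝ} (h : ∀ x, f x ≤ g x) : μ.IR f ≤ μ.IR g := by
  obtain ⟨Ω, _, X, w, h1, h2, h3, h4⟩ := μ.rep'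
  rw [h4, h4]
  exact Finset.sum_le_sum fun i _ => mul_le_mul_of_nonneg_left (h _) (h1 i)

lemma IR_nonneg (μ : Law) {f : ℝ → ℝ} (h : ∀ x, 0 ≤ f x) : 0 ≤ μ.IR f := by
  obtain ⟨Ω, _, X, w, h1, h2, h3, h4⟩ := μ.rep'
  rw [h4]
  exact Finset.sum_nonneg fun i _ => mul_nonneg (h1 i) (h _)

lemma IR_le (μ : Law) {f : ℝ → ℝ} {c : ℝ} (hc : 0 ≤ c) (h : ∀ x, f x ≤ c) : μ.IR f ≤ c := by
  obtain ⟨Ω, _, X, w, h1, h2, h3, h4⟩ := μ.rep'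
  rw [h4]
  calc ∑ i, w i * f (X i) ≤ ∑ i, w i * c := Finset.sum_le_sum fun i _ => mul_le_mul_of_nonneg_left (h _) (h1 i)
    _ = (∑ i, w i) * c := by rw [Finset.sum_mul]
    _ ≤ 1 * c := by gcongr
    _ = c := one_mul c

lemma IR_smul (μ : Law) (c : ℝ) (f : ℝ → ℝ) : μ.IR (fun x => c * f x) = c * μ.IR f := by
  obtain ⟨Ω, _, X, w, h1, h2, h3, h4⟩ := μ.rep'
  rw [h4, h4, Finset.mul_sum]
  exact Finset.sum_congr rfl fun i _ => by ring

lemma RepB_mul {T T' : (ℝ → ℂ) → ℂ} {B B' : ℝ} (h : RepB T B) (h' : RepB T' B') :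
    RepB (fun f => T fun x => T' fun y => f (x * y)) (B * B') := by
  obtain ⟨Ω, _, X, w, h1, h2, h3, h4⟩ := h
  obtain ⟨Ω', _, X', w', h1', h2', h3', h4'⟩ := h'
  refine ⟨Ω × Ω', inferInstance, fun p => X p.1 * X' p.2, fun p => w p.1 * w' p.2,
    fun p => mul_nonneg (h1 _) (h1' _), ?_, ?_, ?_⟩
  · rw [Fintype.sum_prod_type]
    simp only [← Finset.mul_sum, ← Finset.sum_mul]
    exact mul_le_one₀ h2 (Finset.sum_nonneg fun i _ => h1' i) h2'
  · intro p
    rw [abs_mul]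
    exact mul_le_mul (h3 _) (h3' _) (abs_nonneg _) ((abs_nonneg _).trans (h3 p.1))
  · intro f
    beta_reduce
    rw [h4, Fintype.sum_prod_type]
    refine Finset.sum_congr rfl fun i _ => ?_
    rw [h4', Finset.mul_sum]
    refine Finset.sum_congr rfl fun j _ => ?_
    push_cast; ring

lemma RepB_op {T T' : (ℝ → ℂ) → ℂ} {B B' : ℝ} (ε : ℝ) (hε : |ε| = 1) (h : RepB T B) (h' : RepB T' B') :
    RepB (fun f => T fun x => T' fun y => f (x + ε * y)) (B + B') := by
  obtain ⟨Ω, _, X, w, h1, h2, h3, h4⟩ := h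
  obtain ⟨Ω', _, X', w', h1', h2', h3', h4'⟩ := h'
  refine ⟨Ω × Ω', inferInstance, fun p => X p.1 + ε * X' p.2, fun p => w p.1 * w' p.2,
    fun p => mul_nonneg (h1 _) (h1' _), ?_, ?_, ?_⟩
  · rw [Fintype.sum_prod_type]
    simp only [← Finset.mul_sum, ← Finset.sum_mul]
    exact mul_le_one₀ h2 (Finset.sum_nonneg fun i _ => h1' i) h2'
  · intro p
    refine (abs_add_le _ _).trans ?_
    rw [abs_mul, hε, one_mul]
    exact add_le_add (h3 _) (h3' _)
  · intro f
    beta_reduce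
    rw [h4, Fintype.sum_prod_type]
    refine Finset.sum_congr rfl fun i _ => ?_
    rw [h4', Finset.mul_sum]
    refine Finset.sum_congr rfl fun j _ => ?_
    push_cast; ring

lemma RepB_mix {k : ℕ} {T : Fin k → (ℝ → ℂ) → ℂ} {B : ℝ} (h : ∀ j, RepB (T j) B) :
    RepB (fun f => ((1 / (k : ℝ) : ℝ) : ℂ) * ∑ j, T j f) B := by
  choose Ω hΩ X w h1 h2 h3 h4 using h
  refine ⟨Σ j, Ω j, inferInstance, fun p => X p.1 p.2, fun p => 1 / (k : ℝ) * w p.1 p.2, ?_, ?_, ?_, ?_⟩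
  · intro p; exact mul_nonneg (by positivity) (h1 _ _)
  · rw [← Finset.mul_sum, Fintype.sum_sigma]
    have : ∑ j : Fin k, ∑ i : Ω j, w j i ≤ ∑ j : Fin k, 1 := Finset.sum_le_sum fun j _ => h2 j
    rw [Finset.sum_const, Finset.card_univ, Fintype.card_fin, nsmul_eq_mul, mul_one] at this
    calc 1 / (k : ℝ) * ∑ j : Fin k, ∑ i : Ω j, w j i ≤ 1 / (k : ℝ) * k := by gcongr
      _ ≤ 1 := by rw [one_div]; exact inv_mul_le_one
  · intro p; exact h3 _ _
  · intro f
    beta_reduce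
    rw [Fintype.sum_sigma, Finset.mul_sum]
    refine Finset.sum_congr rfl fun j _ => ?_
    rw [h4, Finset.mul_sum]
    refine Finset.sum_congr rfl fun i _ => ?_
    push_cast; ring

instance : Mul Law := ⟨fun μ ν => ⟨fun f => μ.1 fun x => ν.1 fun y => f (x * y), by
  obtain ⟨B, hB⟩ := μ.2
  obtain ⟨B', hB'⟩ := ν.2
  exact ⟨_, RepB_mul hB hB'⟩⟩⟩

lemma RepB_pt (a B : ℝ) (h : |a| ≤ B) : RepB (fun f => f a) B :=
  ⟨Unit, inferInstance, fun _ => a, fun _ => 1, fun _ => zero_le_one, by simp, fun _ => h, fun f => by simp⟩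

instance : One Law := ⟨⟨fun f => f 1, 1, RepB_pt 1 1 (by simp)⟩⟩

lemma I_mul (μ ν : Law) (f : ℝ → ℂ) : (μ * ν).I f = μ.I fun x => ν.I fun y => f (x * y) := rfl
lemma I_one (f : ℝ → ℂ) : (1 : Law).I f = f 1 := rfl

lemma IR_mul (μ ν : Law) (f : ℝ → ℝ) : (μ * ν).IR f = μ.IR fun x => ν.IR fun y => f (x * y) := by
  unfold IR
  rw [I_mul]
  congr 1
  congr 1
  funext x
  exact I_ofReal ν (fun y => f (x * y))

lemma I_comm (μ ν : Law) (f : ℝ → ℝ → ℂ) : (μ.I fun x => ν.I fun y => f x y) = ν.I fun y => μ.I fun x => f x y := by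
  obtain ⟨Ω, _, X, w, h1, h2, h3, h4⟩ := μ.rep'
  obtain ⟨Ω', _, X', w', h1', h2', h3', h4'⟩ := ν.rep'
  simp only [h3, h3', Finset.mul_sum]
  rw [Finset.sum_comm]
  refine Finset.sum_congr rfl fun i _ => Finset.sum_congr rfl fun j _ => by ring

instance : CommMonoid Law where
  mul_assoc a b c := ext' fun f => by simp only [I_mul, mul_assoc]
  one_mul a := ext' fun f => by simp only [I_mul, I_one, one_mul]
  mul_one a := ext' fun f => by simp only [I_mul, I_one, mul_one]
  mul_comm a b := ext' fun f => by
    rw [I_mul, I_mul, I_comm]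
    simp only [mul_comm]

/-- Law of `x₁ + x₂ - x₃ - x₄`. -/
def S (μ : Law) : Law := ⟨fun f => μ.1 fun x => μ.1 fun y => μ.1 fun z => μ.1 fun t => f (x + y - z - t), by
  obtain ⟨B, hB⟩ := μ.2
  have h2 := RepB_op 1 (by simp) hB hB
  have h3 := RepB_op (-1) (by simp) (RepB_op (-1) (by simp) h2 hB) hB
  refine ⟨B + B + B + B, ?_⟩
  convert h3 using 1
  funext f
  simp only [one_mul, neg_one_mul, ← sub_eq_add_neg]⟩

lemma I_S (μ : Law) (f : ℝ → ℂ) : μ.S.I f = μ.I fun x => μ.I fun y => μ.I fun z => μ.I fun t => f (x + y - z - t) := rfl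

lemma IR_S (μ : Law) (f : ℝ → ℝ) :
    μ.S.IR f = μ.IR fun x => μ.IR fun y => μ.IR fun z => μ.IR fun t => f (x + y - z - t) := by
  have : ((μ.S.IR f : ℝ) : ℂ) = ((μ.IR fun x => μ.IR fun y => μ.IR fun z => μ.IR fun t => f (x + y - z - t) : ℝ) : ℂ) := by
    rw [← I_ofReal, I_S]
    simp only [I_ofReal]
  exact_mod_cast this

lemma Supp.S {μ : Law} {B : ℝ} (hB : μ.Supp B) : μ.S.Supp (4 * B) := by
  have h2 := RepB_op 1 (by simp) hB hB
  have h3 := RepB_op (-1) (by simp) (RepB_op (-1) (by simp) h2 hB) hB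
  unfold Supp
  convert h3 using 1
  · funext f
    simp only [one_mul, neg_one_mul, ← sub_eq_add_neg]
    rfl
  · ring

lemma Supp.mul {μ ν : Law} {B B' : ℝ} (hB : μ.Supp B) (hB' : ν.Supp B') : (μ * ν).Supp (B * B') := RepB_mul hB hB'

lemma Supp.mono {μ : Law} {B B' : ℝ} (hB : μ.Supp B) (h : B ≤ B') : μ.Supp B' := by
  obtain ⟨Ω, _, X, w, h1, h2, h3, h4⟩ := hB
  exact ⟨Ω, _, X, w, h1, h2, fun i => (h3 i).trans h, h4⟩

/-- Uniform mixture. -/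
noncomputable def mix {k : ℕ} (μ : Fin k → Law) : Law := ⟨fun f => ((1 / (k : ℝ) : ℝ) : ℂ) * ∑ j, (μ j).1 f, by
  choose B hB using fun j => (μ j).2
  refine ⟨∑ j, |B j|, RepB_mix fun j => Supp.mono (hB j) ?_⟩
  exact (le_abs_self _).trans (Finset.single_le_sum (f := fun j => |B j|) (fun i _ => abs_nonneg _) (Finset.mem_univ j))⟩

lemma I_mix {k : ℕ} (μ : Fin k → Law) (f : ℝ → ℂ) : (mix μ).I f = ((1 / (k : ℝ) : ℝ) : ℂ) * ∑ j, (μ j).I f := rfl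

lemma IR_mix {k : ℕ} (μ : Fin k → Law) (f : ℝ → ℝ) : (mix μ).IR f = 1 / (k : ℝ) * ∑ j, (μ j).IR f := by
  unfold IR
  rw [I_mix, Complex.re_ofReal_mul, Complex.re_sum]

lemma Supp.mix {k : ℕ} {μ : Fin k → Law} {B : ℝ} (h : ∀ j, (μ j).Supp B) : (mix μ).Supp B := RepB_mix h

/-- Fourier transform. -/
noncomputable def F (c : ℝ) (μ : Law) : ℂ := μ.I fun x => Complex.exp (Complex.I * ((c * x : ℝ) : ℂ))

lemma F_mul (c : ℝ) (μ ν : Law) : F c (μ * ν) = μ.I fun x => F (c * x) ν := by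
  unfold F
  rw [I_mul]
  simp only [mul_assoc]

lemma norm_F_le (c : ℝ) (μ : Law) : ‖F c μ‖ ≤ 1 := by
  obtain ⟨Ω, _, X, w, h1, h2, h3, h4⟩ := μ.rep'
  unfold F
  rw [h3]
  refine (norm_sum_le _ _).trans (le_trans (Finset.sum_le_sum fun i _ => ?_) h2)
  rw [norm_mul, mul_comm Complex.I, Complex.norm_exp_ofReal_mul_I, mul_one, Complex.norm_real, Real.norm_of_nonneg (h1 i)]

lemma I_smulc (μ : Law) (c : ℂ) (f : ℝ → ℂ) : μ.I (fun x => c * f x) = c * μ.I f := by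
  obtain ⟨Ω, _, X, w, h1, h2, h3, h4⟩ := μ.rep'
  rw [h3, h3, Finset.mul_sum]
  exact Finset.sum_congr rfl fun i _ => by ring

lemma I_mulc (μ : Law) (c : ℂ) (f : ℝ → ℂ) : μ.I (fun x => f x * c) = μ.I f * c := by
  simp only [mul_comm _ c]
  exact I_smulc μ c f

lemma F_S (c : ℝ) (μ : Law) : F c μ.S = ((‖F c μ‖ ^ 4 : ℝ) : ℂ) := by
  have e : F c μ.S = F c μ * F c μ * (starRingEnd ℂ (F c μ)) * (starRingEnd ℂ (F c μ)) := by
    obtain ⟨Ω, _, X, w, h1, h2, h3, h4⟩ := μ.rep'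
    have hconj : starRingEnd ℂ (F c μ) = μ.I fun x => Complex.exp (-(Complex.I * ((c * x : ℝ) : ℂ))) := by
      unfold F
      rw [h3, h3, map_sum]
      refine Finset.sum_congr rfl fun i _ => ?_
      rw [map_mul, Complex.conj_ofReal, ← Complex.exp_conj, map_mul, Complex.conj_I, Complex.conj_ofReal, neg_mul]
    rw [hconj]
    unfold F
    rw [I_S]
    have e : ∀ x y z t : ℝ, Complex.exp (Complex.I * ((c * (x + y - z - t) : ℝ) : ℂ)) =
        Complex.exp (Complex.I * ((c * x : ℝ) : ℂ)) * (Complex.exp (Complex.I * ((c * y : ℝ) : ℂ)) *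
        (Complex.exp (-(Complex.I * ((c * z : ℝ) : ℂ))) * Complex.exp (-(Complex.I * ((c * t : ℝ) : ℂ))))) := by
      intro x y z t
      rw [← Complex.exp_add, ← Complex.exp_add, ← Complex.exp_add]
      congr 1
      push_cast
      ring
    simp only [e, I_smulc, I_mulc]
    ring
  rw [e]
  have h2 : F c μ * F c μ * (starRingEnd ℂ (F c μ)) * (starRingEnd ℂ (F c μ)) = (F c μ * starRingEnd ℂ (F c μ)) ^ 2 := by ring
  rw [h2, Complex.mul_conj, Complex.normSq_eq_norm_sq]
  push_cast; ring

lemma sq_avg {Ω : Type} [Fintype Ω] (w a : Ω → ℝ) (h1 : ∀ i, 0 ≤ w i) (h2 : ∑ i, w i ≤ 1) :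
    (∑ i, w i * a i) ^ 2 ≤ ∑ i, w i * a i ^ 2 := by
  have := Finset.sum_sq_le_sum_mul_sum_of_sq_le_mul Finset.univ (r := fun i => w i * a i) (f := w) (g := fun i => w i * a i ^ 2)
    (fun i _ => h1 i) (fun i _ => mul_nonneg (h1 i) (sq_nonneg _)) (fun i _ => le_of_eq (by ring))
  refine this.trans ?_
  have h0 : 0 ≤ ∑ i, w i * a i ^ 2 := Finset.sum_nonneg fun i _ => mul_nonneg (h1 i) (sq_nonneg _)
  nlinarith

lemma F_mul_S (c : ℝ) (R μ : Law) : F c (R * μ.S) = ((R.IR fun x => ‖F (c * x) μ‖ ^ 4 : ℝ) : ℂ) := by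
  rw [F_mul]
  simp only [F_S]
  exact I_ofReal R _

lemma F_mul_S_norm (c : ℝ) (R μ : Law) : ‖F c (R * μ.S)‖ = R.IR fun x => ‖F (c * x) μ‖ ^ 4 := by
  rw [F_mul_S, Complex.norm_real, Real.norm_of_nonneg (IR_nonneg _ fun x => by positivity)]

lemma holder (c : ℝ) (R μ : Law) : ‖F c (R * μ)‖ ^ 4 ≤ ‖F c (R * μ.S)‖ := by
  rw [F_mul_S_norm, F_mul]
  obtain ⟨Ω, _, X, w, h1, h2, h3, h4⟩ := R.rep'
  rw [h3, h4]
  have e1 : ‖∑ i, (w i : ℂ) * F (c * X i) μ‖ ≤ ∑ i, w i * ‖F (c * X i) μ‖ := by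
    refine (norm_sum_le _ _).trans (le_of_eq (Finset.sum_congr rfl fun i _ => ?_))
    rw [norm_mul, Complex.norm_real, Real.norm_of_nonneg (h1 i)]
  calc ‖∑ i, (w i : ℂ) * F (c * X i) μ‖ ^ 4 ≤ (∑ i, w i * ‖F (c * X i) μ‖) ^ 4 := by gcongr
    _ = ((∑ i, w i * ‖F (c * X i) μ‖) ^ 2) ^ 2 := by ring
    _ ≤ (∑ i, w i * ‖F (c * X i) μ‖ ^ 2) ^ 2 := by
      gcongr
      exact sq_avg w _ h1 h2
    _ ≤ ∑ i, w i * (‖F (c * X i) μ‖ ^ 2) ^ 2 := sq_avg w _ h1 h2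
    _ = _ := by simp only [← pow_mul]

lemma mix_bound {k : ℕ} (c : ℝ) (R : Law) (μ : Fin k → Law) (j : Fin k) :
    ‖F c (R * (μ j).S)‖ ≤ k * ‖F c (R * mix fun i => (μ i).S)‖ := by
  have hk : (0 : ℝ) < k := by exact_mod_cast j.pos
  have e : F c (R * mix fun i => (μ i).S) = ((1 / (k : ℝ) : ℝ) : ℂ) * ∑ i, F c (R * (μ i).S) := by
    have : ∀ ν : Law, F c (R * ν) = ν.I fun y => F (c * y) R := by
      intro ν; rw [mul_comm, F_mul]
    simp only [this]
    rw [I_mix]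
  have e2 : ∑ i, F c (R * (μ i).S) = ((∑ i, ‖F c (R * (μ i).S)‖ : ℝ) : ℂ) := by
    push_cast
    refine Finset.sum_congr rfl fun i _ => ?_
    rw [F_mul_S_norm, F_mul_S]
  rw [e, e2, ← Complex.ofReal_mul, Complex.norm_real, Real.norm_of_nonneg (mul_nonneg (by positivity) (Finset.sum_nonneg fun _ _ => norm_nonneg _)),
    ← mul_assoc, mul_one_div_cancel hk.ne', one_mul]
  exact Finset.single_le_sum (f := fun i => ‖F c (R * (μ i).S)‖) (fun i _ => norm_nonneg _) (Finset.mem_univ j)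

end Law

end PartNo11

section PartNo12

/-- Frostman condition at scales between `1/η` and `1`. -/
structure Fr (ν : Law) (K κ η : ℝ) : Prop where
  supp : ν.Supp K
  loc : ∀ z r : ℝ, 1 / η ≤ r → r ≤ 1 → ν.IR (fun x => ind (|x - z| ≤ r)) ≤ K * r ^ κ

lemma prod_round {K η x y : ℝ} (hη : 1 ≤ η) (hK : 100 ≤ K) (hx : |x| ≤ K) (hy : |y| ≤ K) :
    |(η * x) * (η * y) - (⌊η * x⌋ : ℝ) * ⌊η * y⌋| ≤ 3 * K * η := by
  have a1 := Int.floor_le (η * x)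
  have a2 := Int.lt_floor_add_one (η * x)
  have b1 := Int.floor_le (η * y)
  have b2 := Int.lt_floor_add_one (η * y)
  set n : ℝ := (⌊η * x⌋ : ℝ)
  set m : ℝ := (⌊η * y⌋ : ℝ)
  have hx' : |η * x| ≤ K * η := by rw [abs_mul, abs_of_pos (by linarith : 0 < η)]; nlinarith
  have hy' : |η * y| ≤ K * η := by rw [abs_mul, abs_of_pos (by linarith : 0 < η)]; nlinarith
  have e : (η * x) * (η * y) - n * m = (η * x - n) * (η * y) + n * (η * y - m) := by ring
  have d1 : |η * x - n| ≤ 1 := by rw [abs_le]; constructor <;> linarith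
  have d2 : |η * y - m| ≤ 1 := by rw [abs_le]; constructor <;> linarith
  have hn : |n| ≤ K * η + 1 := by
    have : n = η * x - (η * x - n) := by ring
    rw [this]
    exact (abs_sub _ _).trans (add_le_add hx' d1)
  rw [e]
  refine (abs_add_le _ _).trans ?_
  rw [abs_mul (η * x - n), abs_mul n]
  have h1 : |η * x - n| * |η * y| ≤ 1 * (K * η) := mul_le_mul d1 hy' (abs_nonneg _) zero_le_one
  have h2 : |n| * |η * y - m| ≤ (K * η + 1) * 1 := mul_le_mul hn d2 (abs_nonneg _) (by nlinarith)
  have h3 : 1 ≤ K * η := by nlinarith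
  linarith

theorem FL1 (κ₀ : ℝ) (h0 : 0 < κ₀) (h1 : κ₀ ≤ 1 / 3) : ∃ C : ℕ, 1 ≤ C ∧
    ∀ (ν : Law) (K η κ : ℝ) (J : ℕ), 100 ≤ K → 1 ≤ η → Fr ν K κ η → κ₀ ≤ κ → κ ≤ 2 / 3 →
    16 / κ₀ + 2 ≤ K ^ 2 → (K ^ 2) ^ C ≤ η ^ κ₀ → (J : ℝ) + 1 ≤ K ^ 2 → K ^ 2 * η ≤ (K ^ 2) ^ J → ∀ z : ℝ,
    (ν * ν).S.IR (fun x => ind (|x - z| ≤ 1 / η)) ≤ η ^ (-κ) * (K ^ 2)⁻¹ := by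
  obtain ⟨C, hC, H⟩ := int_main κ₀ h0 h1
  refine ⟨C, hC, ?_⟩
  intro ν K η κ J hK hη hF hκ1 hκ2 hKκ hKC hJ hJ2 z
  classical
  have hη0 : 0 < η := by linarith
  have hK2 : 100 * K ≤ K ^ 2 := by nlinarith
  obtain ⟨Ω, _, X, w, w0, w1, hX, -, hIR⟩ := ν.rep hF.supp
  set n : Ω → ℤ := fun i => ⌊η * X i⌋ with hn
  set U : Finset ℤ := Finset.univ.image n with hU
  set w' : ℤ → ℝ := fun m => ∑ i with n i = m, w i with hw'
  have hT : ∀ g, ν.IR g = TT Finset.univ w (fun i => g (X i)) := hIR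
  have hT' : ∀ g : ℤ → ℝ, TT U w' g = TT Finset.univ w (fun i => g (n i)) := by
    intro g
    unfold TT
    rw [← Finset.sum_fiberwise_of_maps_to (s := Finset.univ) (t := U) (g := n) (fun i _ => Finset.mem_image_of_mem _ (Finset.mem_univ _))]
    refine Finset.sum_congr rfl fun m _ => ?_
    rw [hw', Finset.sum_mul]
    refine Finset.sum_congr rfl fun i hi => ?_
    beta_reduce
    rw [(Finset.mem_filter.1 hi).2]
  have hw0 : ∀ i ∈ (Finset.univ : Finset Ω), 0 ≤ w i := fun i _ => w0 i
  have hIW : IW U w' (K ^ 2) η κ := by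
    refine ⟨by nlinarith, hη, by linarith, by linarith, ?_, ?_, ?_, ?_⟩
    · intro m _
      exact Finset.sum_nonneg fun i _ => w0 i
    · have := hT' (fun _ => 1)
      simp only [TT, mul_one] at this
      rw [this]; exact w1
    · intro m hm
      obtain ⟨i, -, rfl⟩ := Finset.mem_image.1 hm
      have a1 := Int.floor_le (η * X i)
      have a2 := Int.lt_floor_add_one (η * X i)
      have hb := abs_le.1 (hX i)
      have : η * X i ≤ K * η := by nlinarith
      have : - (K * η) ≤ η * X i := by nlinarith
      have : K * η * 100 ≤ K ^ 2 * η := by nlinarith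
      have : 1 ≤ K * η := by nlinarith
      rw [abs_le]
      constructor <;> simp only [hn] <;> linarith
    · intro a l hl
      rw [hT']
      have hle1 : 0 < l / η := by positivity
      have hp : 0 < (l / η) ^ κ := Real.rpow_pos_of_pos hle1 _
      by_cases hc : 2 * l / η ≤ 1
      · have s1 : TT Finset.univ w (fun i => ind (|(n i : ℝ) - a| ≤ l)) ≤
            TT Finset.univ w (fun i => ind (|X i - a / η| ≤ 2 * l / η)) := by
          refine TT_mono hw0 fun i _ => ind_mono fun hi => ?_
          have a1 := Int.floor_le (η * X i)
          have a2 := Int.lt_floor_add_one (η * X i)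
          have hb := abs_le.1 hi
          simp only [hn] at hb
          rw [le_div_iff₀ hη0, ← abs_of_pos hη0, ← abs_mul, abs_of_pos hη0, sub_mul, div_mul_cancel₀ _ hη0.ne', abs_le]
          constructor <;> linarith
        refine s1.trans ?_
        have s2 := hF.loc (a / η) (2 * l / η) (by gcongr; linarith) hc
        rw [hT] at s2
        refine s2.trans ?_
        rw [mul_div_assoc, Real.mul_rpow (by norm_num) hle1.le]
        have : (2 : ℝ) ^ κ ≤ 2 := by
          calc (2 : ℝ) ^ κ ≤ 2 ^ (1 : ℝ) := Real.rpow_le_rpow_of_exponent_le (by norm_num) (by linarith)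
            _ = 2 := Real.rpow_one 2
        calc K * (2 ^ κ * (l / η) ^ κ) ≤ K * (2 * (l / η) ^ κ) := by gcongr
          _ = (2 * K) * (l / η) ^ κ := by ring
          _ ≤ _ := by gcongr; linarith
      · push Not at hc
        refine (TT_le hw0 w1 zero_le_one fun i _ => ind_le_one _).trans ?_
        have h2 : 1 / 2 ≤ l / η := by rw [mul_div_assoc] at hc; linarith
        have h3 : (1 / 2 : ℝ) ≤ (l / η) ^ κ := by
          calc (1 / 2 : ℝ) = (1 / 2) ^ (1 : ℝ) := (Real.rpow_one _).symm
            _ ≤ (1 / 2) ^ κ := Real.rpow_le_rpow_of_exponent_ge (by norm_num) (by norm_num) (by linarith)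
            _ ≤ _ := Real.rpow_le_rpow (by norm_num) h2 (by linarith)
        nlinarith
  refine le_trans ?_ (H U w' (K ^ 2) η κ J hIW hκ1 hκ2 hKκ hKC hJ hJ2 (η ^ 2 * z))
  simp only [Law.IR_S, Law.IR_mul, hT, hT']
  refine TT_mono hw0 fun i1 _ => TT_mono hw0 fun j1 _ => TT_mono hw0 fun i2 _ => TT_mono hw0 fun j2 _ =>
    TT_mono hw0 fun i3 _ => TT_mono hw0 fun j3 _ => TT_mono hw0 fun i4 _ => TT_mono hw0 fun j4 _ => ind_mono fun hi => ?_
  have r1 := abs_le.1 (prod_round hη hK (hX i1) (hX j1))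
  have r2 := abs_le.1 (prod_round hη hK (hX i2) (hX j2))
  have r3 := abs_le.1 (prod_round hη hK (hX i3) (hX j3))
  have r4 := abs_le.1 (prod_round hη hK (hX i4) (hX j4))
  have hi' : |η ^ 2 * (X i1 * X j1 + X i2 * X j2 - X i3 * X j3 - X i4 * X j4 - z)| ≤ η := by
    rw [abs_mul, abs_of_pos (by positivity : 0 < η ^ 2)]
    calc _ ≤ η ^ 2 * (1 / η) := by gcongr
      _ = η := by field_simp
  have hi2 := abs_le.1 hi'
  have h3 : 13 * K * η ≤ K ^ 2 * η := by gcongr; nlinarith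
  have h4 : η ≤ K * η := by nlinarith
  simp only [hn]
  rw [abs_le]
  constructor <;> nlinarith

end PartNo12

section PartNo13

lemma exists_big (A c : ℝ) (hc : 0 < c) : ∃ H : ℝ, 1 ≤ H ∧ ∀ η, H ≤ η → A ≤ η ^ c := by
  obtain ⟨H, hH⟩ := Filter.eventually_atTop.1 ((tendsto_rpow_atTop hc).eventually_ge_atTop A)
  exact ⟨max H 1, le_max_right _ _, fun η hη => hH η ((le_max_left _ _).trans hη)⟩

theorem FL1' (κ₀ : ℝ) (h0 : 0 < κ₀) (h1 : κ₀ ≤ 1 / 3) : ∃ c H : ℝ, 0 < c ∧ c ≤ 1 / 6 ∧ 1 ≤ H ∧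
    ∀ (ν : Law) (η κ : ℝ), H ≤ η → Fr ν (η ^ c) κ η → κ₀ ≤ κ → κ ≤ 2 / 3 → ∀ z : ℝ,
    (ν * ν).S.IR (fun x => ind (|x - z| ≤ 1 / η)) ≤ η ^ (-(κ + 2 * c)) := by
  obtain ⟨C, hC, hFL⟩ := FL1 κ₀ h0 h1
  have hC' : (1 : ℝ) ≤ C := by exact_mod_cast hC
  set c := κ₀ / (2 * C) with hc
  have hc0 : 0 < c := by positivity
  have hcC : 2 * c * C = κ₀ := by rw [hc]; field_simp
  have hc1 : c ≤ 1 / 6 := by nlinarith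
  obtain ⟨J, hJ⟩ := exists_nat_ge (1 / (2 * c) + 1)
  obtain ⟨H, hH, hbig⟩ := exists_big (max 100 (max (16 / κ₀ + 2) (J + 1))) c hc0
  refine ⟨c, H, hc0, hc1, hH, ?_⟩
  intro ν η κ hη hF hκ1 hκ2 z
  have hη1 : 1 ≤ η := hH.trans hη
  have hη0 : 0 < η := by linarith
  have hb := hbig η hη
  rw [max_le_iff, max_le_iff] at hb
  obtain ⟨b1, b2, b3⟩ := hb
  have hK2 : η ^ c ≤ (η ^ c) ^ 2 := by nlinarith
  have e2 : (η ^ c) ^ 2 = η ^ (2 * c) := by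
    rw [← Real.rpow_natCast, ← Real.rpow_mul hη0.le]; congr 1; push_cast; ring
  have := hFL ν (η ^ c) η κ J b1 hη1 hF hκ1 hκ2 (b2.trans hK2) ?_ (b3.trans hK2) ?_ z
  · refine this.trans (le_of_eq ?_)
    rw [e2, ← Real.rpow_neg hη0.le, ← Real.rpow_add hη0]
    congr 1; ring
  · rw [e2, ← Real.rpow_natCast, ← Real.rpow_mul hη0.le, hcC]
  · rw [e2, ← Real.rpow_natCast, ← Real.rpow_mul hη0.le]
    nth_rw 2 [← Real.rpow_one η]
    rw [← Real.rpow_add hη0]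
    apply Real.rpow_le_rpow_of_exponent_le hη1
    have : 2 * c * (1 / (2 * c) + 1) ≤ 2 * c * J := by gcongr
    have e : 2 * c * (1 / (2 * c) + 1) = 2 * c + 1 := by field_simp; ring
    linarith

lemma Fr.mono {ν : Law} {K K' κ κ' η η' : ℝ} (h : Fr ν K κ η) (hK0 : 0 ≤ K) (hK : K ≤ K') (hκ : κ' ≤ κ) (hη0 : 0 < η') (hη : η' ≤ η) :
    Fr ν K' κ' η' := by
  refine ⟨h.supp.mono hK, ?_⟩
  intro z r h1 h2
  have hr : 0 < r := lt_of_lt_of_le (by positivity) h1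
  refine (h.loc z r ((one_div_le_one_div_of_le hη0 hη).trans h1) h2).trans ?_
  have := Real.rpow_le_rpow_of_exponent_ge hr h2 hκ
  have : 0 ≤ r ^ κ := (Real.rpow_pos_of_pos hr _).le
  gcongr
  linarith

theorem FL2 (κ₀ : ℝ) (h0 : 0 < κ₀) (h1 : κ₀ ≤ 1 / 3) : ∃ c : ℝ, 0 < c ∧ ∀ ε' : ℝ, 0 < ε' → ∃ ε H : ℝ, 0 < ε ∧ 1 ≤ H ∧
    ∀ (ν : Law) (η κ : ℝ), H ≤ η → Fr ν (η ^ ε) κ η → κ₀ ≤ κ → κ ≤ 2 / 3 → Fr (ν * ν).S (η ^ ε') (κ + c) η := by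
  obtain ⟨c, H0, hc0, hc1, hH0, hFL⟩ := FL1' κ₀ h0 h1
  refine ⟨2 * c, by linarith, ?_⟩
  intro ε' hε'
  set ε := c * ε' / 2 with hε
  have hε0 : 0 < ε := by positivity
  obtain ⟨H1, hH1, hb1⟩ := exists_big H0 (ε' / 2) (by positivity)
  obtain ⟨H2, hH2, hb2⟩ := exists_big 4 (ε' / 2) (by positivity)
  refine ⟨ε, max H1 H2, hε0, hH1.trans (le_max_left _ _), ?_⟩
  intro ν η κ hη hF hκ1 hκ2
  have hη1 : 1 ≤ η := (hH1.trans (le_max_left _ _)).trans hη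
  have hη0 : 0 < η := by linarith
  constructor
  · refine (hF.supp.mul hF.supp).S.mono ?_
    have := hb2 η ((le_max_right _ _).trans hη)
    rw [← Real.rpow_add hη0]
    calc 4 * η ^ (ε + ε) ≤ η ^ (ε' / 2) * η ^ (ε' / 2) := by
          gcongr
          rw [hε]; nlinarith
      _ = η ^ ε' := by rw [← Real.rpow_add hη0]; congr 1; ring
  · intro z r hr1 hr2
    have hr0 : 0 < r := lt_of_lt_of_le (by positivity) hr1
    by_cases hc : η ^ (ε' / 2) ≤ 1 / r
    · have hHr : H0 ≤ 1 / r := (hb1 η ((le_max_left _ _).trans hη)).trans hc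
      have hle : 1 / r ≤ η := by rw [one_div_le hr0 hη0]; exact hr1
      have hFr : Fr ν ((1 / r) ^ c) κ (1 / r) := by
        refine hF.mono (Real.rpow_nonneg hη0.le _) ?_ le_rfl (by positivity) hle
        calc η ^ ε = (η ^ (ε' / 2)) ^ c := by
              rw [← Real.rpow_mul hη0.le]; congr 1; rw [hε]; ring
          _ ≤ _ := Real.rpow_le_rpow (Real.rpow_nonneg hη0.le _) hc hc0.le
      have := hFL ν (1 / r) κ hHr hFr hκ1 hκ2 z
      rw [one_div_one_div] at this
      refine this.trans ?_
      rw [one_div, Real.inv_rpow hr0.le, ← Real.rpow_neg hr0.le, neg_neg]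
      have h3 : 1 ≤ η ^ ε' := Real.one_le_rpow hη1 hε'.le
      have h4 : 0 ≤ r ^ (κ + 2 * c) := Real.rpow_nonneg hr0.le _
      nlinarith
    · push Not at hc
      refine (Law.IR_le _ zero_le_one fun x => ind_le_one _).trans ?_
      have h2 : η ^ (-(ε' / 2)) ≤ r := by
        rw [Real.rpow_neg hη0.le, inv_le_comm₀ (Real.rpow_pos_of_pos hη0 _) hr0, ← one_div]; exact hc.le
      calc (1 : ℝ) = η ^ ε' * (η ^ (-(ε' / 2))) ^ (2 : ℝ) := by
            rw [← Real.rpow_mul hη0.le, ← Real.rpow_add hη0]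
            have : ε' + -(ε' / 2) * 2 = 0 := by ring
            rw [this, Real.rpow_zero]
        _ ≤ η ^ ε' * r ^ (2 : ℝ) := by
            have := Real.rpow_nonneg hη0.le ε'
            gcongr
        _ ≤ η ^ ε' * r ^ (κ + 2 * c) := by
            have := Real.rpow_nonneg hη0.le ε'
            refine mul_le_mul_of_nonneg_left ?_ this
            exact Real.rpow_le_rpow_of_exponent_ge hr0 hr2 (by linarith)

/-- Iterated sequence of laws. -/
def iterL (ν : Law) : ℕ → Law
  | 0 => ν
  | n + 1 => (iterL ν n * iterL ν n).S

theorem FL3 (κ₀ : ℝ) (h0 : 0 < κ₀) (h1 : κ₀ ≤ 1 / 3) : ∃ n : ℕ, ∀ ε' : ℝ, 0 < ε' → ∃ ε H : ℝ, 0 < ε ∧ 1 ≤ H ∧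
    ∀ (ν : Law) (η : ℝ), H ≤ η → Fr ν (η ^ ε) κ₀ η → Fr (iterL ν n) (η ^ ε') (3 / 5) η := by
  obtain ⟨c, hc, hFL⟩ := FL2 κ₀ h0 h1
  have key : ∀ n : ℕ, ∀ ε' : ℝ, 0 < ε' → ∃ ε H : ℝ, 0 < ε ∧ 1 ≤ H ∧
      ∀ (ν : Law) (η : ℝ), H ≤ η → Fr ν (η ^ ε) κ₀ η → Fr (iterL ν n) (η ^ ε') (min (κ₀ + n * c) (3 / 5)) η := by
    intro n
    induction n with
    | zero =>
      intro ε' hε'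
      refine ⟨ε', 1, hε', le_rfl, ?_⟩
      intro ν η hη hF
      refine hF.mono (Real.rpow_nonneg (by linarith) _) le_rfl ?_ (by linarith) le_rfl
      simp
    | succ n ih =>
      intro ε' hε'
      obtain ⟨ε1, H1, he1, hH1, h1'⟩ := hFL ε' hε'
      obtain ⟨ε2, H2, he2, hH2, h2'⟩ := ih ε1 he1
      refine ⟨ε2, max H1 H2, he2, hH1.trans (le_max_left _ _), ?_⟩
      intro ν η hη hF
      have hη1 : 1 ≤ η := (hH1.trans (le_max_left _ _)).trans hη
      have h3 := h2' ν η ((le_max_right _ _).trans hη) hF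
      have h4 := h1' _ η _ ((le_max_left _ _).trans hη) h3 (le_min (by nlinarith [(by positivity : (0:ℝ) ≤ n)]) (by linarith))
        ((min_le_right _ _).trans (by norm_num))
      refine h4.mono (Real.rpow_nonneg (by linarith) _) le_rfl ?_ (by linarith) le_rfl
      push_cast
      rcases min_cases (κ₀ + n * c) (3 / 5) with ⟨h, _⟩ | ⟨h, _⟩
      · rw [h]
        refine (min_le_left _ _).trans ?_
        linarith
      · rw [h]
        refine (min_le_right _ _).trans ?_
        linarith
  obtain ⟨n, hn⟩ := exists_nat_ge (1 / c)
  refine ⟨n, fun ε' hε' => ?_⟩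
  obtain ⟨ε, H, a, b, d⟩ := key n ε' hε'
  refine ⟨ε, H, a, b, fun ν η hη hF => ?_⟩
  have := d ν η hη hF
  rwa [min_eq_right] at this
  rw [div_le_iff₀ hc] at hn
  linarith

end PartNo13

section PartNo14

lemma dirichlet_bound (N : ℕ) (θ : ℝ) (h : |θ| ≤ Real.pi) (h0 : θ ≠ 0) :
    ‖∑ m ∈ Finset.range N, Complex.exp (Complex.I * ((m * θ : ℝ) : ℂ))‖ ≤ Real.pi / |θ| := by
  set z := Complex.exp (Complex.I * ((θ : ℝ) : ℂ)) with hz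
  have hp : ∀ m : ℕ, Complex.exp (Complex.I * ((m * θ : ℝ) : ℂ)) = z ^ m := by
    intro m
    rw [hz, ← Complex.exp_nat_mul]; congr 1; push_cast; ring
  simp only [hp]
  have hz1 : ‖z‖ = 1 := by rw [hz, mul_comm]; exact Complex.norm_exp_ofReal_mul_I θ
  have hlow : 2 / Real.pi * |θ| ≤ ‖z - 1‖ := by
    rw [hz, Complex.norm_exp_I_mul_ofReal_sub_one, Real.norm_eq_abs, abs_mul, abs_of_pos (by norm_num : (0:ℝ) < 2)]
    have := Real.mul_abs_le_abs_sin (x := θ / 2) (by rw [abs_div, abs_of_pos (by norm_num : (0:ℝ) < 2)]; linarith)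
    rw [abs_div, abs_of_pos (by norm_num : (0:ℝ) < 2)] at this
    linarith
  have hθ : 0 < |θ| := abs_pos.2 h0
  have hpi := Real.pi_pos
  have hpos : 0 < ‖z - 1‖ := lt_of_lt_of_le (by positivity) hlow
  have hne : z ≠ 1 := by
    intro h'; rw [h'] at hpos; simp at hpos
  rw [geom_sum_eq hne, norm_div, div_le_div_iff₀ hpos hθ]
  have h2 : ‖z ^ N - 1‖ ≤ 2 := by
    refine (norm_sub_le _ _).trans ?_
    rw [norm_pow, hz1]; norm_num
  calc ‖z ^ N - 1‖ * |θ| ≤ 2 * |θ| := by gcongr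
    _ = Real.pi * (2 / Real.pi * |θ|) := by field_simp
    _ ≤ _ := by gcongr

lemma exp_lip (a b : ℝ) : ‖Complex.exp (Complex.I * (a : ℂ)) - Complex.exp (Complex.I * (b : ℂ))‖ ≤ |a - b| := by
  have : Complex.exp (Complex.I * (a : ℂ)) - Complex.exp (Complex.I * (b : ℂ)) =
      Complex.exp (Complex.I * (b : ℂ)) * (Complex.exp (Complex.I * ((a - b : ℝ) : ℂ)) - 1) := by
    rw [mul_sub, ← Complex.exp_add, mul_one]; congr 2; push_cast; ring
  rw [this, norm_mul, mul_comm Complex.I (b : ℂ), Complex.norm_exp_ofReal_mul_I, one_mul]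
  exact Real.norm_exp_I_mul_ofReal_sub_one_le

lemma fourier_fin {Ω : Type} [Fintype Ω] (X w : Ω → ℝ) (h1 : ∀ i, 0 ≤ w i) (h2 : ∑ i, w i ≤ 1) (K c h M : ℝ)
    (hc : 0 ≤ c) (hK : 0 ≤ K) (hM : 0 ≤ M)
    (hh : 0 ≤ h) (hX : ∀ i, |X i| ≤ K) (N : ℕ) (m : Ω → ℕ) (hm : ∀ i, m i < N) (hmx : ∀ i, |X i - (h * m i - K)| ≤ h)
    (hcell : ∀ n : ℕ, ∑ i with m i = n, w i ≤ M) :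
    ‖∑ i, (w i : ℂ) * ∑ j, (w j : ℂ) * Complex.exp (Complex.I * ((c * X i * X j : ℝ) : ℂ))‖ ≤
      c * h * K + √(M * ∑ i, w i * ∑ j, w j * ‖∑ n ∈ Finset.range N, Complex.exp (Complex.I * ((n * (c * h * (X i - X j)) : ℝ) : ℂ))‖) := by
  set G : ℝ → ℂ := fun x => ∑ j, (w j : ℂ) * Complex.exp (Complex.I * ((c * x * X j : ℝ) : ℂ)) with hG
  have hlip : ∀ i, ‖G (X i)‖ ≤ ‖G (h * m i - K)‖ + c * h * K := by
    intro i
    have : ‖G (X i) - G (h * m i - K)‖ ≤ c * h * K := by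
      rw [hG]
      simp only [← Finset.sum_sub_distrib, ← mul_sub]
      calc _ ≤ ∑ j, w j * (c * h * K) := by
            refine (norm_sum_le _ _).trans (Finset.sum_le_sum fun j _ => ?_)
            rw [norm_mul, Complex.norm_real, Real.norm_of_nonneg (h1 j)]
            refine mul_le_mul_of_nonneg_left ((exp_lip _ _).trans ?_) (h1 j)
            have : c * X i * X j - c * (h * m i - K) * X j = c * (X i - (h * m i - K)) * X j := by ring
            rw [this, abs_mul, abs_mul, abs_of_nonneg hc]
            have := hmx i
            have := hX j
            gcongr
        _ = (∑ j, w j) * (c * h * K) := by rw [Finset.sum_mul]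
        _ ≤ 1 * (c * h * K) := by gcongr
        _ = _ := one_mul _
    have := norm_sub_norm_le (G (X i)) (G (h * m i - K))
    linarith
  have hA : ‖∑ i, (w i : ℂ) * G (X i)‖ ≤ c * h * K + ∑ i, w i * ‖G (h * m i - K)‖ := by
    calc _ ≤ ∑ i, w i * (‖G (h * m i - K)‖ + c * h * K) := by
          refine (norm_sum_le _ _).trans (Finset.sum_le_sum fun j _ => ?_)
          rw [norm_mul, Complex.norm_real, Real.norm_of_nonneg (h1 j)]
          exact mul_le_mul_of_nonneg_left (hlip j) (h1 j)
      _ = (∑ j, w j) * (c * h * K) + ∑ i, w i * ‖G (h * m i - K)‖ := by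
          rw [Finset.sum_mul, ← Finset.sum_add_distrib]
          exact Finset.sum_congr rfl fun i _ => by ring
      _ ≤ 1 * (c * h * K) + ∑ i, w i * ‖G (h * m i - K)‖ := by gcongr
      _ = _ := by rw [one_mul]
  refine hA.trans (add_le_add le_rfl (Real.le_sqrt_of_sq_le ?_))
  refine (Law.sq_avg w _ h1 h2).trans ?_
  have hB : ∑ i, w i * ‖G (h * m i - K)‖ ^ 2 ≤ M * ∑ n ∈ Finset.range N, ‖G (h * n - K)‖ ^ 2 := by
    rw [← Finset.sum_fiberwise_of_maps_to (s := Finset.univ) (t := Finset.range N) (g := m) (fun i _ => Finset.mem_range.2 (hm i)),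
      Finset.mul_sum]
    refine Finset.sum_le_sum fun n _ => ?_
    calc ∑ i with m i = n, w i * ‖G (h * m i - K)‖ ^ 2 = ∑ i with m i = n, w i * ‖G (h * n - K)‖ ^ 2 := by
          refine Finset.sum_congr rfl fun i hi => ?_
          rw [(Finset.mem_filter.1 hi).2]
      _ = (∑ i with m i = n, w i) * ‖G (h * n - K)‖ ^ 2 := by rw [Finset.sum_mul]
      _ ≤ _ := by
        have := hcell n
        gcongr
  refine hB.trans (mul_le_mul_of_nonneg_left ?_ hM)
  have hsq : ∀ x, ((‖G x‖ ^ 2 : ℝ) : ℂ) = ∑ i, (w i : ℂ) * ∑ j, (w j : ℂ) * Complex.exp (Complex.I * ((c * x * (X i - X j) : ℝ) : ℂ)) := by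
    intro x
    rw [← Complex.normSq_eq_norm_sq, ← Complex.mul_conj, hG]
    simp only [map_sum, map_mul, Complex.conj_ofReal, ← Complex.exp_conj, Complex.conj_I]
    rw [Finset.sum_mul]
    refine Finset.sum_congr rfl fun i _ => ?_
    rw [Finset.mul_sum, Finset.mul_sum]
    refine Finset.sum_congr rfl fun j _ => ?_
    have : Complex.exp (Complex.I * ((c * x * (X i - X j) : ℝ) : ℂ)) =
      Complex.exp (Complex.I * ((c * x * X i : ℝ) : ℂ)) * Complex.exp (-Complex.I * ((c * x * X j : ℝ) : ℂ)) := by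
      rw [← Complex.exp_add]; congr 1; push_cast; ring
    rw [this]; ring
  have e : ((∑ n ∈ Finset.range N, ‖G (h * n - K)‖ ^ 2 : ℝ) : ℂ) = ∑ i, (w i : ℂ) * ∑ j, (w j : ℂ) *
      (Complex.exp (Complex.I * ((-(c * K * (X i - X j)) : ℝ) : ℂ)) *
      ∑ n ∈ Finset.range N, Complex.exp (Complex.I * ((n * (c * h * (X i - X j)) : ℝ) : ℂ))) := by
    rw [Complex.ofReal_sum]
    simp only [hsq]
    rw [Finset.sum_comm]
    refine Finset.sum_congr rfl fun i _ => ?_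
    rw [← Finset.mul_sum, Finset.sum_comm]
    refine congrArg _ (Finset.sum_congr rfl fun j _ => ?_)
    rw [← Finset.mul_sum]
    refine congrArg _ ?_
    rw [Finset.mul_sum]
    refine Finset.sum_congr rfl fun n _ => ?_
    rw [← Complex.exp_add]; congr 1; push_cast; ring
  have h0 : 0 ≤ ∑ n ∈ Finset.range N, ‖G (h * n - K)‖ ^ 2 := by positivity
  calc _ = ‖((∑ n ∈ Finset.range N, ‖G (h * n - K)‖ ^ 2 : ℝ) : ℂ)‖ := by
        rw [Complex.norm_real, Real.norm_of_nonneg h0]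
    _ ≤ _ := by
      rw [e]
      refine (norm_sum_le _ _).trans (Finset.sum_le_sum fun i _ => ?_)
      rw [norm_mul, Complex.norm_real, Real.norm_of_nonneg (h1 i)]
      refine mul_le_mul_of_nonneg_left ?_ (h1 i)
      refine (norm_sum_le _ _).trans (Finset.sum_le_sum fun j _ => ?_)
      rw [norm_mul, Complex.norm_real, Real.norm_of_nonneg (h1 j), norm_mul, mul_comm Complex.I (Complex.ofReal (-_)), Complex.norm_exp_ofReal_mul_I, one_mul]

lemma dir3 (N : ℕ) (b d r1 r2 : ℝ) (hb : 0 < b) (hr1 : 0 < r1) (hr2 : 0 < r2) (hd : b * |d| ≤ Real.pi) :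
    ‖∑ n ∈ Finset.range N, Complex.exp (Complex.I * ((n * (b * d) : ℝ) : ℂ))‖ ≤
     N * ind (|d| ≤ r1) + Real.pi / (b * r1) * ind (|d| ≤ r2) + Real.pi / (b * r2) := by
  have hpi := Real.pi_pos
  have p1 := ind_nonneg (|d| ≤ r1)
  have p2 := ind_nonneg (|d| ≤ r2)
  have q1 : 0 ≤ N * ind (|d| ≤ r1) := by positivity
  have q2 : 0 ≤ Real.pi / (b * r1) * ind (|d| ≤ r2) := by positivity
  have q3 : 0 ≤ Real.pi / (b * r2) := by positivity
  by_cases c1 : |d| ≤ r1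
  · have : ‖∑ n ∈ Finset.range N, Complex.exp (Complex.I * ((n * (b * d) : ℝ) : ℂ))‖ ≤ N := by
      refine (norm_sum_le _ _).trans ?_
      simp only [mul_comm Complex.I, Complex.norm_exp_ofReal_mul_I]
      simp
    rw [ind_true c1] at *
    linarith
  · push Not at c1
    have hd0 : 0 < |d| := hr1.trans c1
    have hb' : |b * d| = b * |d| := by rw [abs_mul, abs_of_pos hb]
    have := dirichlet_bound N (b * d) (by rw [hb']; exact hd) (mul_ne_zero hb.ne' (abs_pos.1 hd0))
    rw [hb'] at this
    refine this.trans ?_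
    by_cases c2 : |d| ≤ r2
    · rw [ind_true c2] at *
      have : Real.pi / (b * |d|) ≤ Real.pi / (b * r1) := by gcongr
      linarith
    · push Not at c2
      have : Real.pi / (b * |d|) ≤ Real.pi / (b * r2) := by gcongr
      linarith

end PartNo14

section PartNo15

theorem FF : ∃ ε' εf H : ℝ, 0 < ε' ∧ 0 < εf ∧ 1 ≤ H ∧ ∀ (ν : Law) (η : ℝ), H ≤ η → Fr ν (η ^ ε') (3 / 5) η →
    ‖Law.F (2 * Real.pi * η) (ν * ν)‖ ≤ η ^ (-εf) := by
  obtain ⟨H, hH, hbig⟩ := exists_big 10 (1 / 2000) (by norm_num)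
  refine ⟨1 / 1000, 1 / 2000, H, by norm_num, by norm_num, hH, ?_⟩
  intro ν η hη hF
  have hη1 : 1 ≤ η := hH.trans hη
  have hη0 : 0 < η := by linarith
  have hb := hbig η hη
  have hpi := Real.pi_pos
  have hpi4 : Real.pi ≤ 4 := Real.pi_le_four
  have pm : ∀ a b : ℝ, η ^ a * η ^ b = η ^ (a + b) := fun a b => (Real.rpow_add hη0 a b).symm
  have mono : ∀ a b : ℝ, a ≤ b → η ^ a ≤ η ^ b := fun a b h => Real.rpow_le_rpow_of_exponent_le hη1 h
  have pos : ∀ a : ℝ, 0 < η ^ a := fun a => Real.rpow_pos_of_pos hη0 a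
  have inv1 : 1 / η = η ^ (-1 : ℝ) := by rw [Real.rpow_neg_one, one_div]
  set e : ℝ := 1 / 1000 with he
  set K := η ^ e with hK
  set h := η ^ (-1 - 2 * e) with hh
  have hK0 : 0 < K := pos _
  have hh0 : 0 < h := pos _
  have hK1 : 1 ≤ K := Real.one_le_rpow hη1 (by rw [he]; norm_num)
  have hK4 : 4 ≤ K := by
    have := mono (1 / 2000) e (by rw [he]; norm_num)
    linarith
  have hhη : h ≤ 1 / η := by rw [inv1]; exact mono _ _ (by rw [he]; norm_num)
  have hch : 2 * Real.pi * η * h = 2 * Real.pi * η ^ (-2 * e) := by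
    rw [mul_assoc]; congr 1
    nth_rw 1 [← Real.rpow_one η]
    rw [hh, pm]; congr 1; ring
  obtain ⟨Ω, _, X, w, w1, w2, hX, hI, hIR⟩ := ν.rep hF.supp
  set m : Ω → ℕ := fun i => ⌊(X i + K) / h⌋₊ with hm
  set N : ℕ := ⌊2 * K / h⌋₊ + 1 with hN
  have hXK : ∀ i, 0 ≤ X i + K ∧ X i + K ≤ 2 * K := fun i => by
    have := abs_le.1 (hX i)
    constructor <;> linarith
  have hmx : ∀ i, |X i - (h * m i - K)| ≤ h := by
    intro i
    have a1 := Nat.floor_le (div_nonneg (hXK i).1 hh0.le)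
    have a2 := Nat.lt_floor_add_one ((X i + K) / h)
    rw [le_div_iff₀ hh0] at a1
    rw [div_lt_iff₀ hh0] at a2
    rw [abs_le]
    constructor <;> simp only [hm] <;> nlinarith
  have hmN : ∀ i, m i < N := by
    intro i
    rw [hN, Nat.lt_succ_iff]
    apply Nat.floor_le_floor
    have := (hXK i).2
    gcongr
  have hloc : ∀ z r : ℝ, 1 / η ≤ r → r ≤ 1 → ∑ j, w j * ind (|X j - z| ≤ r) ≤ K * r ^ (3 / 5 : ℝ) := by
    intro z r hr1 hr2
    have := hF.loc z r hr1 hr2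
    rwa [hIR] at this
  have hcell : ∀ n : ℕ, ∑ i with m i = n, w i ≤ η ^ (e - 3 / 5) := by
    intro n
    have h3 := hloc (h * n - K) (1 / η) le_rfl (by rw [inv1]; exact Real.rpow_le_one_of_one_le_of_nonpos hη1 (by norm_num))
    have e3 : K * (1 / η) ^ (3 / 5 : ℝ) = η ^ (e - 3 / 5) := by
      rw [inv1, ← Real.rpow_mul hη0.le, hK, pm]; congr 1; ring
    rw [e3] at h3
    refine le_trans ?_ h3
    rw [Finset.sum_filter]
    refine Finset.sum_le_sum fun i _ => ?_
    split_ifs with hi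
    · rw [ind_true, mul_one]
      rw [← hi]
      exact (hmx i).trans hhη
    · exact mul_nonneg (w1 i) (ind_nonneg _)
  have hmain := fourier_fin X w w1 w2 K (2 * Real.pi * η) h (η ^ (e - 3 / 5)) (by positivity) hK0.le (pos _).le hh0.le hX N m hmN hmx hcell
  have hFeq : Law.F (2 * Real.pi * η) (ν * ν) = ∑ i, (w i : ℂ) * ∑ j, (w j : ℂ) * Complex.exp (Complex.I * ((2 * Real.pi * η * X i * X j : ℝ) : ℂ)) := by
    rw [Law.F_mul, hI]
    refine Finset.sum_congr rfl fun i _ => ?_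
    rw [Law.F, hI]
  rw [hFeq]
  refine hmain.trans ?_
  set r1 := η ^ (-(9 / 10) : ℝ) with hr1
  set r2 := η ^ (-(11 / 20) : ℝ) with hr2
  have hr1' : 0 < r1 := pos _
  have hr2' : 0 < r2 := pos _
  set b := 2 * Real.pi * η * h with hbdef
  have hb0 : 0 < b := by positivity
  have hdir : ∀ i j, ‖∑ n ∈ Finset.range N, Complex.exp (Complex.I * ((n * (b * (X i - X j)) : ℝ) : ℂ))‖ ≤
     N * ind (|X j - X i| ≤ r1) + Real.pi / (b * r1) * ind (|X j - X i| ≤ r2) + Real.pi / (b * r2) := by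
    intro i j
    rw [abs_sub_comm (X j)]
    apply dir3 N b _ r1 r2 hb0 hr1' hr2'
    have hd : |X i - X j| ≤ 2 * K := by
      have := abs_sub (X i) (X j)
      linarith [hX i, hX j]
    calc b * |X i - X j| ≤ b * (2 * K) := by gcongr
      _ = Real.pi * (4 * η ^ (-e)) := by
        have : η ^ (-2 * e) * η ^ e = η ^ (-e) := by rw [pm]; congr 1; ring
        rw [hch, ← this]; ring
      _ ≤ Real.pi * 1 := by
        gcongr
        rw [Real.rpow_neg hη0.le, ← div_eq_mul_inv, div_le_one (pos _)]
        exact hK4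
      _ = _ := mul_one _
  have hdbl : ∑ i, w i * ∑ j, w j * ‖∑ n ∈ Finset.range N, Complex.exp (Complex.I * ((n * (b * (X i - X j)) : ℝ) : ℂ))‖ ≤
      N * (K * r1 ^ (3 / 5 : ℝ)) + Real.pi / (b * r1) * (K * r2 ^ (3 / 5 : ℝ)) + Real.pi / (b * r2) := by
    set T := N * (K * r1 ^ (3 / 5 : ℝ)) + Real.pi / (b * r1) * (K * r2 ^ (3 / 5 : ℝ)) + Real.pi / (b * r2) with hT
    have hT0 : 0 ≤ T := by positivity
    have hin : ∀ i, ∑ j, w j * ‖∑ n ∈ Finset.range N, Complex.exp (Complex.I * ((n * (b * (X i - X j)) : ℝ) : ℂ))‖ ≤ T := by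
      intro i
      calc _ ≤ ∑ j, w j * (N * ind (|X j - X i| ≤ r1) + Real.pi / (b * r1) * ind (|X j - X i| ≤ r2) + Real.pi / (b * r2)) :=
            Finset.sum_le_sum fun j _ => mul_le_mul_of_nonneg_left (hdir i j) (w1 j)
        _ = N * (∑ j, w j * ind (|X j - X i| ≤ r1)) + Real.pi / (b * r1) * (∑ j, w j * ind (|X j - X i| ≤ r2)) + Real.pi / (b * r2) * ∑ j, w j := by
            rw [Finset.mul_sum, Finset.mul_sum, Finset.mul_sum, ← Finset.sum_add_distrib, ← Finset.sum_add_distrib]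
            exact Finset.sum_congr rfl fun j _ => by ring
        _ ≤ N * (K * r1 ^ (3 / 5 : ℝ)) + Real.pi / (b * r1) * (K * r2 ^ (3 / 5 : ℝ)) + Real.pi / (b * r2) * 1 := by
            have l1 := hloc (X i) r1 (by rw [inv1]; exact mono _ _ (by norm_num)) (Real.rpow_le_one_of_one_le_of_nonpos hη1 (by norm_num))
            have l2 := hloc (X i) r2 (by rw [inv1]; exact mono _ _ (by norm_num)) (Real.rpow_le_one_of_one_le_of_nonpos hη1 (by norm_num))
            gcongr
        _ = T := by rw [mul_one]
    calc _ ≤ ∑ i, w i * T := Finset.sum_le_sum fun i _ => mul_le_mul_of_nonneg_left (hin i) (w1 i)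
      _ = (∑ i, w i) * T := by rw [Finset.sum_mul]
      _ ≤ 1 * T := by gcongr
      _ = T := one_mul _
  have hNle : (N : ℝ) ≤ 3 * η ^ (1 + 3 * e) := by
    have e1 : K / h = η ^ (1 + 3 * e) := by
      rw [hK, hh, ← Real.rpow_sub hη0]; congr 1; ring
    have e2 : 1 ≤ η ^ (1 + 3 * e) := Real.one_le_rpow hη1 (by rw [he]; norm_num)
    have : (N : ℝ) ≤ 2 * K / h + 1 := by
      rw [hN]; push_cast
      have := Nat.floor_le (by positivity : 0 ≤ 2 * K / h)
      linarith
    rw [mul_div_assoc, e1] at this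
    linarith
  have hA : ∀ a : ℝ, Real.pi / (b * η ^ a) = 1 / 2 * η ^ (2 * e - a) := by
    intro a
    rw [hch, mul_assoc, pm, div_eq_iff (by have := pos (-2 * e + a); positivity)]
    have : η ^ (2 * e - a) * η ^ (-2 * e + a) = 1 := by
      rw [pm]; rw [show 2 * e - a + (-2 * e + a) = 0 by ring, Real.rpow_zero]
    linear_combination (-Real.pi) * this
  have htot : η ^ (e - 3 / 5) * (N * (K * r1 ^ (3 / 5 : ℝ)) + Real.pi / (b * r1) * (K * r2 ^ (3 / 5 : ℝ)) + Real.pi / (b * r2)) ≤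
      4 * η ^ (-2 * e) := by
    rw [hr1, hr2, hA, hA, ← Real.rpow_mul hη0.le, ← Real.rpow_mul hη0.le, hK, pm, pm]
    have m1 := mono (e - 3 / 5 + (1 + 3 * e + (e + -(9 / 10) * (3 / 5)))) (-2 * e) (by rw [he]; norm_num)
    have m2 := mono (e - 3 / 5 + (2 * e - -(9 / 10) + (e + -(11 / 20) * (3 / 5)))) (-2 * e) (by rw [he]; norm_num)
    have m3 := mono (e - 3 / 5 + (2 * e - -(11 / 20))) (-2 * e) (by rw [he]; norm_num)
    rw [← pm, ← pm] at m1 m2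
    rw [← pm] at m3
    have q := pos (e - 3 / 5)
    have q2 := pos (e + -(9 / 10) * (3 / 5))
    have : η ^ (e - 3 / 5) * (N * η ^ (e + -(9 / 10) * (3 / 5))) ≤ η ^ (e - 3 / 5) * (3 * η ^ (1 + 3 * e) * η ^ (e + -(9 / 10) * (3 / 5))) := by
      gcongr
    linarith
  have hsq : √(η ^ (e - 3 / 5) * ∑ i, w i * ∑ j, w j * ‖∑ n ∈ Finset.range N, Complex.exp (Complex.I * ((n * (b * (X i - X j)) : ℝ) : ℂ))‖) ≤ 2 * η ^ (-e) := by
    rw [Real.sqrt_le_left (by have := pos (-e); positivity)]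
    calc _ ≤ _ := mul_le_mul_of_nonneg_left hdbl (pos _).le
      _ ≤ _ := htot
      _ = _ := by
        rw [mul_pow, sq (η ^ (-e)), pm]
        norm_num
  have hfirst : b * K ≤ 8 * η ^ (-e) := by
    have : η ^ (-2 * e) * η ^ e = η ^ (-e) := by rw [pm]; congr 1; ring
    rw [hch, mul_assoc, hK, this]
    have := pos (-e)
    nlinarith
  have hlast : 10 * η ^ (-e) ≤ η ^ (-(1 / 2000) : ℝ) := by
    have : η ^ (-(1 / 2000) : ℝ) = η ^ (1 / 2000 : ℝ) * η ^ (-e) := by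
      rw [pm]; congr 1; rw [he]; norm_num
    rw [this]
    have := pos (-e)
    gcongr
  linarith

end PartNo15

section PartNo16

lemma repl_all {k : ℕ} (hk0 : 1 ≤ k) (c : ℝ) (μ : Fin k → Law) (s : Finset (Fin k)) : ∀ R : Law,
    ‖Law.F c (R * ∏ j ∈ s, μ j)‖ ^ (4 ^ s.card) ≤
      (k : ℝ) ^ (4 ^ s.card) * ‖Law.F c (R * (Law.mix fun i => (μ i).S) ^ s.card)‖ := by
  set ν := Law.mix fun i => (μ i).S with hν
  induction s using Finset.induction_on with
  | empty =>
    intro R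
    simp only [Finset.prod_empty, Finset.card_empty, pow_zero, pow_one]
    have : (1 : ℝ) ≤ k := by exact_mod_cast hk0
    nlinarith [norm_nonneg (Law.F c (R * 1))]
  | insert j s hj ih =>
    intro R
    have hk : (1 : ℝ) ≤ k := by exact_mod_cast j.pos
    rw [Finset.prod_insert hj, Finset.card_insert_of_notMem hj]
    have h1 : ‖Law.F c (R * (μ j * ∏ j ∈ s, μ j))‖ ^ 4 ≤ k * ‖Law.F c ((R * ν) * ∏ j ∈ s, μ j)‖ := by
      have e1 : R * (μ j * ∏ j ∈ s, μ j) = (R * ∏ j ∈ s, μ j) * μ j := by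
        rw [mul_assoc, mul_comm (μ j)]
      have e2 : (R * ν) * ∏ j ∈ s, μ j = (R * ∏ j ∈ s, μ j) * ν := by
        rw [mul_assoc, mul_assoc, mul_comm ν]
      rw [e1, e2]
      exact (Law.holder c _ _).trans (Law.mix_bound c _ μ j)
    have h2 := ih (R * ν)
    have e3 : R * ν * ν ^ s.card = R * ν ^ (s.card + 1) := by rw [pow_succ', mul_assoc]
    rw [e3] at h2
    calc _ = (‖Law.F c (R * (μ j * ∏ j ∈ s, μ j))‖ ^ 4) ^ (4 ^ s.card) := by rw [← pow_mul, pow_succ']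
      _ ≤ (k * ‖Law.F c ((R * ν) * ∏ j ∈ s, μ j)‖) ^ (4 ^ s.card) := by gcongr
      _ = (k : ℝ) ^ (4 ^ s.card) * ‖Law.F c ((R * ν) * ∏ j ∈ s, μ j)‖ ^ (4 ^ s.card) := by rw [mul_pow]
      _ ≤ (k : ℝ) ^ (4 ^ s.card) * ((k : ℝ) ^ (4 ^ s.card) * ‖Law.F c (R * ν ^ (s.card + 1))‖) := by gcongr
      _ = (k : ℝ) ^ (4 ^ s.card + 4 ^ s.card) * ‖Law.F c (R * ν ^ (s.card + 1))‖ := by rw [pow_add]; ring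
      _ ≤ _ := by
        gcongr
        rw [pow_succ]; omega

lemma pow_S (c : ℝ) (μ : Law) (a : ℕ) : ∀ R : Law, ‖Law.F c (R * μ ^ a)‖ ^ (4 ^ a) ≤ ‖Law.F c (R * μ.S ^ a)‖ := by
  induction a with
  | zero => intro R; simp
  | succ a ih =>
    intro R
    have h1 : ‖Law.F c (R * μ ^ (a + 1))‖ ^ 4 ≤ ‖Law.F c ((R * μ.S) * μ ^ a)‖ := by
      have e1 : R * μ ^ (a + 1) = (R * μ ^ a) * μ := by rw [pow_succ, mul_assoc]
      have e2 : (R * μ.S) * μ ^ a = (R * μ ^ a) * μ.S := by rw [mul_assoc, mul_assoc, mul_comm μ.S]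
      rw [e1, e2]
      exact Law.holder c _ _
    have h2 := ih (R * μ.S)
    have e3 : R * μ.S * μ.S ^ a = R * μ.S ^ (a + 1) := by rw [pow_succ', mul_assoc]
    rw [e3] at h2
    calc _ = (‖Law.F c (R * μ ^ (a + 1))‖ ^ 4) ^ (4 ^ a) := by rw [← pow_mul, ← pow_succ']
      _ ≤ (‖Law.F c ((R * μ.S) * μ ^ a)‖) ^ (4 ^ a) := by gcongr
      _ ≤ _ := h2

lemma iter_pow (n : ℕ) : ∀ q : ℕ, ∃ E : ℕ, 1 ≤ E ∧ ∀ (c : ℝ) (ν : Law),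
    ‖Law.F c (ν ^ (2 ^ n * q))‖ ^ E ≤ ‖Law.F c ((iterL ν n) ^ q)‖ := by
  induction n with
  | zero => intro q; exact ⟨1, le_rfl, fun c ν => by simp [iterL]⟩
  | succ n ih =>
    intro q
    obtain ⟨E, hE, h⟩ := ih (2 * q)
    refine ⟨E * 4 ^ q, Nat.one_le_iff_ne_zero.2 (by positivity), fun c ν => ?_⟩
    have e : 2 ^ (n + 1) * q = 2 ^ n * (2 * q) := by ring
    rw [e, pow_mul]
    have h1 := h c ν
    have h2 := pow_S c (iterL ν n * iterL ν n) q 1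
    rw [one_mul, one_mul, ← sq, ← pow_mul] at h2
    calc _ ≤ ‖Law.F c ((iterL ν n) ^ (2 * q))‖ ^ (4 ^ q) := by gcongr
      _ ≤ _ := h2
      _ = _ := by rw [iterL, ← sq]

theorem law_main (κ₀ : ℝ) (h0 : 0 < κ₀) (h1 : κ₀ ≤ 1 / 3) : ∃ (k : ℕ) (ε ε₁ H : ℝ), 1 ≤ k ∧ 0 < ε ∧ 0 < ε₁ ∧ 1 ≤ H ∧
    ∀ (μ : Fin k → Law) (η : ℝ), H ≤ η → Fr (Law.mix fun i => (μ i).S) (η ^ ε) κ₀ η →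
      ‖Law.F (2 * Real.pi * η) (∏ j, μ j)‖ ≤ k * η ^ (-ε₁) := by
  obtain ⟨ε', εf, H1, he', hef, hH1, hFF⟩ := FF
  obtain ⟨n, hn⟩ := FL3 κ₀ h0 h1
  obtain ⟨ε, H2, he, hH2, hFL⟩ := hn ε' he'
  obtain ⟨E, hE, hit⟩ := iter_pow n 2
  set k := 2 ^ n * 2 with hk
  have hk1 : 1 ≤ k := Nat.one_le_iff_ne_zero.2 (by positivity)
  set E' := 4 ^ k * E with hE'
  have hE'0 : E' ≠ 0 := by positivity
  have hEr : (0 : ℝ) < E' := by positivity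
  refine ⟨k, ε, εf / E', max H1 H2, hk1, he, by positivity, hH1.trans (le_max_left _ _), ?_⟩
  intro μ η hη hFr
  have hη1 : H1 ≤ η := (le_max_left _ _).trans hη
  have hη0 : 0 < η := by linarith
  have a1 := hFF _ η hη1 (hFL _ η ((le_max_right _ _).trans hη) hFr)
  have a2 := hit (2 * Real.pi * η) (Law.mix fun i => (μ i).S)
  have a3 := repl_all hk1 (2 * Real.pi * η) μ Finset.univ 1
  rw [sq] at a2
  rw [one_mul, one_mul, Finset.card_univ, Fintype.card_fin] at a3
  have a4 : ‖Law.F (2 * Real.pi * η) (∏ j, μ j)‖ ^ E' ≤ (k * η ^ (-(εf / E'))) ^ E' := by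
    calc _ = (‖Law.F (2 * Real.pi * η) (∏ j, μ j)‖ ^ (4 ^ k)) ^ E := by rw [← pow_mul]
      _ ≤ ((k : ℝ) ^ (4 ^ k) * ‖Law.F (2 * Real.pi * η) ((Law.mix fun i => (μ i).S) ^ k)‖) ^ E := by gcongr
      _ = (k : ℝ) ^ E' * ‖Law.F (2 * Real.pi * η) ((Law.mix fun i => (μ i).S) ^ k)‖ ^ E := by rw [mul_pow, ← pow_mul]
      _ ≤ (k : ℝ) ^ E' * η ^ (-εf) := by
        gcongr
        exact a2.trans a1
      _ = _ := by
        rw [mul_pow, ← Real.rpow_natCast (η ^ _), ← Real.rpow_mul hη0.le]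
        congr 2
        field_simp
  exact le_of_pow_le_pow_left₀ hE'0 (by positivity) a4

end PartNo16

section PartNo17

lemma base_law {α : Type} (Z : Finset α) (ζ : α → ℝ) (A B : ℝ) (hA : 0 < A) (hcard : (Z.card : ℝ) ≤ A)
    (hζ : ∀ b ∈ Z, |ζ b| ≤ B) : ∃ μ : Law, μ.Supp B ∧ (∀ f, μ.I f = ((1 / A : ℝ) : ℂ) * ∑ b ∈ Z, f (ζ b)) ∧
      ∀ g, μ.IR g = 1 / A * ∑ b ∈ Z, g (ζ b) := by
  have hR : RepB (fun f => ((1 / A : ℝ) : ℂ) * ∑ b ∈ Z, f (ζ b)) B := by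
    refine ⟨Z, inferInstance, fun b => ζ b, fun _ => 1 / A, fun _ => by positivity, ?_, fun i => hζ i i.2, ?_⟩
    · simp only [Finset.sum_const, Finset.card_univ, Fintype.card_coe, nsmul_eq_mul]
      rw [mul_one_div, div_le_one hA]; exact hcard
    · intro f
      rw [← Finset.mul_sum]
      exact congrArg _ (Finset.sum_coe_sort Z fun b => f (ζ b)).symm
  refine ⟨⟨_, B, hR⟩, hR, fun f => rfl, fun g => ?_⟩
  change ((((1 / A : ℝ) : ℂ) * ∑ b ∈ Z, ((g (ζ b) : ℝ) : ℂ))).re = _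
  rw [← Complex.ofReal_sum, ← Complex.ofReal_mul, Complex.ofReal_re]

lemma prod_law {α : Type} [DecidableEq α] (A : ℝ) : ∀ (k : ℕ) (Z : Fin k → Finset α) (ζ : Fin k → α → ℝ) (μ : Fin k → Law),
    (∀ j f, (μ j).I f = ((1 / A : ℝ) : ℂ) * ∑ b ∈ Z j, f (ζ j b)) → ∀ f : ℝ → ℂ,
    (∏ j, μ j).I f = ((1 / A : ℝ) : ℂ) ^ k * ∑ b ∈ Fintype.piFinset Z, f (∏ j, ζ j (b j)) := by
  intro k
  induction k with
  | zero =>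
    intro Z ζ μ _ f
    simp [Law.I_one, Fintype.piFinset]
  | succ k ih =>
    intro Z ζ μ hμ f
    rw [Fin.prod_univ_succ, Law.I_mul, hμ]
    have h2 := ih (fun j => Z j.succ) (fun j => ζ j.succ) (fun j => μ j.succ) (fun j f => hμ j.succ f)
    simp only [h2]
    rw [← Finset.mul_sum, ← mul_assoc, ← pow_succ', ← Finset.sum_product']
    congr 1
    refine Finset.sum_bij' (fun p _ => (Fin.cons p.1 p.2 : Fin (k + 1) → α)) (fun b _ => (b 0, fun j => b j.succ)) ?_ ?_ ?_ ?_ ?_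
    · intro p hp
      rw [Finset.mem_product, Fintype.mem_piFinset] at hp
      rw [Fintype.mem_piFinset]
      intro j
      refine Fin.cases ?_ ?_ j
      · simpa using hp.1
      · intro i; simpa using hp.2 i
    · intro b hb
      rw [Fintype.mem_piFinset] at hb
      rw [Finset.mem_product, Fintype.mem_piFinset]
      exact ⟨hb 0, fun j => hb j.succ⟩
    · intro p _
      simp
    · intro b _
      funext j
      refine Fin.cases ?_ ?_ j <;> simp
    · intro p _
      rw [Fin.prod_univ_succ]; simp

lemma ball_count {α : Type} [DecidableEq α] (Z : Finset α) (ζ : α → ℝ) (z r : ℝ) :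
    (∑ b ∈ Z, ind (|ζ b - z| ≤ r)) ^ 2 ≤
      (Set.ncard {p : α × α | p.1 ∈ Z ∧ p.2 ∈ Z ∧ |ζ p.1 - ζ p.2| ≤ 2 * r} : ℝ) := by
  classical
  set Q := Z.filter fun b => |ζ b - z| ≤ r with hQ
  have e : ∑ b ∈ Z, ind (|ζ b - z| ≤ r) = (Q.card : ℝ) := by
    unfold ind
    rw [hQ, ← Finset.sum_filter]
    simp
  rw [e, sq, ← Nat.cast_mul, ← Finset.card_product, ← Set.ncard_coe_finset]
  have hfin : {p : α × α | p.1 ∈ Z ∧ p.2 ∈ Z ∧ |ζ p.1 - ζ p.2| ≤ 2 * r}.Finite := by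
    refine (Z ×ˢ Z).finite_toSet.subset ?_
    rintro p ⟨h1, h2, _⟩
    exact Finset.mem_coe.2 (Finset.mem_product.2 ⟨h1, h2⟩)
  refine Nat.cast_le.2 (Set.ncard_le_ncard ?_ hfin)
  intro p hp
  obtain ⟨h1, h2⟩ := Finset.mem_product.1 (Finset.mem_coe.1 hp)
  obtain ⟨a1, a2⟩ := Finset.mem_filter.1 h1
  obtain ⟨b1, b2⟩ := Finset.mem_filter.1 h2
  refine ⟨a1, b1, ?_⟩
  rw [abs_le] at *
  constructor <;> linarith

lemma mix_S_loc {k : ℕ} (hk : 1 ≤ k) (μ : Fin k → Law) (r M : ℝ) (hM : 0 ≤ M)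
    (h : ∀ j z, (μ j).IR (fun x => ind (|x - z| ≤ r)) ≤ M) (z : ℝ) :
    (Law.mix fun i => (μ i).S).IR (fun x => ind (|x - z| ≤ r)) ≤ M := by
  have hk' : (0 : ℝ) < k := by exact_mod_cast hk
  have hS : ∀ j, (μ j).S.IR (fun x => ind (|x - z| ≤ r)) ≤ M := by
    intro j
    rw [Law.IR_S]
    refine Law.IR_le _ hM fun x => Law.IR_le _ hM fun y => Law.IR_le _ hM fun u => ?_
    refine le_trans (Law.IR_mono _ fun t => ?_) (h j (x + y - u - z))
    refine ind_mono fun h' => ?_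
    rw [abs_sub_comm]
    convert h' using 2; ring
  rw [Law.IR_mix]
  calc _ ≤ 1 / (k : ℝ) * ∑ j : Fin k, M := by
        gcongr with j
        exact hS j
    _ = M := by
      rw [Finset.sum_const, Finset.card_univ, Fintype.card_fin, nsmul_eq_mul]
      field_simp

lemma norm_sum_abs {β : Type} (s : Finset β) (g : β → ℝ) (η : ℝ) :
    ‖∑ b ∈ s, Complex.exp (Complex.I * ((2 * Real.pi * η * g b : ℝ) : ℂ))‖ =
      ‖∑ b ∈ s, Complex.exp (Complex.I * ((2 * Real.pi * |η| * g b : ℝ) : ℂ))‖ := by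
  rcases abs_cases η with ⟨h, _⟩ | ⟨h, _⟩
  · rw [h]
  · rw [h, ← Complex.norm_conj, map_sum]
    congr 1
    refine Finset.sum_congr rfl fun b _ => ?_
    rw [← Complex.exp_conj, map_mul, Complex.conj_I, Complex.conj_ofReal]
    congr 1; push_cast; ring

lemma base_loc {α : Type} [DecidableEq α] (Z : Finset α) (ζ : α → ℝ) (N C₀ δ₀ ε ε₂ κ₀ η : ℝ) (μ : Law)
    (hN : 0 < N) (hC : 0 < C₀) (hε₂ : ε₂ ≤ ε / 2) (hκ : κ₀ ≤ δ₀ / 2) (hκ1 : κ₀ ≤ 1) (hη : 1 ≤ η) (hε0 : 0 < ε)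
    (hbig : 2 ≤ η ^ (ε / 2)) (hbig2 : √(2 ^ δ₀ / C₀) ≤ η ^ (ε / 2))
    (hμ : ∀ g, μ.IR g = 1 / (C₀ * N) * ∑ b ∈ Z, g (ζ b))
    (hp : ∀ σ ∈ Set.Icc η⁻¹ (η ^ (-ε₂)), (Set.ncard {p : α × α | p.1 ∈ Z ∧ p.2 ∈ Z ∧ |ζ p.1 - ζ p.2| ≤ σ} : ℝ)
            ≤ C₀ * N ^ 2 * σ ^ δ₀) (z r : ℝ) (hr1 : 1 / η ≤ r) (hr2 : r ≤ 1) :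
    μ.IR (fun x => ind (|x - z| ≤ r)) ≤ η ^ ε * r ^ κ₀ := by
  have hη0 : 0 < η := by linarith
  have hr0 : 0 < r := lt_of_lt_of_le (by positivity) hr1
  by_cases hc : 2 * r ≤ η ^ (-ε₂)
  · have h1 := (ball_count Z ζ z r).trans (hp (2 * r) ⟨by rw [one_div] at hr1; linarith, hc⟩)
    rw [hμ]
    set q := ∑ b ∈ Z, ind (|ζ b - z| ≤ r)
    have h2 : (1 / (C₀ * N) * q) ^ 2 ≤ 2 ^ δ₀ / C₀ * r ^ δ₀ := by
      rw [Real.mul_rpow (by norm_num) hr0.le] at h1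
      rw [mul_pow, div_pow, one_pow, div_mul_eq_mul_div, one_mul, div_le_iff₀ (by positivity)]
      refine h1.trans (le_of_eq ?_)
      field_simp
    have h3 : 1 / (C₀ * N) * q ≤ √(2 ^ δ₀ / C₀) * r ^ (δ₀ / 2) := by
      refine (Real.le_sqrt_of_sq_le h2).trans (le_of_eq ?_)
      rw [Real.sqrt_mul (by positivity), Real.sqrt_eq_rpow (r ^ δ₀), ← Real.rpow_mul hr0.le]
      congr 2; ring
    refine h3.trans ?_
    have h4 : √(2 ^ δ₀ / C₀) ≤ η ^ ε := hbig2.trans (Real.rpow_le_rpow_of_exponent_le hη (by linarith))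
    have h5 : r ^ (δ₀ / 2) ≤ r ^ κ₀ := Real.rpow_le_rpow_of_exponent_ge hr0 hr2 hκ
    have := Real.rpow_pos_of_pos hr0 (δ₀ / 2)
    have := Real.rpow_pos_of_pos hη0 ε
    gcongr
  · push Not at hc
    refine (Law.IR_le _ zero_le_one fun x => ind_le_one _).trans ?_
    have h1 : r ≤ r ^ κ₀ := by
      nth_rw 1 [← Real.rpow_one r]
      exact Real.rpow_le_rpow_of_exponent_ge hr0 hr2 hκ1
    have h2 : η ^ (-(ε / 2)) ≤ 2 * r := (Real.rpow_le_rpow_of_exponent_le hη (by linarith)).trans hc.le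
    have h3 : η ^ ε * η ^ (-(ε / 2)) = η ^ (ε / 2) := by rw [← Real.rpow_add hη0]; congr 1; ring
    have p := Real.rpow_pos_of_pos hη0 ε
    have h4 : η ^ ε * η ^ (-(ε / 2)) ≤ η ^ ε * (2 * r) := by gcongr
    have h5 : η ^ ε * r ≤ η ^ ε * r ^ κ₀ := by gcongr
    linarith

theorem mcdd_aux (δ₀ : ℝ) (hδ₀ : 0 < δ₀) :
    ∃ (k : ℕ) (ε₂ : ℝ), 0 < ε₂ ∧ ∀ C₀ : ℝ, 0 < C₀ → ∃ C₁ > (0 : ℝ),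
      ∀ (α : Type) [DecidableEq α] (Z : Fin k → Finset α) (ζ : Fin k → α → ℝ) (N : ℝ),
        0 ≤ N →
        (∀ j, ((Z j).card : ℝ) ≤ C₀ * N) →
        (∀ j, ∀ b ∈ Z j, ζ j b ∈ Set.Icc C₀⁻¹ C₀) →
        ∀ η : ℝ, 1 < |η| →
        (∀ σ ∈ Set.Icc |η|⁻¹ (|η| ^ (-ε₂)), ∀ j,
          (Set.ncard {p : α × α | p.1 ∈ Z j ∧ p.2 ∈ Z j ∧ |ζ j p.1 - ζ j p.2| ≤ σ} : ℝ)
            ≤ C₀ * N ^ 2 * σ ^ δ₀) →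
        (N ^ k)⁻¹ * ‖∑ b ∈ Fintype.piFinset Z,
            Complex.exp (Complex.I * ((2 * Real.pi * η * ∏ j, ζ j (b j) : ℝ) : ℂ))‖
          ≤ C₁ * |η| ^ (-ε₂) := by
  set κ₀ := min (δ₀ / 2) (1 / 3) with hκ₀
  obtain ⟨k, ε, ε₁, H, hk, hε, hε₁, hH, hmain⟩ := law_main κ₀ (by positivity) (min_le_right _ _)
  set ε₂ := min (ε / 2) ε₁ with hε₂
  have hε₂0 : 0 < ε₂ := by positivity
  refine ⟨k, ε₂, hε₂0, fun C₀ hC₀ => ?_⟩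
  obtain ⟨H', hH', hbig⟩ := exists_big (max (4 * C₀) (max 2 √(2 ^ δ₀ / C₀))) (ε / 2) (by positivity)
  set H₀ := max H H' with hH₀
  have hH₀1 : 1 ≤ H₀ := hH.trans (le_max_left _ _)
  have hH₀p : 0 < H₀ ^ ε₂ := Real.rpow_pos_of_pos (by linarith) _
  refine ⟨C₀ ^ k * (k + H₀ ^ ε₂), by positivity, ?_⟩
  intro α _ Z ζ N hN hcard hζ η hη hp
  have hη0 : 0 < |η| := by linarith
  have hpow : 0 < |η| ^ (-ε₂) := Real.rpow_pos_of_pos hη0 _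
  rcases hN.eq_or_lt with hN0 | hN0
  · rw [← hN0, zero_pow (by omega), inv_zero, zero_mul]; positivity
  rw [norm_sum_abs (Fintype.piFinset Z) (fun b => ∏ j, ζ j (b j)) η]
  have hζ' : ∀ j, ∀ b ∈ Z j, |ζ j b| ≤ C₀ := fun j b hb => by
    have := hζ j b hb
    rw [abs_of_nonneg ((inv_pos.2 hC₀).le.trans this.1)]; exact this.2
  choose μ hsupp hI hIR using fun j => base_law (Z j) (ζ j) (C₀ * N) C₀ (by positivity) (hcard j) (hζ' j)
  have hprod := prod_law (C₀ * N) k Z ζ μ hI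
    (fun x => Complex.exp (Complex.I * ((2 * Real.pi * |η| * x : ℝ) : ℂ)))
  have hF : (N ^ k)⁻¹ * ‖∑ b ∈ Fintype.piFinset Z,
      Complex.exp (Complex.I * ((2 * Real.pi * |η| * ∏ j, ζ j (b j) : ℝ) : ℂ))‖ = C₀ ^ k * ‖Law.F (2 * Real.pi * |η|) (∏ j, μ j)‖ := by
    rw [Law.F, hprod, norm_mul, norm_pow, Complex.norm_real, Real.norm_of_nonneg (by positivity), ← mul_assoc]
    congr 1
    rw [div_pow, mul_pow, one_pow]; field_simp
  rw [hF, mul_assoc (C₀ ^ k)]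
  refine mul_le_mul_of_nonneg_left ?_ (pow_pos hC₀ k).le
  by_cases hbigη : H₀ ≤ |η|
  · have hb := hbig |η| ((le_max_right _ _).trans hbigη)
    rw [max_le_iff, max_le_iff] at hb
    obtain ⟨b1, b2, b3⟩ := hb
    have hFr : Fr (Law.mix fun i => (μ i).S) (|η| ^ ε) κ₀ |η| := by
      constructor
      · refine Law.Supp.mix fun j => ((hsupp j).S).mono ?_
        exact b1.trans (Real.rpow_le_rpow_of_exponent_le hη.le (by linarith))
      · intro z r hr1 hr2
        have hr0 : 0 < r := lt_of_lt_of_le (by positivity) hr1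
        refine mix_S_loc hk μ r _ (by positivity) (fun j z => ?_) z
        exact base_loc (Z j) (ζ j) N C₀ δ₀ ε ε₂ κ₀ |η| (μ j) hN0 hC₀ (min_le_left _ _) (min_le_left _ _)
          ((min_le_right _ _).trans (by norm_num)) hη.le hε b2 b3 (hIR j) (fun σ hσ => hp σ hσ j) z r hr1 hr2
    refine (hmain μ |η| ((le_max_left _ _).trans hbigη) hFr).trans ?_
    have : |η| ^ (-ε₁) ≤ |η| ^ (-ε₂) := Real.rpow_le_rpow_of_exponent_le hη.le (neg_le_neg (min_le_right _ _))
    calc (k : ℝ) * |η| ^ (-ε₁) ≤ k * |η| ^ (-ε₂) := by gcongr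
      _ ≤ _ := by
        gcongr
        linarith
  · push Not at hbigη
    refine (Law.norm_F_le _ _).trans ?_
    have h1 : |η| ^ ε₂ ≤ H₀ ^ ε₂ := Real.rpow_le_rpow hη0.le hbigη.le hε₂0.le
    have h2 : |η| ^ ε₂ * |η| ^ (-ε₂) = 1 := by rw [← Real.rpow_add hη0, add_neg_cancel, Real.rpow_zero]
    have hk0 : (0 : ℝ) ≤ k := by positivity
    calc (1 : ℝ) = |η| ^ ε₂ * |η| ^ (-ε₂) := h2.symm
      _ ≤ (k + H₀ ^ ε₂) * |η| ^ (-ε₂) := by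
        gcongr
        linarith

end PartNo17

open Set Real

noncomputable section

/-- **Decay of multiplicative convolutions, discrete form.**
For every `δ₀ > 0` there are `k ∈ ℕ` and `ε₂ > 0` depending only on `δ₀` such that for every
`C₀ > 0` there is `C₁ > 0` depending only on `C₀, δ₀` with the following property.  If
`𝒵₁, …, 𝒵_k` are finite sets with `#𝒵_j ≤ C₀ N_𝒵`, `ζ_j : 𝒵_j → [C₀⁻¹, C₀]`, `η ∈ ℝ`
with `|η| > 1`, and for all `σ ∈ [|η|⁻¹, |η|^{-ε₂}]` and all `j` one has
`#{(𝐛,𝐜) ∈ 𝒵_j² : |ζ_j(𝐛) − ζ_j(𝐜)| ≤ σ} ≤ C₀ N_𝒵² σ^{δ₀}`, then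
`|S_k(η)| ≤ C₁ |η|^{-ε₂}` where
`S_k(η) = N_𝒵^{-k} Σ_{𝐛₁ ∈ 𝒵₁, …, 𝐛_k ∈ 𝒵_k} exp(2πiη ζ₁(𝐛₁)⋯ζ_k(𝐛_k))`. -/
theorem mult_conv_decay_discrete (δ₀ : ℝ) (hδ₀ : 0 < δ₀) :
    ∃ (k : ℕ) (ε₂ : ℝ), 0 < ε₂ ∧ ∀ C₀ : ℝ, 0 < C₀ → ∃ C₁ > (0 : ℝ),
      ∀ (α : Type) [DecidableEq α] (Z : Fin k → Finset α) (ζ : Fin k → α → ℝ) (N : ℝ),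
        0 ≤ N →
        (∀ j, ((Z j).card : ℝ) ≤ C₀ * N) →
        (∀ j, ∀ b ∈ Z j, ζ j b ∈ Set.Icc C₀⁻¹ C₀) →
        ∀ η : ℝ, 1 < |η| →
        (∀ σ ∈ Set.Icc |η|⁻¹ (|η| ^ (-ε₂)), ∀ j,
          (Set.ncard {p : α × α | p.1 ∈ Z j ∧ p.2 ∈ Z j ∧ |ζ j p.1 - ζ j p.2| ≤ σ} : ℝ)
            ≤ C₀ * N ^ 2 * σ ^ δ₀) →
        (N ^ k)⁻¹ * ‖∑ b ∈ Fintype.piFinset Z,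
            Complex.exp (Complex.I * ((2 * π * η * ∏ j, ζ j (b j) : ℝ) : ℂ))‖
          ≤ C₁ * |η| ^ (-ε₂) := by
  exact mcdd_aux δ₀ hδ₀

end
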